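/- Let C be a smooth connected projective complex curve which is non-hyperelliptic, non-trigonal, and not a smooth plane quintic. Then the canonical algebra R_K = ⊕_{n≥0} H^0(C, K^n) is Koszul. -/

import Mathlib

open TensorProduct Function

noncomputable section


/-!  ### Graded algebras presented by their components

An ℕ-graded algebra `R = ⊕ₙ Rₙ` over a field `k` (with `R₀ = k`) is presented here through
its graded components, realized as `k`-subspaces `piece n` of an ambient `k`-algebra `A`,
with `1 ∈ piece 0` and `piece m * piece n ⊆ piece (m + n)`.  All notions below (Koszulness,
quadraticity) depend only on the components and the componentwise multiplication maps. -/
structure GradedSystem (k A : Type) [Field k] [Ring A] [Algebra k A] where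
  piece : ℕ → Submodule k A
  one_mem : (1 : A) ∈ piece 0
  mul_mem : ∀ {m n : ℕ} {x y : A}, x ∈ piece m → y ∈ piece n → x * y ∈ piece (m + n)

namespace GradedSystem

variable {k A : Type} [Field k] [Ring A] [Algebra k A] (S : GradedSystem k A)

/-- The componentwise multiplication map `Rₘ ⊗ Rₙ → R_{m+n}`. -/
def mulMap (m n : ℕ) : S.piece m →ₗ[k] S.piece n →ₗ[k] S.piece (m + n) :=
  LinearMap.mk₂ k (fun x y => ⟨(x : A) * (y : A), S.mul_mem x.2 y.2⟩)
    (fun x x' y => Subtype.ext (by simp [add_mul]))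
    (fun c x y => Subtype.ext (by simp [smul_mul_assoc]))
    (fun x y y' => Subtype.ext (by simp [mul_add]))
    (fun c x y => Subtype.ext (by simp [mul_smul_comm]))

/-- Transport of a graded component along an equality of degrees. -/
def cast {m n : ℕ} (h : m = n) : (S.piece m : Type) ≃ₗ[k] S.piece n :=
  LinearEquiv.ofEq _ _ (by rw [h])

/-- The degree-`d` component of the differential
`V_{i+1} ⊗ R(-(i+1)) → V_i ⊗ R(-i)` of a complex of free graded (right) `R`-modules with
`V_i = k^{n i}` generated in degree `i`; the differential is encoded by its
restriction `φ i : V_{i+1} → V_i ⊗ R₁` to the generators (a "matrix of linear forms").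
The degree-`(i+1+d)` component of the map is `V_{i+1} ⊗ R_d → V_i ⊗ R_{d+1}`. -/
def Dmap (n : ℕ → ℕ)
    (φ : ∀ i : ℕ, (Fin (n (i + 1)) → k) →ₗ[k] ((Fin (n i) → k) ⊗[k] S.piece 1))
    (i d : ℕ) :
    ((Fin (n (i + 1)) → k) ⊗[k] S.piece d) →ₗ[k] ((Fin (n i) → k) ⊗[k] S.piece (d + 1)) :=
  (LinearMap.lTensor (Fin (n i) → k)
      ((S.cast (add_comm 1 d)).toLinearMap ∘ₗ TensorProduct.lift (S.mulMap 1 d))) ∘ₗ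
    (TensorProduct.assoc k (Fin (n i) → k) (S.piece 1) (S.piece d)).toLinearMap ∘ₗ
    (LinearMap.rTensor (S.piece d) (φ i))

/-- `S` is connected: the degree-zero component is spanned by the unit, i.e. `R₀ = k`. -/
def ConnectedOne : Prop := S.piece 0 = Submodule.span k {(1 : A)}

/-- `S` is a *Koszul algebra*: `R₀ = k` and the trivial module `k` admits a linear free
resolution `⋯ → V₂ ⊗ R(-2) → V₁ ⊗ R(-1) → R → k → 0` (this is one of the standard
equivalent definitions of Koszulness: `Extⁿ(k, k(-m)) = 0` for `n ≠ m`).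
Exactness is expressed by its graded components: surjectivity of `V₁ ⊗ R_d → R_{d+1}`
(exactness at `R` in positive degrees), injectivity of `V_{i+1} ⊗ R₀ → V_i ⊗ R₁`
(exactness in the lowest degree at each spot), and `range = ker` elsewhere. -/
def IsKoszul : Prop :=
  S.ConnectedOne ∧
  ∃ (n : ℕ → ℕ)
    (φ : ∀ i : ℕ, (Fin (n (i + 1)) → k) →ₗ[k] ((Fin (n i) → k) ⊗[k] S.piece 1)),
    n 0 = 1 ∧
    (∀ d : ℕ, Surjective (S.Dmap n φ 0 d)) ∧
    (∀ i : ℕ, Injective (S.Dmap n φ i 0)) ∧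
    (∀ i d : ℕ, LinearMap.range (S.Dmap n φ (i + 1) d) = LinearMap.ker (S.Dmap n φ i (d + 1)))

/-- `S` is a *quadratic algebra*: `R₀ = k`, `R` is generated by `R₁` and its relations are
generated in degree `2`; equivalently there is an exact sequence
`V₂ ⊗ R(-2) → V₁ ⊗ R(-1) → R → k → 0` (exact at `V₁ ⊗ R(-1)` and at `R`). -/
def IsQuadratic : Prop :=
  S.ConnectedOne ∧
  ∃ (n : ℕ → ℕ)
    (φ : ∀ i : ℕ, (Fin (n (i + 1)) → k) →ₗ[k] ((Fin (n i) → k) ⊗[k] S.piece 1)),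
    n 0 = 1 ∧
    (∀ d : ℕ, Surjective (S.Dmap n φ 0 d)) ∧
    Injective (S.Dmap n φ 0 0) ∧
    (∀ d : ℕ, LinearMap.range (S.Dmap n φ 1 d) = LinearMap.ker (S.Dmap n φ 0 (d + 1)))

end GradedSystem

/-- For `m = 1`, the canonical identification `(k^m) ⊗ M ≃ M`. -/
def oneTensorEquiv {k : Type} [Field k] {m : ℕ} (h : m = 1) (M : Type)
    [AddCommGroup M] [Module k M] : ((Fin m → k) ⊗[k] M) ≃ₗ[k] M :=
  (TensorProduct.congr
      ((LinearEquiv.funCongrLeft k k (finCongr h.symm)).trans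
        (LinearEquiv.funUnique (Fin 1) k k))
      (LinearEquiv.refl k M)).trans (TensorProduct.lid k M)


/-!  ### Smooth connected projective complex curves

A smooth connected projective curve over `ℂ` is (equivalently) presented through its
function field `F` — a finitely generated extension of `ℂ` of transcendence degree 1 —
together with its set of points (= places of `F/ℂ`), each point giving an
order-of-vanishing valuation `ord P : F → ℤ`.  Divisors are finitely supported `ℤ`-valued
functions on points, and `H⁰(C, O(D))` is the Riemann–Roch space of `D`. -/
structure PreCurve where
  /-- the function field of the curve -/
  F : Type
  [fieldF : Field F]
  [algF : Algebra ℂ F]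
  /-- `F` is a finitely generated extension of `ℂ` of transcendence degree 1 -/
  trdeg_one : ∃ x : F, Transcendental ℂ x ∧
    FiniteDimensional (IntermediateField.adjoin ℂ {x}) F
  /-- the (closed) points of the curve -/
  Point : Type
  /-- order of vanishing of a rational function at a point -/
  ord : Point → F → ℤ
  ord_zero' : ∀ P, ord P 0 = 0
  ord_mul : ∀ P, ∀ f g : F, f ≠ 0 → g ≠ 0 → ord P (f * g) = ord P f + ord P g
  ord_add : ∀ P, ∀ f g : F, f ≠ 0 → g ≠ 0 → f + g ≠ 0 →
    min (ord P f) (ord P g) ≤ ord P (f + g)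
  ord_algebraMap : ∀ P, ∀ c : ℂ, c ≠ 0 → ord P (algebraMap ℂ F c) = 0
  /-- every point admits a local uniformizer (the valuation is surjective) -/
  ord_uniformizer : ∀ P, ∃ f : F, f ≠ 0 ∧ ord P f = 1
  /-- a nonzero rational function has only finitely many zeros and poles -/
  ord_finite_support : ∀ f : F, f ≠ 0 → (Function.support fun P => ord P f).Finite
  /-- distinct points are separated by rational functions -/
  ord_separates : ∀ P Q : Point, P ≠ Q → ∃ f : F, f ≠ 0 ∧ 0 < ord P f ∧ ord Q f = 0

attribute [instance] PreCurve.fieldF PreCurve.algF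

namespace PreCurve

variable (C : PreCurve)

/-- Divisors on the curve. -/
abbrev Div := C.Point →₀ ℤ

/-- The divisor of a single point. -/
def pt (P : C.Point) : C.Div := Finsupp.single P 1

/-- The degree of a divisor. -/
def deg (D : C.Div) : ℤ := D.sum fun _ n => n

/-- The Riemann–Roch space `H⁰(C, O(D)) = {f ∈ F | div f + D ≥ 0} ∪ {0}`. -/
def H0 (D : C.Div) : Submodule ℂ C.F where
  carrier := {f : C.F | f = 0 ∨ ∀ P, 0 ≤ C.ord P f + D P}
  zero_mem' := Or.inl rfl
  add_mem' := by
    intro f g hf hg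
    rcases eq_or_ne f 0 with rfl | hf0
    · simpa using hg
    rcases eq_or_ne g 0 with rfl | hg0
    · simpa using hf
    rcases eq_or_ne (f + g) 0 with h0 | h0
    · exact Or.inl h0
    rcases hf with rfl | hf
    · exact absurd rfl hf0
    rcases hg with rfl | hg
    · exact absurd rfl hg0
    refine Or.inr fun P => ?_
    have hmin := C.ord_add P f g hf0 hg0 h0
    rcases le_total (C.ord P f) (C.ord P g) with hle | hle
    · rw [min_eq_left hle] at hmin
      have := hf P; omega
    · rw [min_eq_right hle] at hmin
      have := hg P; omega
  smul_mem' := by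
    intro c f hf
    rcases eq_or_ne c 0 with rfl | hc
    · exact Or.inl (zero_smul ℂ f)
    rcases hf with rfl | hf
    · exact Or.inl (smul_zero c)
    rcases eq_or_ne f 0 with rfl | hf0
    · exact Or.inl (smul_zero c)
    refine Or.inr fun P => ?_
    have hmap : (algebraMap ℂ C.F c) ≠ 0 := fun h =>
      hc ((algebraMap ℂ C.F).injective (by rw [h, map_zero]))
    have hsm : c • f = algebraMap ℂ C.F c * f := Algebra.smul_def c f
    rw [hsm, C.ord_mul P _ f hmap hf0, C.ord_algebraMap P c hc]
    simpa using hf P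

theorem mem_H0 {D : C.Div} {f : C.F} :
    f ∈ C.H0 D ↔ (f = 0 ∨ ∀ P, 0 ≤ C.ord P f + D P) := Iff.rfl

/-- `h⁰(D) = dim H⁰(C, O(D))`. -/
def h0 (D : C.Div) : ℕ := Module.finrank ℂ (C.H0 D)

theorem H0_mono {D E : C.Div} (h : ∀ P, D P ≤ E P) : C.H0 D ≤ C.H0 E := by
  intro f hf
  rcases (C.mem_H0.mp hf) with rfl | hf
  · exact (C.H0 E).zero_mem
  · exact C.mem_H0.mpr (Or.inr fun P => by have := h P; have := hf P; omega)

theorem mul_mem_H0 {D E : C.Div} {f g : C.F} (hf : f ∈ C.H0 D) (hg : g ∈ C.H0 E) :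
    f * g ∈ C.H0 (D + E) := by
  rcases (C.mem_H0.mp hf) with rfl | hf
  · exact C.mem_H0.mpr (Or.inl (zero_mul g))
  rcases (C.mem_H0.mp hg) with rfl | hg
  · exact C.mem_H0.mpr (Or.inl (mul_zero f))
  rcases eq_or_ne f 0 with rfl | hf0
  · exact C.mem_H0.mpr (Or.inl (zero_mul g))
  rcases eq_or_ne g 0 with rfl | hg0
  · exact C.mem_H0.mpr (Or.inl (mul_zero f))
  refine C.mem_H0.mpr (Or.inr fun P => ?_)
  rw [C.ord_mul P f g hf0 hg0, Finsupp.add_apply]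
  have := hf P; have := hg P; omega

/-- Multiplication of sections, `H⁰(D) ⊗ H⁰(E) → H⁰(D + E)`, as a bilinear map. -/
def mulH0 (D E : C.Div) : C.H0 D →ₗ[ℂ] C.H0 E →ₗ[ℂ] C.H0 (D + E) :=
  LinearMap.mk₂ ℂ (fun f g => ⟨(f : C.F) * (g : C.F), C.mul_mem_H0 f.2 g.2⟩)
    (fun f f' g => Subtype.ext (by simp [add_mul]))
    (fun c f g => Subtype.ext (by simp [smul_mul_assoc]))
    (fun f g g' => Subtype.ext (by simp [mul_add]))
    (fun c f g => Subtype.ext (by simp [mul_smul_comm]))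

/-- Transport of `H⁰` along an equality of divisors. -/
def castH0 {D E : C.Div} (h : D = E) : (C.H0 D : Type) ≃ₗ[ℂ] C.H0 E :=
  LinearEquiv.ofEq _ _ (by rw [h])

/-- The multiplication map `H⁰(D) ⊗ H⁰(E) → H⁰(G)` for `G = D + E`. -/
def mulTo (D E G : C.Div) (h : D + E = G) : (C.H0 D ⊗[ℂ] C.H0 E) →ₗ[ℂ] C.H0 G :=
  (C.castH0 h).toLinearMap ∘ₗ TensorProduct.lift (C.mulH0 D E)

/-- The inclusion `H⁰(D) ⊆ H⁰(E)` for `D ≤ E`. -/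
def inclH0 {D E : C.Div} (h : ∀ P, D P ≤ E P) : (C.H0 D : Type) →ₗ[ℂ] C.H0 E :=
  Submodule.inclusion (C.H0_mono h)

/-- Multiplication by a fixed section `a ∈ H⁰(E)`, as a map `H⁰(M) → H⁰(E + M)`. -/
def mulBy {E : C.Div} (a : C.F) (ha : a ∈ C.H0 E) (M : C.Div) :
    (C.H0 M : Type) →ₗ[ℂ] C.H0 (E + M) :=
  C.mulH0 E M ⟨a, ha⟩

/-- The reduced effective divisor attached to a finite set of points. -/
def divOfFinset (s : Finset C.Point) : C.Div := ∑ P ∈ s, C.pt P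

/-- The divisor of a nonzero rational function. -/
def divOf (f : C.F) : C.Div := by
  classical
  exact if h : f = 0 then 0
    else Finsupp.ofSupportFinite (fun P => C.ord P f) (C.ord_finite_support f h)

/-- Linear equivalence of divisors. -/
def LinEquiv (D E : C.Div) : Prop := ∃ f : C.F, f ≠ 0 ∧ D - E = C.divOf f

end PreCurve

/-- A smooth connected projective complex curve: the data of `PreCurve` together with
properness (principal divisors have degree zero), finite–dimensionality of Riemann–Roch
spaces, `H⁰(O) = ℂ`, a canonical divisor `K`, and the genus, tied together by the
Riemann–Roch theorem (in its Serre-duality form `h⁰(D) − h⁰(K−D) = deg D + 1 − g`). -/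
structure Curve extends PreCurve where
  deg_principal : ∀ f : toPreCurve.F, f ≠ 0 → (∑ᶠ P, toPreCurve.ord P f) = 0
  finiteDim : ∀ D : toPreCurve.Div, FiniteDimensional ℂ (toPreCurve.H0 D)
  h0_triv : toPreCurve.h0 0 = 1
  /-- a canonical divisor (class) of the curve -/
  K : toPreCurve.Div
  /-- the genus of the curve -/
  genus : ℕ
  riemann_roch : ∀ D : toPreCurve.Div,
    (toPreCurve.h0 D : ℤ) - toPreCurve.h0 (K - D) = toPreCurve.deg D + 1 - genus

namespace Curve

variable (C : Curve)

/-- `h¹(D)`, via Serre duality. -/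
def h1 (D : C.Div) : ℕ := C.h0 (C.K - D)

/-- The complete linear system `|D|` is base-point free. -/
def BasePointFree (D : C.Div) : Prop := ∀ P : C.Point, C.h0 (D - C.pt P) + 1 = C.h0 D

/-- `|D|` is a base-point-free pencil (base-point free of projective dimension 1). -/
def IsBPFPencil (D : C.Div) : Prop := C.BasePointFree D ∧ C.h0 D = 2

/-- `C` is hyperelliptic: it carries a `g¹₂`. -/
def Hyperelliptic : Prop := ∃ D : C.Div, C.deg D = 2 ∧ 2 ≤ C.h0 D

/-- `C` is trigonal: it admits a degree-3 map to `ℙ¹`. -/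
def Trigonal : Prop := ∃ D : C.Div, C.deg D = 3 ∧ 2 ≤ C.h0 D ∧ C.BasePointFree D

/-- `D` is very ample (it separates points and tangent vectors). -/
def VeryAmple (D : C.Div) : Prop :=
  ∀ P Q : C.Point, C.h0 (D - C.pt P - C.pt Q) + 2 = C.h0 D

/-- `C` is a smooth plane quintic: it carries a very ample `g²₅`. -/
def IsPlaneQuintic : Prop := ∃ D : C.Div, C.deg D = 5 ∧ C.h0 D = 3 ∧ C.VeryAmple D

/-- The homogeneous coordinate algebra `R_L = ⊕ₙ H⁰(C, Lⁿ)` of a divisor (class) `L`,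
as a graded system inside the function field. -/
def RL (L : C.Div) : GradedSystem ℂ C.F where
  piece n := C.H0 (n • L)
  one_mem := by
    refine C.mem_H0.mpr (Or.inr fun P => ?_)
    have h1 : C.ord P 1 = 0 := by
      simpa using C.ord_algebraMap P 1 one_ne_zero
    simp [h1]
  mul_mem := by
    intro m n x y hx hy
    have h := C.mul_mem_H0 hx hy
    show x * y ∈ C.H0 ((m + n) • L)
    rwa [add_smul]

/-- The embedding given by the complete linear system `|L|` is projectively normal:
`R_L` is generated in degree one (equivalently, `Symⁿ H⁰(L) → H⁰(Lⁿ)` is surjective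
for all `n`). -/
def ProjectivelyNormal (L : C.Div) : Prop :=
  ∀ n : ℕ, Surjective
    (C.mulTo L (n • L) ((n + 1) • L) ((add_comm L (n • L)).trans (succ_nsmul L n).symm))

end Curve

/-- The homology of a (two-step) complex `X → Y → Z` at `Y`. -/
def homol {X Y Z : Type} [AddCommGroup X] [AddCommGroup Y] [AddCommGroup Z]
    [Module ℂ X] [Module ℂ Y] [Module ℂ Z] (f : X →ₗ[ℂ] Y) (g : Y →ₗ[ℂ] Z) : Type :=
  ↥(LinearMap.ker g) ⧸ Submodule.comap (LinearMap.ker g).subtype (LinearMap.range f)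


namespace GradedSystem

variable {k F : Type} [Field k] [Field F] [Algebra k F] (S : GradedSystem k F)

/-- The syzygies of a finite family `p` in an `F`-module, graded so that linear syzygies
have degree `0`. -/
def Syz {ι M : Type} [Fintype ι] [AddCommGroup M] [Module F M] (p : ι → M) (n : ℕ) :
    AddSubgroup (ι → F) where
  carrier := {z | (∀ i, z i ∈ S.piece (n + 1)) ∧ ∑ i, z i • p i = 0}
  zero_mem' := ⟨fun _ => zero_mem _, by simp⟩
  add_mem' := by
    rintro a b ⟨ha, ha'⟩ ⟨hb, hb'⟩
    exact ⟨fun i => add_mem (ha i) (hb i), by simp [add_smul, Finset.sum_add_distrib, ha', hb']⟩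
  neg_mem' := by
    rintro a ⟨ha, ha'⟩
    exact ⟨fun i => neg_mem (ha i), by simp [ha']⟩

/-- `p` is a minimal system of generators, placed in degree `0`, of the graded family `P`. -/
structure MinGen {ι M : Type} [Fintype ι] [AddCommGroup M] [Module F M]
    (p : ι → M) (P : ℕ → AddSubgroup M) : Prop where
  mem_iff : ∀ n m, m ∈ P n ↔ ∃ z : ι → F, (∀ i, z i ∈ S.piece n) ∧ ∑ i, z i • p i = m
  indep : ∀ z : ι → F, (∀ i, z i ∈ S.piece 0) → ∑ i, z i • p i = 0 → z = 0

/-- The graded family `P` has a free resolution which is linear for its first steps. -/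
def Lin : ℕ → (M : Type) → [AddCommGroup M] → [Module F M] → (ℕ → AddSubgroup M) → Prop
  | 0, M, _, _, P => ∃ (ι : Type) (_ : Fintype ι) (p : ι → M), S.MinGen p P
  | i + 1, M, _, _, P => ∃ (ι : Type) (_ : Fintype ι) (p : ι → M), S.MinGen p P ∧
      Lin i (ι → F) (S.Syz p)

variable {S}
variable {M M' M'' : Type} [AddCommGroup M] [Module F M] [AddCommGroup M'] [Module F M']
  [AddCommGroup M''] [Module F M'']

theorem mem_syz {ι : Type} [Fintype ι] {p : ι → M} {n : ℕ} {z : ι → F} :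
    z ∈ S.Syz p n ↔ (∀ i, z i ∈ S.piece (n + 1)) ∧ ∑ i, z i • p i = 0 := Iff.rfl

theorem MinGen.mem {ι : Type} [Fintype ι] {p : ι → M} {P : ℕ → AddSubgroup M}
    (h : S.MinGen p P) (i : ι) : p i ∈ P 0 := by
  classical
  rw [h.mem_iff]
  refine ⟨Pi.single i 1, fun j => ?_, by simp [Pi.single_apply, ite_smul]⟩
  by_cases hj : j = i
  · subst hj; simpa using S.one_mem
  · simp [hj]

/-- A short exact sequence of graded families. -/
structure SES (P' : ℕ → AddSubgroup M') (P : ℕ → AddSubgroup M) (P'' : ℕ → AddSubgroup M'')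
    (j : M' →ₗ[F] M) (π : M →ₗ[F] M'') : Prop where
  inj : Injective j
  map_mem : ∀ n x, x ∈ P' n → j x ∈ P n
  comp : ∀ n x, x ∈ P' n → π (j x) = 0
  exact : ∀ n x, x ∈ P n → π x = 0 → ∃ y ∈ P' n, j y = x
  map_mem' : ∀ n x, x ∈ P n → π x ∈ P'' n
  surj : ∀ n y, y ∈ P'' n → ∃ x ∈ P n, π x = y

variable (S) in
/-- The family `P` is stable under the action of the graded algebra. -/
def Stable (P : ℕ → AddSubgroup M) : Prop :=
  ∀ n r x, r ∈ S.piece n → x ∈ P 0 → r • x ∈ P n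

theorem MinGen.ext {ι' ι'' : Type} [Fintype ι'] [Fintype ι''] {p' : ι' → M'} {p'' : ι'' → M''}
    {P' : ℕ → AddSubgroup M'} {P : ℕ → AddSubgroup M} {P'' : ℕ → AddSubgroup M''}
    {j : M' →ₗ[F] M} {π : M →ₗ[F] M''} (hs : SES P' P P'' j π) (hP : S.Stable P)
    (h' : S.MinGen p' P') (h'' : S.MinGen p'' P'') {l : ι'' → M} (hl : ∀ i, l i ∈ P 0)
    (hl' : ∀ i, π (l i) = p'' i) : S.MinGen (Sum.elim (j ∘ p') l) P := by
  have hπ : ∀ (z' : ι' → F), π (∑ i, z' i • j (p' i)) = 0 := by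
    intro z'
    rw [map_sum]
    refine Finset.sum_eq_zero fun i _ => ?_
    rw [map_smul, hs.comp 0 _ (h'.mem i), smul_zero]
  have hπ' : ∀ (z : ι'' → F), π (∑ i, z i • l i) = ∑ i, z i • p'' i := by
    intro z; simp [map_sum, hl']
  have hj : ∀ (z' : ι' → F), ∑ i, z' i • j (p' i) = j (∑ i, z' i • p' i) := by
    intro z; simp [map_sum]
  refine ⟨fun n m => ⟨fun hm => ?_, ?_⟩, ?_⟩
  · obtain ⟨z, hz, hz'⟩ := (h''.mem_iff n _).1 (hs.map_mem' n m hm)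
    have hmem : m - ∑ i, z i • l i ∈ P n :=
      sub_mem hm (sum_mem fun i _ => hP n _ _ (hz i) (hl i))
    obtain ⟨y, hy, hy'⟩ := hs.exact n _ hmem (by rw [map_sub, hπ', hz', sub_self])
    obtain ⟨w, hw, hw'⟩ := (h'.mem_iff n _).1 hy
    refine ⟨Sum.elim w z, by rintro (i | i) <;> simp [hw, hz], ?_⟩
    simp only [Fintype.sum_sum_type, Sum.elim_inl, Sum.elim_inr, Function.comp]
    rw [hj, hw', hy']; abel
  · rintro ⟨z, hz, rfl⟩
    simp only [Fintype.sum_sum_type, Sum.elim_inl, Sum.elim_inr, Function.comp]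
    exact add_mem (sum_mem fun i _ => hP n _ _ (hz _) (hs.map_mem 0 _ (h'.mem i)))
      (sum_mem fun i _ => hP n _ _ (hz _) (hl i))
  · intro z hz h0
    simp only [Fintype.sum_sum_type, Sum.elim_inl, Sum.elim_inr, Function.comp] at h0
    have h1 := congrArg π h0
    rw [map_add, hπ (fun i => z (Sum.inl i)), hπ' (fun i => z (Sum.inr i)), zero_add,
      map_zero] at h1
    have h2 := h''.indep _ (fun i => hz (Sum.inr i)) h1
    have h3 : ∀ i, z (Sum.inr i) = 0 := fun i => congrFun h2 i
    simp only [h3, zero_smul, Finset.sum_const_zero, add_zero] at h0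
    rw [hj (fun i => z (Sum.inl i))] at h0
    have h4 := h'.indep _ (fun i => hz (Sum.inl i)) (hs.inj (by rw [h0, map_zero]))
    funext i
    rcases i with i | i
    · exact congrFun h4 i
    · exact h3 i

variable (F) in
/-- Extension of a tuple by zero. -/
def inlMap (ι' ι'' : Type) : (ι' → F) →ₗ[F] (ι' ⊕ ι'' → F) where
  toFun z := Sum.elim z 0
  map_add' a b := by ext (i | i) <;> simp
  map_smul' a b := by ext (i | i) <;> simp

variable (F) in
/-- Restriction of a tuple to the second summand. -/
def inrMap (ι' ι'' : Type) : (ι' ⊕ ι'' → F) →ₗ[F] (ι'' → F) where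
  toFun z := fun i => z (Sum.inr i)
  map_add' _ _ := rfl
  map_smul' _ _ := rfl

theorem inlMap_injective (ι' ι'' : Type) : Injective (inlMap F ι' ι'') := by
  intro a b h
  funext i
  exact congrFun h (Sum.inl i)

theorem syz_stable {ι : Type} [Fintype ι] (p : ι → M) : S.Stable (S.Syz p) := by
  rintro n r x hr ⟨hx, hx'⟩
  refine ⟨fun i => ?_, ?_⟩
  · have := S.mul_mem hr (hx i)
    simpa using this
  · simp only [Pi.smul_apply, smul_assoc, ← Finset.smul_sum, hx', smul_zero]

theorem SES.syz {ι' ι'' : Type} [Fintype ι'] [Fintype ι''] {p' : ι' → M'} {p'' : ι'' → M''}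
    {P' : ℕ → AddSubgroup M'} {P : ℕ → AddSubgroup M} {P'' : ℕ → AddSubgroup M''}
    {j : M' →ₗ[F] M} {π : M →ₗ[F] M''} (hs : SES P' P P'' j π) (hP : S.Stable P)
    (h' : S.MinGen p' P') {l : ι'' → M} (hl : ∀ i, l i ∈ P 0)
    (hl' : ∀ i, π (l i) = p'' i) :
    SES (S.Syz p') (S.Syz (Sum.elim (j ∘ p') l)) (S.Syz p'') (inlMap F ι' ι'')
      (inrMap F ι' ι'') := by
  have hπ : ∀ (z' : ι' → F), π (∑ i, z' i • j (p' i)) = 0 := by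
    intro z'
    rw [map_sum]
    refine Finset.sum_eq_zero fun i _ => ?_
    rw [map_smul, hs.comp 0 _ (h'.mem i), smul_zero]
  have hπ' : ∀ (z : ι'' → F), π (∑ i, z i • l i) = ∑ i, z i • p'' i := by
    intro z; simp [map_sum, hl']
  have hj : ∀ (z' : ι' → F), ∑ i, z' i • j (p' i) = j (∑ i, z' i • p' i) := by
    intro z; simp [map_sum]
  refine ⟨inlMap_injective _ _, ?_, ?_, ?_, ?_, ?_⟩
  · rintro n x ⟨hx, hx'⟩
    refine ⟨by rintro (i | i) <;> simp [inlMap, hx], ?_⟩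
    simp [Fintype.sum_sum_type, inlMap, hj, hx']
  · rintro n x -
    rfl
  · rintro n x ⟨hx, hx'⟩ h0
    have h3 : ∀ i, x (Sum.inr i) = 0 := fun i => congrFun h0 i
    refine ⟨fun i => x (Sum.inl i), ⟨fun i => hx _, ?_⟩, ?_⟩
    · simp only [Fintype.sum_sum_type, Sum.elim_inl, Sum.elim_inr, Function.comp, h3, zero_smul,
        Finset.sum_const_zero, add_zero] at hx'
      rw [hj (fun i => x (Sum.inl i))] at hx'
      exact hs.inj (by rw [hx', map_zero])
    · funext i
      rcases i with i | i
      · rfl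
      · exact (h3 i).symm
  · rintro n x ⟨hx, hx'⟩
    refine ⟨fun i => hx _, ?_⟩
    have h1 := congrArg π hx'
    simp only [Fintype.sum_sum_type, Sum.elim_inl, Sum.elim_inr, Function.comp] at h1
    rwa [map_add, hπ (fun i => x (Sum.inl i)), hπ' (fun i => x (Sum.inr i)), zero_add,
      map_zero] at h1
  · rintro n y ⟨hy, hy'⟩
    have hmem : ∑ i, y i • l i ∈ P (n + 1) := sum_mem fun i _ => hP _ _ _ (hy i) (hl i)
    obtain ⟨x, hx, hxy⟩ := hs.exact _ _ hmem (by rw [hπ', hy'])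
    obtain ⟨w, hw, hw'⟩ := (h'.mem_iff _ _).1 hx
    refine ⟨Sum.elim (-w) y, ⟨by rintro (i | i) <;> simp [hw, hy], ?_⟩, rfl⟩
    simp [Fintype.sum_sum_type, hj, hw', hxy]

theorem Lin.ext (i : ℕ) : ∀ {M M' M'' : Type} [AddCommGroup M] [Module F M] [AddCommGroup M']
    [Module F M'] [AddCommGroup M''] [Module F M'']
    {P' : ℕ → AddSubgroup M'} {P : ℕ → AddSubgroup M} {P'' : ℕ → AddSubgroup M''}
    {j : M' →ₗ[F] M} {π : M →ₗ[F] M''}, SES P' P P'' j π → S.Stable P →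
    S.Lin i M' P' → S.Lin i M'' P'' → S.Lin i M P := by
  induction i with
  | zero =>
    rintro M M' M'' _ _ _ _ _ _ P' P P'' j π hs hP ⟨ι', _, p', h'⟩ ⟨ι'', _, p'', h''⟩
    choose l hl hl' using fun i => hs.surj 0 _ (h''.mem i)
    exact ⟨_, inferInstance, _, MinGen.ext hs hP h' h'' hl hl'⟩
  | succ i ih =>
    rintro M M' M'' _ _ _ _ _ _ P' P P'' j π hs hP ⟨ι', _, p', h', g'⟩ ⟨ι'', _, p'', h'', g''⟩
    choose l hl hl' using fun i => hs.surj 0 _ (h''.mem i)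
    exact ⟨_, inferInstance, _, MinGen.ext hs hP h' h'' hl hl',
      ih (SES.syz hs hP h' hl hl') (syz_stable _) g' g''⟩

theorem Lin.bot (i : ℕ) : ∀ {M : Type} [AddCommGroup M] [Module F M],
    S.Lin i M (fun _ => ⊥) := by
  have key : ∀ {M : Type} [AddCommGroup M] [Module F M],
      S.MinGen (fun i : Empty => (i.elim : M)) (fun _ => ⊥) := by
    intro M _ _
    refine ⟨fun n m => ?_, fun z _ _ => by funext i; exact i.elim⟩
    simp only [AddSubgroup.mem_bot, Finset.univ_eq_empty, Finset.sum_empty]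
    exact ⟨fun h => ⟨fun i => i.elim, fun i => i.elim, h.symm⟩, fun ⟨_, _, h⟩ => h.symm⟩
  induction i with
  | zero => intro M _ _; exact ⟨_, inferInstance, _, key⟩
  | succ i ih =>
    intro M _ _
    refine ⟨_, inferInstance, _, key, ?_⟩
    have : S.Syz (fun i : Empty => (i.elim : M)) = fun _ => ⊥ := by
      funext n
      ext z
      simp only [AddSubgroup.mem_bot]
      exact ⟨fun _ => by funext i; exact i.elim, fun h => h ▸ zero_mem _⟩
    rw [this]
    exact ih

theorem Lin.map (i : ℕ) {P' : ℕ → AddSubgroup M'} {P : ℕ → AddSubgroup M}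
    (j : M' →ₗ[F] M) (hj : Injective j) (hm : ∀ n x, x ∈ P n ↔ ∃ y ∈ P' n, j y = x)
    (hP : S.Stable P) (h : S.Lin i M' P') : S.Lin i M P := by
  refine Lin.ext (M'' := F) (P'' := fun _ => ⊥) (π := 0) i (j := j) ⟨hj, ?_, ?_, ?_, ?_, ?_⟩ hP h
    (Lin.bot i)
  · intro n x hx; exact (hm n _).2 ⟨x, hx, rfl⟩
  · intro n x hx; rfl
  · intro n x hx _; exact (hm n x).1 hx
  · intro n x _; exact AddSubgroup.mem_bot.2 rfl
  · intro n y hy; exact ⟨0, zero_mem _, by simpa using (AddSubgroup.mem_bot.1 hy).symm⟩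

/-- Linearity of the syzygies does not depend on the choice of minimal generators. -/
theorem Lin.syz_of_minGen (i : ℕ) {ι κ : Type} [Fintype ι] [Fintype κ] {p : ι → M} {q : κ → M}
    {P : ℕ → AddSubgroup M} (hp : S.MinGen p P) (hq : S.MinGen q P)
    (h : S.Lin i (ι → F) (S.Syz p)) : S.Lin i (κ → F) (S.Syz q) := by
  classical
  choose c hc hc' using fun i => (hq.mem_iff 0 _).1 (hp.mem i)
  choose d hd hd' using fun i => (hp.mem_iff 0 _).1 (hq.mem i)
  have mul0 : ∀ {n : ℕ} {a b : F}, a ∈ S.piece n → b ∈ S.piece 0 → a * b ∈ S.piece n := by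
    intro n a b ha hb; simpa using S.mul_mem ha hb
  have one0 : ∀ {ι : Type} [DecidableEq ι] (i j : ι), (1 : Matrix ι ι F) i j ∈ S.piece 0 := by
    intro ι _ i j
    rw [Matrix.one_apply]; split_ifs
    · exact S.one_mem
    · exact zero_mem _
  have hcd : ∀ a b, ∑ x, c a x * d x b = (1 : Matrix ι ι F) a b := by
    intro a b
    have := hp.indep (fun b => ∑ x, c a x * d x b - (1 : Matrix ι ι F) a b)
      (fun b => sub_mem (sum_mem fun x _ => mul0 (hc a x) (hd x b)) (one0 a b)) (by
        simp only [sub_smul, Finset.sum_sub_distrib, Finset.sum_smul]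
        rw [Finset.sum_comm]
        simp only [mul_smul, ← Finset.smul_sum, hd', hc']
        simp [Matrix.one_apply, ite_smul])
    exact sub_eq_zero.1 (congrFun this b)
  have hdc : ∀ a b, ∑ x, d a x * c x b = (1 : Matrix κ κ F) a b := by
    intro a b
    have := hq.indep (fun b => ∑ x, d a x * c x b - (1 : Matrix κ κ F) a b)
      (fun b => sub_mem (sum_mem fun x _ => mul0 (hd a x) (hc x b)) (one0 a b)) (by
        simp only [sub_smul, Finset.sum_sub_distrib, Finset.sum_smul]
        rw [Finset.sum_comm]
        simp only [mul_smul, ← Finset.smul_sum, hd', hc']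
        simp [Matrix.one_apply, ite_smul])
    exact sub_eq_zero.1 (congrFun this b)
  have eC : (Matrix.of c) * (Matrix.of d) = 1 := by
    ext a b; rw [Matrix.mul_apply]; exact hcd a b
  have eD : (Matrix.of d) * (Matrix.of c) = 1 := by
    ext a b; rw [Matrix.mul_apply]; exact hdc a b
  have vm : ∀ (z : ι → F), ∑ b, (Matrix.vecMul z (Matrix.of c)) b • q b = ∑ a, z a • p a := by
    intro z
    simp only [Matrix.vecMul, dotProduct, Finset.sum_smul, Matrix.of_apply]
    rw [Finset.sum_comm]
    simp only [mul_smul, ← Finset.smul_sum, hc']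
  have vm' : ∀ (z : κ → F), ∑ b, (Matrix.vecMul z (Matrix.of d)) b • p b = ∑ a, z a • q a := by
    intro z
    simp only [Matrix.vecMul, dotProduct, Finset.sum_smul, Matrix.of_apply]
    rw [Finset.sum_comm]
    simp only [mul_smul, ← Finset.smul_sum, hd']
  refine Lin.map i (Matrix.vecMulLinear (Matrix.of c)) ?_ ?_ (syz_stable q) h
  · intro x y hxy
    have : Matrix.vecMul (Matrix.vecMul x (Matrix.of c)) (Matrix.of d) =
      Matrix.vecMul (Matrix.vecMul y (Matrix.of c)) (Matrix.of d) := congrArg (fun t => Matrix.vecMul t (Matrix.of d)) hxy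
    rwa [Matrix.vecMul_vecMul, Matrix.vecMul_vecMul, eC, Matrix.vecMul_one,
      Matrix.vecMul_one] at this
  · intro n x
    constructor
    · rintro ⟨hx, hx'⟩
      refine ⟨Matrix.vecMul x (Matrix.of d), ⟨fun a => ?_, by rw [vm', hx']⟩, ?_⟩
      · exact sum_mem fun b _ => mul0 (hx b) (hd b a)
      · show Matrix.vecMul (Matrix.vecMul x (Matrix.of d)) (Matrix.of c) = x
        rw [Matrix.vecMul_vecMul, eD, Matrix.vecMul_one]
    · rintro ⟨y, ⟨hy, hy'⟩, rfl⟩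
      refine ⟨fun a => sum_mem fun b _ => mul0 (hy b) (hc b a), ?_⟩
      exact (vm y).trans hy'

end GradedSystem

namespace GradedSystem

variable {k F : Type} [Field k] [Field F] [Algebra k F] {S : GradedSystem k F}
variable {M : Type} [AddCommGroup M] [Module F M]

/-- Adding one generator to a module; `Q` is the corresponding colon ideal. -/
theorem Lin.add_generator (i : ℕ) {P' P : ℕ → AddSubgroup M} {Q : ℕ → AddSubgroup F} (c : M)
    (hP : S.Stable P) (hle : ∀ n x, x ∈ P' n → x ∈ P n) (hc : c ∈ P 0)
    (hind : ∀ r ∈ S.piece 0, r • c ∈ P' 0 → r = 0)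
    (hgen : ∀ n, ∀ x ∈ P n, ∃ r ∈ S.piece n, x - r • c ∈ P' n)
    (hQ : ∀ n r, r ∈ Q n ↔ r ∈ S.piece (n + 1) ∧ r • c ∈ P' (n + 1))
    (h : S.Lin (i + 1) M P') (hlin : S.Lin i F Q) : S.Lin (i + 1) M P := by
  obtain ⟨ι, _, p, hp, hs⟩ := h
  have hm : S.MinGen (Sum.elim p (fun _ : Unit => c)) P := by
    refine ⟨fun n m => ⟨fun hm => ?_, ?_⟩, ?_⟩
    · obtain ⟨r, hr, hr'⟩ := hgen n m hm
      obtain ⟨z, hz, hz'⟩ := (hp.mem_iff _ _).1 hr'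
      exact ⟨Sum.elim z (fun _ => r), by rintro (i | i) <;> simp [hz, hr], by simp [hz']⟩
    · rintro ⟨z, hz, rfl⟩
      refine sum_mem fun a _ => hP _ _ _ (hz a) ?_
      rcases a with a | a
      · exact hle _ _ (hp.mem a)
      · exact hc
    · intro z hz h0
      simp only [Fintype.sum_sum_type, Sum.elim_inl, Sum.elim_inr, Finset.univ_unique,
        Finset.sum_singleton] at h0
      have h1 : z (Sum.inr default) = 0 := by
        refine hind _ (hz _) ?_
        rw [← neg_eq_iff_add_eq_zero] at h0
        rw [← h0]
        exact neg_mem ((hp.mem_iff _ _).2 ⟨_, fun a => hz (Sum.inl a), rfl⟩)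
      rw [h1, zero_smul, add_zero] at h0
      have h2 := hp.indep _ (fun a => hz (Sum.inl a)) h0
      funext a
      rcases a with a | a
      · exact congrFun h2 a
      · exact h1
  refine ⟨_, inferInstance, _, hm, ?_⟩
  refine Lin.ext (j := inlMap F ι Unit) (π := LinearMap.proj (Sum.inr ())) i
    ⟨inlMap_injective _ _, ?_, ?_, ?_, ?_, ?_⟩ (syz_stable _) hs hlin
  · rintro n x ⟨hx, hx'⟩
    refine ⟨by rintro (i | i) <;> simp [inlMap, hx], ?_⟩
    simp [Fintype.sum_sum_type, inlMap, hx']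
  · rintro n x -
    rfl
  · rintro n x ⟨hx, hx'⟩ h0
    have h3 : x (Sum.inr ()) = 0 := h0
    refine ⟨fun i => x (Sum.inl i), ⟨fun i => hx _, ?_⟩, ?_⟩
    · simpa [Fintype.sum_sum_type, h3] using hx'
    · funext i
      rcases i with i | i
      · rfl
      · exact h3.symm
  · rintro n x ⟨hx, hx'⟩
    refine (hQ _ _).2 ⟨hx _, ?_⟩
    simp only [Fintype.sum_sum_type, Sum.elim_inl, Sum.elim_inr, Finset.univ_unique,
        Finset.sum_singleton] at hx'
    rw [← neg_eq_iff_add_eq_zero] at hx'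
    show x (Sum.inr ()) • c ∈ _
    have : x (Sum.inr ()) • c = x (Sum.inr default) • c := rfl
    rw [this, ← hx']
    exact neg_mem ((hp.mem_iff _ _).2 ⟨_, fun a => hx (Sum.inl a), rfl⟩)
  · intro n r hr
    obtain ⟨hr, hr'⟩ := (hQ _ _).1 hr
    obtain ⟨z, hz, hz'⟩ := (hp.mem_iff _ _).1 hr'
    refine ⟨Sum.elim (-z) (fun _ => r), ⟨by rintro (i | i) <;> simp [hz, hr], ?_⟩, rfl⟩
    simp [hz']

theorem mul_le_mul_left_sub {L L' N : Submodule k F} (h : L ≤ L') : L * N ≤ L' * N :=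
  mul_le_mul h le_rfl bot_le bot_le

variable (S) in
/-- The graded ideal generated by a space `L` of linear forms. -/
def idl (L : Submodule k F) (n : ℕ) : AddSubgroup F := (L * S.piece n).toAddSubgroup

theorem mem_idl {L : Submodule k F} {n : ℕ} {x : F} : x ∈ S.idl L n ↔ x ∈ L * S.piece n := Iff.rfl

theorem piece_zero_mul (h0 : S.ConnectedOne) (L : Submodule k F) : L * S.piece 0 = L := by
  rw [h0, ← Submodule.one_eq_span, mul_one]

theorem idl_stable (h0 : S.ConnectedOne) (L : Submodule k F) : S.Stable (S.idl L) := by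
  intro n r x hr hx
  rw [mem_idl, piece_zero_mul h0] at hx
  rw [mem_idl, smul_eq_mul, mul_comm r x]
  exact Submodule.mul_mem_mul hx hr

theorem minGen_idl (h0 : S.ConnectedOne) {ι : Type} [Fintype ι] {L : Submodule k F}
    (b : Module.Basis ι k L) : S.MinGen (fun i => (b i : F)) (S.idl L) := by
  classical
  have hL : L = Submodule.span k (Set.range fun i => (b i : F)) := by
    have := congrArg (Submodule.map L.subtype) b.span_eq
    rw [Submodule.map_span, Submodule.map_top, Submodule.range_subtype, ← Set.range_comp] at this
    exact this.symm
  refine ⟨fun n m => ⟨fun hm => ?_, ?_⟩, ?_⟩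
  · rw [mem_idl] at hm
    induction hm using Submodule.mul_induction_on' with
    | mem_mul_mem x hx y hy =>
      refine ⟨fun i => b.repr ⟨x, hx⟩ i • y, fun i => Submodule.smul_mem _ _ hy, ?_⟩
      have := congrArg Subtype.val (b.sum_repr ⟨x, hx⟩)
      simp only [AddSubmonoidClass.coe_finsetSum, Submodule.coe_smul] at this
      refine Eq.trans ?_ (congrArg (· * y) this)
      simp only [Finset.sum_mul]
      refine Finset.sum_congr rfl fun i _ => ?_
      simp [mul_comm]
    | add x _ y _ hx hy =>
      obtain ⟨z, hz, rfl⟩ := hx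
      obtain ⟨w, hw, rfl⟩ := hy
      exact ⟨z + w, fun i => add_mem (hz i) (hw i), by simp [add_mul, Finset.sum_add_distrib]⟩
  · rintro ⟨z, hz, rfl⟩
    refine sum_mem fun i _ => ?_
    rw [mem_idl, smul_eq_mul, mul_comm (z i)]
    exact Submodule.mul_mem_mul (b i).2 (hz i)
  · intro z hz h
    rw [h0] at hz
    choose c hc using fun i => Submodule.mem_span_singleton.1 (hz i)
    have h1 : ∑ i, c i • b i = 0 := by
      apply Subtype.ext
      simp only [AddSubmonoidClass.coe_finsetSum, Submodule.coe_smul, ZeroMemClass.coe_zero]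
      rw [← h]
      refine Finset.sum_congr rfl fun i _ => ?_
      rw [← hc]; simp
    have h2 := Fintype.linearIndependent_iff.1 b.linearIndependent c h1
    funext i
    rw [← hc, h2]; simp

/-- If a net of linear forms with linear resolution generates an ideal of colength one in degree
two, is everything in higher degrees, and is nondegenerate, then the augmentation ideal has a
linear resolution. -/
theorem lin_augmentation (h0 : S.ConnectedOne) [∀ n, FiniteDimensional k (S.piece n)]
    {L₀ : Submodule k F} (hL₀ : L₀ ≤ S.piece 1) (hdim : Module.finrank k L₀ + 2 ≤
      Module.finrank k (S.piece 1))
    (hcodim : Module.finrank k (S.piece 2) =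
      Module.finrank k (L₀ * S.piece 1 : Submodule k F) + 1)
    (hhigh : ∀ n, L₀ * S.piece (n + 2) = S.piece (n + 3))
    (hnd : ∀ c ∈ S.piece 1, (∀ r ∈ S.piece 1, c * r ∈ L₀ * S.piece 1) → c ∈ L₀)
    (hlin : ∀ i, S.Lin i F (S.idl L₀)) (i : ℕ) : S.Lin i F (fun n => (S.piece (n + 1)).toAddSubgroup) := by
  have hsub : ∀ {L : Submodule k F} {n : ℕ}, L ≤ S.piece 1 → L * S.piece n ≤ S.piece (n + 1) := by
    intro L n hL
    rw [Submodule.mul_le]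
    intro x hx y hy
    rw [add_comm]; exact S.mul_mem (hL hx) hy
  -- an ideal strictly larger than the one of the net is everything from degree two on
  have hbig : ∀ L : Submodule k F, L₀ < L → L ≤ S.piece 1 → ∀ n, L * S.piece (n + 1) =
      S.piece (n + 2) := by
    intro L hL hL1 n
    rcases n with _ | n
    · have h1 : L₀ * S.piece 1 < L * S.piece 1 := by
        refine lt_of_le_of_ne (mul_le_mul_left_sub hL.le) fun h => hL.not_ge ?_
        intro c hc
        exact hnd c (hL1 hc) fun r hr => h ▸ Submodule.mul_mem_mul hc hr
      have h2 : L * S.piece 1 ≤ S.piece 2 := hsub hL1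
      have : FiniteDimensional k (L * S.piece 1 : Submodule k F) :=
        Submodule.finiteDimensional_of_le h2
      have h3 := Submodule.finrank_lt_finrank_of_lt h1
      refine Submodule.eq_of_le_of_finrank_le h2 ?_
      show Module.finrank k (S.piece 2) ≤ Module.finrank k (L * S.piece 1 : Submodule k F)
      omega
    · refine le_antisymm (hsub hL1) ?_
      rw [← hhigh]
      exact mul_le_mul_left_sub hL.le
  have key : ∀ i, ∀ d, ∀ L : Submodule k F, Module.finrank k L = d → L₀ < L → L ≤ S.piece 1 →
      S.Lin i F (S.idl L) := by
    intro i
    induction i with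
    | zero =>
      intro d L _ _ hL1
      have : FiniteDimensional k L := Submodule.finiteDimensional_of_le hL1
      exact ⟨_, inferInstance, _, minGen_idl h0 (Module.finBasis k L)⟩
    | succ i ih =>
      intro d
      induction d using Nat.strong_induction_on with
      | _ d ihd =>
        intro L hd hL hL1
        have : FiniteDimensional k L := Submodule.finiteDimensional_of_le hL1
        obtain ⟨c, hcL, hc0⟩ := SetLike.exists_of_lt hL
        obtain ⟨f, hf, hf0⟩ := Submodule.exists_le_ker_of_notMem hc0
        set L' := L ⊓ LinearMap.ker f with hL'
        have hcL' : c ∉ L' := fun h => hf h.2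
        have hL0' : L₀ ≤ L' := le_inf hL.le hf0
        have hlt : L' < L := lt_of_le_of_ne inf_le_left fun h => hcL' (h ▸ hcL)
        have hdec : ∀ x ∈ L, ∃ a : k, x - a • c ∈ L' := by
          intro x hx
          refine ⟨f x / f c, sub_mem hx (Submodule.smul_mem _ _ hcL), ?_⟩
          show f _ = 0
          rw [map_sub, map_smul, smul_eq_mul, div_mul_cancel₀ _ hf, sub_self]
        have hlinL' : S.Lin (i + 1) F (S.idl L') := by
          rcases hL0'.eq_or_lt with h | h
          · rw [← h]; exact hlin _
          · exact ihd _ (hd ▸ Submodule.finrank_lt_finrank_of_lt hlt) L' rfl h (hlt.le.trans hL1)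
        have hgenL : ∀ n, ∀ x ∈ S.idl L n, ∃ r ∈ S.piece n, x - r • c ∈ S.idl L' n := by
          intro n x hx
          rw [mem_idl] at hx
          induction hx using Submodule.mul_induction_on' with
          | mem_mul_mem x hx y hy =>
            obtain ⟨a, ha⟩ := hdec x hx
            refine ⟨a • y, Submodule.smul_mem _ _ hy, ?_⟩
            rw [mem_idl]
            have : x * y - (a • y) • c = (x - a • c) * y := by
              rw [smul_eq_mul, sub_mul, smul_mul_assoc, smul_mul_assoc, mul_comm c y]
            rw [this]
            exact Submodule.mul_mem_mul ha hy
          | add x _ y _ hx hy =>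
            obtain ⟨z, hz, hz'⟩ := hx
            obtain ⟨w, hw, hw'⟩ := hy
            refine ⟨z + w, add_mem hz hw, ?_⟩
            have := add_mem hz' hw'
            rwa [show x + y - (z + w) • c = (x - z • c) + (y - w • c) by
              rw [add_smul]; abel]
        have hind : ∀ r ∈ S.piece 0, r • c ∈ S.idl L' 0 → r = 0 := by
          intro r hr hrc
          rw [mem_idl, piece_zero_mul h0] at hrc
          rw [h0] at hr
          obtain ⟨a, rfl⟩ := Submodule.mem_span_singleton.1 hr
          by_contra hne
          have ha : a ≠ 0 := by rintro rfl; simp at hne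
          rw [smul_assoc, one_smul] at hrc
          exact hcL' ((Submodule.smul_mem_iff _ ha).1 hrc)
        have hcP : c ∈ S.idl L 0 := by rw [mem_idl, piece_zero_mul h0]; exact hcL
        have hleP : ∀ n x, x ∈ S.idl L' n → x ∈ S.idl L n := fun n x hx =>
          mul_le_mul_left_sub hlt.le hx
        rcases hL0'.eq_or_lt with h | h
        · -- the colon space of the net
          let mc : S.piece 1 →ₗ[k] F := (LinearMap.mulRight k c) ∘ₗ (S.piece 1).subtype
          let W : Submodule k F := (Submodule.comap mc (L₀ * S.piece 1)).map (S.piece 1).subtype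
          have hW : ∀ r, r ∈ W ↔ r ∈ S.piece 1 ∧ r * c ∈ L₀ * S.piece 1 := by
            intro r
            constructor
            · rintro ⟨s, hs, rfl⟩; exact ⟨s.2, hs⟩
            · rintro ⟨h1, h2⟩; exact ⟨⟨r, h1⟩, h2, rfl⟩
          have hLW : L₀ < W := by
            have hle : L₀ ≤ W := fun r hr =>
              (hW r).2 ⟨hL₀ hr, Submodule.mul_mem_mul hr (hL1 hcL)⟩
            refine lt_of_le_of_ne hle fun heq => ?_
            have hmap : ∀ r : S.piece 1, mc r ∈ S.piece 2 := fun r =>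
              S.mul_mem (m := 1) (n := 1) r.2 (hL1 hcL)
            have hd2 : L₀ * S.piece 1 ≤ S.piece 2 := hsub hL₀
            let g : S.piece 1 →ₗ[k] (S.piece 2 ⧸ Submodule.comap (S.piece 2).subtype
                (L₀ * S.piece 1)) := (Submodule.mkQ _) ∘ₗ (mc.codRestrict (S.piece 2) hmap)
            have hker : LinearMap.ker g = Submodule.comap mc (L₀ * S.piece 1) := by
              ext r
              rw [LinearMap.mem_ker]
              show Submodule.Quotient.mk _ = _ ↔ _
              rw [Submodule.Quotient.mk_eq_zero]
              rfl
            have h1 : Module.finrank k W = Module.finrank k (LinearMap.ker g) := by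
              rw [hker]
              exact (LinearEquiv.finrank_eq (Submodule.equivMapOfInjective _
                (Submodule.injective_subtype _) _)).symm
            have h2 := LinearMap.finrank_range_add_finrank_ker g
            have h3 := Submodule.finrank_le (LinearMap.range g)
            have h4 := Submodule.finrank_quotient_add_finrank
              (Submodule.comap (S.piece 2).subtype (L₀ * S.piece 1))
            have h5 := LinearEquiv.finrank_eq (Submodule.comapSubtypeEquivOfLe hd2)
            rw [← heq] at h1
            omega
          have hW1 : W ≤ S.piece 1 := fun r hr => ((hW r).1 hr).1
          rw [← h] at hlinL'
          refine Lin.add_generator i c (idl_stable h0 L) (Q := S.idl W)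
            (h ▸ hleP) hcP (h ▸ hind) (h ▸ hgenL) ?_ hlinL' (ih _ W rfl hLW hW1)
          intro n r
          rw [mem_idl, mem_idl, smul_eq_mul]
          rcases n with _ | n
          · rw [piece_zero_mul h0, hW]
          · rw [hbig W hLW hW1, hhigh]
            exact ⟨fun hr => ⟨hr, S.mul_mem (m := n + 2) (n := 1) hr (hL1 hcL)⟩, fun hr => hr.1⟩
        · refine Lin.add_generator i c (idl_stable h0 L) (Q := S.idl (S.piece 1)) hleP hcP hind
            hgenL ?_ hlinL' (ih _ (S.piece 1) rfl (lt_of_lt_of_le hL hL1) le_rfl)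
          intro n r
          rw [mem_idl, mem_idl, hbig L' h (hlt.le.trans hL1), smul_eq_mul]
          have h1 : S.piece 1 * S.piece n = S.piece (n + 1) := by
            rcases n with _ | n
            · rw [piece_zero_mul h0]
            · exact hbig _ (lt_of_lt_of_le hL hL1) le_rfl n
          rw [h1]
          exact ⟨fun hr => ⟨hr, S.mul_mem (m := n + 1) (n := 1) hr (hL1 hcL)⟩, fun hr => hr.1⟩
  have hlt : L₀ < S.piece 1 := lt_of_le_of_ne hL₀ fun h => by rw [← h] at hdim; omega
  have := key i _ _ rfl hlt le_rfl
  have he : S.idl (S.piece 1) = fun n => (S.piece (n + 1)).toAddSubgroup := by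
    funext n
    show (S.piece 1 * S.piece n).toAddSubgroup = _
    rcases n with _ | n
    · rw [piece_zero_mul h0]
    · rw [hbig _ hlt le_rfl n]
  rwa [he] at this

end GradedSystem

namespace GradedSystem

variable {k F : Type} [Field k] [Field F] [Algebra k F] {S : GradedSystem k F}

variable (S) in
/-- Coordinates of an element of `V ⊗ R_d` in the standard basis of `V`. -/
def coords (m d : ℕ) : ((Fin m → k) ⊗[k] S.piece d) →ₗ[k] (Fin m → F) :=
  (LinearMap.funLeft k F id ∘ₗ LinearMap.pi fun b => (S.piece d).subtype ∘ₗ LinearMap.proj b) ∘ₗ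
    (TensorProduct.piScalarRight k k (S.piece d) (Fin m)).toLinearMap ∘ₗ
    (TensorProduct.comm k (Fin m → k) (S.piece d)).toLinearMap

theorem coords_tmul {m d : ℕ} (v : Fin m → k) (r : S.piece d) (b : Fin m) :
    S.coords m d (v ⊗ₜ r) b = v b • (r : F) := by
  simp [coords, LinearMap.funLeft]

theorem coords_injective (m d : ℕ) : Injective (S.coords m d) := by
  intro x y h
  apply (TensorProduct.comm k (Fin m → k) (S.piece d)).injective
  apply (TensorProduct.piScalarRight k k (S.piece d) (Fin m)).injective
  funext b
  exact Subtype.ext (congrFun h b)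

theorem coords_mem {m d : ℕ} (t : (Fin m → k) ⊗[k] S.piece d) (b : Fin m) :
    S.coords m d t b ∈ S.piece d := by
  exact Subtype.prop (((TensorProduct.piScalarRight k k (S.piece d) (Fin m)))
    (TensorProduct.comm k (Fin m → k) (S.piece d) t) b)

theorem exists_coords {m d : ℕ} (z : Fin m → F) (hz : ∀ b, z b ∈ S.piece d) :
    ∃ t, S.coords m d t = z := by
  refine ⟨(TensorProduct.comm k (Fin m → k) (S.piece d)).symm
    ((TensorProduct.piScalarRight k k (S.piece d) (Fin m)).symm fun b => ⟨z b, hz b⟩), ?_⟩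
  funext b
  simp [coords, LinearMap.funLeft]

theorem coords_Dmap (n : ℕ → ℕ)
    (φ : ∀ i : ℕ, (Fin (n (i + 1)) → k) →ₗ[k] ((Fin (n i) → k) ⊗[k] S.piece 1))
    (p : ∀ i, Fin (n (i + 1)) → Fin (n i) → F)
    (hφ : ∀ i v, S.coords _ _ (φ i v) = ∑ a, v a • p i a) (i d : ℕ)
    (t : (Fin (n (i + 1)) → k) ⊗[k] S.piece d) :
    S.coords _ _ (S.Dmap n φ i d t) = ∑ a, S.coords _ _ t a • p i a := by
  induction t with
  | zero => simp
  | add x y hx hy => simp only [map_add, hx, hy, Pi.add_apply, add_smul, Finset.sum_add_distrib]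
  | tmul v r =>
    have key : ∀ w : (Fin (n i) → k) ⊗[k] S.piece 1, ∀ b,
        S.coords _ _ (LinearMap.lTensor (Fin (n i) → k)
          ((S.cast (add_comm 1 d)).toLinearMap ∘ₗ TensorProduct.lift (S.mulMap 1 d))
          (TensorProduct.assoc k (Fin (n i) → k) (S.piece 1) (S.piece d) (w ⊗ₜ r))) b =
        S.coords _ _ w b * r := by
      intro w b
      induction w with
      | zero => simp
      | add x y hx hy => simp only [add_tmul, map_add, Pi.add_apply, hx, hy, add_mul]
      | tmul u s =>
        simp only [TensorProduct.assoc_tmul, LinearMap.lTensor_tmul, coords_tmul,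
          LinearMap.comp_apply, TensorProduct.lift.tmul, smul_mul_assoc]
        rfl
    funext b
    refine (key (φ i v) b).trans ?_
    rw [hφ]
    simp only [Finset.sum_apply, Pi.smul_apply, coords_tmul, Finset.sum_mul, smul_eq_mul,
      smul_mul_assoc]
    exact Finset.sum_congr rfl fun a _ => by rw [mul_comm]

/-- A linear free resolution given by matrices of linear forms shows Koszulness. -/
theorem isKoszul_of_matrices (h0 : S.ConnectedOne) (n : ℕ → ℕ) (hn : n 0 = 1)
    (p : ∀ i, Fin (n (i + 1)) → Fin (n i) → F) (hp : ∀ i a b, p i a b ∈ S.piece 1)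
    (hgen : ∀ d, ∀ x : Fin (n 0) → F, (∀ b, x b ∈ S.piece (d + 1)) →
      ∃ z : Fin (n 1) → F, (∀ a, z a ∈ S.piece d) ∧ ∑ a, z a • p 0 a = x)
    (hind : ∀ i, ∀ z : Fin (n (i + 1)) → F, (∀ a, z a ∈ S.piece 0) → ∑ a, z a • p i a = 0 → z = 0)
    (hex : ∀ i d, ∀ x : Fin (n (i + 1)) → F, ((∀ b, x b ∈ S.piece (d + 1)) ∧
      ∑ b, x b • p i b = 0) ↔
      ∃ z : Fin (n (i + 2)) → F, (∀ a, z a ∈ S.piece d) ∧ ∑ a, z a • p (i + 1) a = x) :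
    S.IsKoszul := by
  choose c hc using fun i a => exists_coords (p i a) (hp i a)
  let φ : ∀ i : ℕ, (Fin (n (i + 1)) → k) →ₗ[k] ((Fin (n i) → k) ⊗[k] S.piece 1) := fun i =>
    Fintype.linearCombination k (c i)
  have hφ : ∀ i v, S.coords _ _ (φ i v) = ∑ a, v a • p i a := by
    intro i v
    simp only [φ, Fintype.linearCombination_apply, map_sum, map_smul, hc]
  have hD := coords_Dmap n φ p hφ
  refine ⟨h0, n, φ, hn, ?_, ?_, ?_⟩
  · intro d x
    obtain ⟨z, hz, hz'⟩ := hgen d _ (coords_mem x)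
    obtain ⟨t, rfl⟩ := exists_coords z hz
    exact ⟨t, coords_injective _ _ ((hD _ _ _).trans hz')⟩
  · intro i
    rw [injective_iff_map_eq_zero]
    intro t ht
    have := hD i 0 t
    rw [ht, map_zero] at this
    refine coords_injective _ _ ?_
    rw [hind i _ (coords_mem t) this.symm, map_zero]
  · intro i d
    ext t
    constructor
    · rintro ⟨s, rfl⟩
      refine coords_injective _ _ ?_
      rw [hD, map_zero]
      exact ((hex i d _).2 ⟨_, coords_mem s, (hD _ _ s).symm⟩).2
    · intro ht
      have h1 := hD i (d + 1) t
      rw [LinearMap.mem_ker.1 ht, map_zero] at h1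
      obtain ⟨z, hz, hz'⟩ := (hex i d _).1 ⟨coords_mem t, h1.symm⟩
      obtain ⟨s, rfl⟩ := exists_coords z hz
      exact ⟨s, coords_injective _ _ ((hD _ _ _).trans hz')⟩

variable (S) in
/-- One differential of a linear free resolution, together with the fact that its kernel
has linear resolutions of arbitrary length. -/
structure ResStep where
  src : ℕ
  tgt : ℕ
  mat : Fin src → Fin tgt → F
  mem : ∀ a b, mat a b ∈ S.piece 1
  lin : ∀ i, S.Lin i (Fin src → F) (S.Syz mat)
  indep : ∀ z : Fin src → F, (∀ a, z a ∈ S.piece 0) → ∑ a, z a • mat a = 0 → z = 0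

theorem MinGen.equiv {M : Type} [AddCommGroup M] [Module F M] {ι κ : Type} [Fintype ι] [Fintype κ]
    {p : ι → M} {P : ℕ → AddSubgroup M} (h : S.MinGen p P) (e : κ ≃ ι) :
    S.MinGen (p ∘ e) P := by
  refine ⟨fun n m => (h.mem_iff n m).trans ⟨?_, ?_⟩, ?_⟩
  · rintro ⟨z, hz, rfl⟩
    exact ⟨z ∘ e, fun i => hz _, e.sum_comp fun i => z i • p i⟩
  · rintro ⟨z, hz, rfl⟩
    refine ⟨z ∘ e.symm, fun i => hz _, ?_⟩
    rw [← e.sum_comp]; simp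
  · intro z hz h0
    have := h.indep (z ∘ e.symm) (fun i => hz _) (by rw [← e.sum_comp]; simpa using h0)
    funext i
    simpa using congrFun this (e i)

theorem exists_uniform {M : Type} [AddCommGroup M] [Module F M] {P : ℕ → AddSubgroup M}
    (h : ∀ i, S.Lin i M P) : ∃ (N : ℕ) (p : Fin N → M), S.MinGen p P ∧
      ∀ i, S.Lin i (Fin N → F) (S.Syz p) := by
  obtain ⟨ι, _, p, hp⟩ := h 0
  refine ⟨_, p ∘ (Fintype.equivFin ι).symm, hp.equiv _, fun i => ?_⟩
  obtain ⟨κ, _, q, hq, hl⟩ := h (i + 1)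
  exact Lin.syz_of_minGen i hq (hp.equiv _) hl

theorem ResStep.exists_next (s : S.ResStep) : ∃ (N : ℕ) (p : Fin N → Fin s.src → F),
    S.MinGen p (S.Syz s.mat) ∧ ∀ i, S.Lin i (Fin N → F) (S.Syz p) := exists_uniform s.lin

/-- The next differential. -/
def ResStep.next (s : S.ResStep) : S.ResStep where
  src := s.exists_next.choose
  tgt := s.src
  mat := s.exists_next.choose_spec.choose
  mem a b := by
    have := s.exists_next.choose_spec.choose_spec.1.mem a
    simpa using this.1 b
  lin := s.exists_next.choose_spec.choose_spec.2
  indep := s.exists_next.choose_spec.choose_spec.1.indep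

theorem ResStep.next_spec (s : S.ResStep) : S.MinGen s.next.mat (S.Syz s.mat) :=
  s.exists_next.choose_spec.choose_spec.1

/-- If the augmentation ideal has linear resolutions of arbitrary length, the algebra is Koszul. -/
theorem isKoszul_of_lin (h0 : S.ConnectedOne)
    (h : ∀ i, S.Lin i F (fun n => (S.piece (n + 1)).toAddSubgroup)) : S.IsKoszul := by
  let P : ℕ → AddSubgroup (Fin 1 → F) := fun n =>
    { carrier := {x | ∀ b, x b ∈ S.piece (n + 1)}
      zero_mem' := fun _ => zero_mem _
      add_mem' := fun ha hb b => add_mem (ha b) (hb b)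
      neg_mem' := fun ha b => neg_mem (ha b) }
  have hP : ∀ i, S.Lin i (Fin 1 → F) P := by
    intro i
    refine Lin.map i (LinearMap.pi fun _ => LinearMap.id) ?_ ?_ ?_ (h i)
    · intro x y hxy; exact congrFun hxy 0
    · intro n x
      constructor
      · intro hx
        refine ⟨x 0, hx 0, ?_⟩
        funext b
        rw [Subsingleton.elim b 0]; rfl
      · rintro ⟨y, hy, rfl⟩ b
        exact hy
    · intro n r x hr hx b
      exact S.mul_mem hr (hx b)
  obtain ⟨N, p, hp, hl⟩ := exists_uniform hP
  let s₀ : S.ResStep := ⟨N, 1, p, fun a b => hp.mem a b, hl, hp.indep⟩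
  let s : ℕ → S.ResStep := fun i => Nat.rec s₀ (fun _ t => t.next) i
  have hs : ∀ i, S.MinGen (s (i + 1)).mat (S.Syz (s i).mat) := fun i => (s i).next_spec
  refine isKoszul_of_matrices h0 (fun i => (s i).tgt) rfl (fun i => (s i).mat)
    (fun i => (s i).mem) ?_ (fun i => (s i).indep) ?_
  · intro d x hx
    exact (hp.mem_iff d x).1 hx
  · intro i d x
    exact (hs i).mem_iff d x

end GradedSystem

namespace PreCurve
variable {C : PreCurve}

theorem ord_one (P : C.Point) : C.ord P 1 = 0 := by
  simpa using C.ord_algebraMap P 1 one_ne_zero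

theorem algebraMap_ne_zero {c : ℂ} (hc : c ≠ 0) : algebraMap ℂ C.F c ≠ 0 := fun h =>
  hc ((algebraMap ℂ C.F).injective (by rw [h, map_zero]))

theorem ord_smul (P : C.Point) {c : ℂ} (hc : c ≠ 0) (f : C.F) : C.ord P (c • f) = C.ord P f := by
  rcases eq_or_ne f 0 with rfl | hf
  · simp
  rw [Algebra.smul_def, C.ord_mul P _ _ (algebraMap_ne_zero hc) hf, C.ord_algebraMap P c hc,
    zero_add]

theorem ord_inv (P : C.Point) (f : C.F) : C.ord P f⁻¹ = - C.ord P f := by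
  rcases eq_or_ne f 0 with rfl | hf
  · simp [C.ord_zero']
  have := C.ord_mul P f f⁻¹ hf (inv_ne_zero hf)
  rw [mul_inv_cancel₀ hf, ord_one] at this
  omega

theorem ord_div (P : C.Point) {f g : C.F} (hf : f ≠ 0) (hg : g ≠ 0) :
    C.ord P (f / g) = C.ord P f - C.ord P g := by
  rw [div_eq_mul_inv, C.ord_mul P _ _ hf (inv_ne_zero hg), ord_inv]; omega

variable (C) in
/-- Functions vanishing to order at least `n` at `P`. -/
def van (P : C.Point) (n : ℤ) : Submodule ℂ C.F where
  carrier := {f | f = 0 ∨ n ≤ C.ord P f}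
  zero_mem' := Or.inl rfl
  add_mem' := by
    intro f g hf hg
    rcases eq_or_ne f 0 with rfl | hf0
    · simpa using hg
    rcases eq_or_ne g 0 with rfl | hg0
    · simpa using hf
    rcases eq_or_ne (f + g) 0 with h0 | h0
    · exact Or.inl h0
    have h1 := hf.resolve_left hf0
    have h2 := hg.resolve_left hg0
    exact Or.inr ((le_min h1 h2).trans (C.ord_add P f g hf0 hg0 h0))
  smul_mem' := by
    intro c f hf
    rcases eq_or_ne c 0 with rfl | hc
    · exact Or.inl (zero_smul ℂ f)
    rcases hf with rfl | hf
    · exact Or.inl (smul_zero c)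
    · exact Or.inr (by rwa [ord_smul P hc])

theorem mem_van {P : C.Point} {n : ℤ} {f : C.F} : f ∈ C.van P n ↔ f = 0 ∨ n ≤ C.ord P f := Iff.rfl

theorem mem_van_of_ne {P : C.Point} {n : ℤ} {f : C.F} (hf : f ≠ 0) :
    f ∈ C.van P n ↔ n ≤ C.ord P f := by simp [mem_van, hf]

theorem van_mono {P : C.Point} {m n : ℤ} (h : m ≤ n) : C.van P n ≤ C.van P m := by
  rintro f (rfl | hf)
  · exact zero_mem _
  · exact Or.inr (h.trans hf)

theorem mul_mem_van {P : C.Point} {m n : ℤ} {f g : C.F} (hf : f ∈ C.van P m)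
    (hg : g ∈ C.van P n) : f * g ∈ C.van P (m + n) := by
  rcases eq_or_ne f 0 with rfl | hf0
  · simp
  rcases eq_or_ne g 0 with rfl | hg0
  · simp
  rw [mem_van_of_ne hf0] at hf
  rw [mem_van_of_ne hg0] at hg
  refine Or.inr ?_
  rw [C.ord_mul P _ _ hf0 hg0]; omega

theorem one_mem_van (P : C.Point) : (1 : C.F) ∈ C.van P 0 := Or.inr (ord_one P).ge

theorem algebraMap_mem_van (P : C.Point) (c : ℂ) : algebraMap ℂ C.F c ∈ C.van P 0 := by
  rw [Algebra.algebraMap_eq_smul_one]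
  exact Submodule.smul_mem _ _ (one_mem_van P)

theorem algebraMap_mem_van_one {P : C.Point} {c : ℂ} (h : algebraMap ℂ C.F c ∈ C.van P 1) :
    c = 0 := by
  by_contra hc
  rw [mem_van_of_ne (algebraMap_ne_zero hc), C.ord_algebraMap P c hc] at h
  omega

theorem mem_H0' {D : C.Div} {f : C.F} : f ∈ C.H0 D ↔ ∀ P, f ∈ C.van P (- D P) := by
  rw [C.mem_H0]
  constructor
  · rintro (rfl | h) P
    · exact zero_mem _
    · exact Or.inr (by have := h P; omega)
  · intro h
    rcases eq_or_ne f 0 with rfl | hf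
    · exact Or.inl rfl
    · refine Or.inr fun P => ?_
      have := (mem_van_of_ne hf).1 (h P)
      omega

theorem divOf_apply {f : C.F} (hf : f ≠ 0) (P : C.Point) : C.divOf f P = C.ord P f := by
  simp [divOf, hf]
  rfl

theorem divOf_mul {f g : C.F} (hf : f ≠ 0) (hg : g ≠ 0) :
    C.divOf (f * g) = C.divOf f + C.divOf g := by
  ext P
  rw [Finsupp.add_apply, divOf_apply hf, divOf_apply hg, divOf_apply (mul_ne_zero hf hg),
    C.ord_mul P _ _ hf hg]

theorem mem_H0_of_ne {D : C.Div} {f : C.F} (hf : f ≠ 0) : f ∈ C.H0 D ↔ 0 ≤ C.divOf f + D := by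
  rw [C.mem_H0, or_iff_right hf, Finsupp.le_def]
  simp [divOf_apply hf]

theorem pt_nonneg (P : C.Point) : 0 ≤ C.pt P := by
  classical
  rw [Finsupp.le_def]
  intro Q
  rw [pt, Finsupp.single_apply]
  split_ifs <;> simp

theorem pt_self (P : C.Point) : C.pt P P = 1 := by simp [pt]

theorem pt_ne {P Q : C.Point} (h : P ≠ Q) : C.pt P Q = 0 := by
  classical
  simp [pt, h]

theorem H0_le {D E : C.Div} (h : D ≤ E) : C.H0 D ≤ C.H0 E := C.H0_mono (Finsupp.le_def.1 h)

theorem H0_sub_pt_le (D : C.Div) (P : C.Point) : C.H0 (D - C.pt P) ≤ C.H0 D :=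
  H0_le (sub_le_self _ (pt_nonneg P))

theorem mem_H0_sub_pt {D : C.Div} {P : C.Point} {f : C.F} :
    f ∈ C.H0 (D - C.pt P) ↔ f ∈ C.H0 D ∧ f ∈ C.van P (1 - D P) := by
  constructor
  · intro h
    refine ⟨H0_sub_pt_le D P h, ?_⟩
    have := mem_H0'.1 h P
    rwa [Finsupp.sub_apply, pt_self, show -(D P - 1) = 1 - D P by ring] at this
  · rintro ⟨h1, h2⟩
    rw [mem_H0'] at h1 ⊢
    intro Q
    by_cases hQ : P = Q
    · subst hQ
      rwa [Finsupp.sub_apply, pt_self, show -(D P - 1) = 1 - D P by ring]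
    · rw [Finsupp.sub_apply, pt_ne hQ, sub_zero]; exact h1 Q

theorem deg_add (D E : C.Div) : C.deg (D + E) = C.deg D + C.deg E :=
  Finsupp.sum_add_index' (fun _ => rfl) (fun _ _ _ => rfl)

theorem deg_zero : C.deg 0 = 0 := Finsupp.sum_zero_index

variable (C) in
/-- The degree as a homomorphism. -/
def degHom : C.Div →+ ℤ where
  toFun := C.deg
  map_zero' := deg_zero
  map_add' := deg_add

theorem deg_neg (D : C.Div) : C.deg (-D) = - C.deg D := (degHom C).map_neg D

theorem deg_sub (D E : C.Div) : C.deg (D - E) = C.deg D - C.deg E := (degHom C).map_sub D E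

theorem deg_nsmul (n : ℕ) (D : C.Div) : C.deg (n • D) = n * C.deg D := by
  have := (degHom C).map_nsmul n D
  rw [nsmul_eq_mul] at this
  exact this

theorem deg_sum {ι : Type*} (s : Finset ι) (D : ι → C.Div) :
    C.deg (∑ i ∈ s, D i) = ∑ i ∈ s, C.deg (D i) := map_sum (degHom C) D s

theorem deg_pt (P : C.Point) : C.deg (C.pt P) = 1 := by
  simp [deg, pt]

theorem deg_nonneg {D : C.Div} (h : 0 ≤ D) : 0 ≤ C.deg D :=
  Finset.sum_nonneg fun P _ => Finsupp.le_def.1 h P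

theorem deg_mono {D E : C.Div} (h : D ≤ E) : C.deg D ≤ C.deg E := by
  have := deg_nonneg (sub_nonneg.2 h)
  rw [deg_sub] at this
  omega

theorem eq_zero_of_deg {D : C.Div} (h : 0 ≤ D) (h' : C.deg D = 0) : D = 0 := by
  ext P
  by_contra hP
  have := (Finset.sum_eq_zero_iff_of_nonneg (fun P _ => Finsupp.le_def.1 h P)).1 h' P
    (Finsupp.mem_support_iff.2 hP)
  exact hP this

theorem pt_le_of_pos {D : C.Div} (h : 0 ≤ D) {P : C.Point} (hP : 0 < D P) : C.pt P ≤ D := by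
  rw [Finsupp.le_def]
  intro Q
  by_cases hQ : P = Q
  · subst hQ; rw [pt_self]; omega
  · rw [pt_ne hQ]; exact Finsupp.le_def.1 h Q

theorem exists_pt_le {D : C.Div} (h : 0 ≤ D) (h' : D ≠ 0) : ∃ P, C.pt P ≤ D := by
  obtain ⟨P, hP⟩ := Finsupp.ne_iff.1 h'
  exact ⟨P, pt_le_of_pos h (lt_of_le_of_ne (Finsupp.le_def.1 h P) (Ne.symm hP))⟩

/-- Multiplication by a nonzero function. -/
theorem mul_mem_H0_iff {D : C.Div} {f g : C.F} (hf : f ≠ 0) :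
    f * g ∈ C.H0 D ↔ g ∈ C.H0 (D + C.divOf f) := by
  rcases eq_or_ne g 0 with rfl | hg
  · simp
  rw [mem_H0_of_ne hg, mem_H0_of_ne (mul_ne_zero hf hg), divOf_mul hf hg]
  rw [show C.divOf f + C.divOf g + D = C.divOf g + (D + C.divOf f) by abel]

theorem mulLeft_injective {f : C.F} (hf : f ≠ 0) : Injective (LinearMap.mulLeft ℂ f) :=
  fun _ _ h => mul_left_cancel₀ hf h

theorem finrank_map_mul {f : C.F} (hf : f ≠ 0) (N : Submodule ℂ C.F) :
    Module.finrank ℂ (N.map (LinearMap.mulLeft ℂ f)) = Module.finrank ℂ N :=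
  (LinearEquiv.finrank_eq (Submodule.equivMapOfInjective _ (mulLeft_injective hf) N)).symm

end PreCurve

namespace Curve
open PreCurve
variable {C : Curve}

instance (D : C.Div) : FiniteDimensional ℂ (C.H0 D) := C.finiteDim D

theorem deg_divOf {f : C.F} (hf : f ≠ 0) : C.deg (C.divOf f) = 0 := by
  have h := C.deg_principal f hf
  rw [finsum_eq_sum_of_support_subset (s := (C.divOf f).support)] at h
  · rw [deg, Finsupp.sum, ← h]
    exact Finset.sum_congr rfl fun P _ => divOf_apply hf P
  · intro P hP
    simpa [divOf_apply hf] using hP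

theorem h0_eq_zero {D : C.Div} (h : C.deg D < 0) : C.h0 D = 0 := by
  rw [h0, Submodule.finrank_eq_zero, eq_bot_iff]
  intro f hf
  by_contra hf0
  have h1 := (mem_H0_of_ne hf0).1 hf
  have h2 := deg_nonneg h1
  rw [deg_add, deg_divOf hf0] at h2
  omega

theorem h0_mono {D E : C.Div} (h : D ≤ E) : C.h0 D ≤ C.h0 E := Submodule.finrank_mono (H0_le h)

theorem h0_K : C.h0 C.K = C.genus := by
  have := C.riemann_roch 0
  rw [C.h0_triv, deg_zero, sub_zero] at this
  omega

theorem deg_K : C.deg C.K = 2 * C.genus - 2 := by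
  have := C.riemann_roch C.K
  rw [sub_self, C.h0_triv, h0_K] at this
  omega

theorem h0_of_deg {D : C.Div} (h : 2 * (C.genus : ℤ) - 2 < C.deg D) :
    (C.h0 D : ℤ) = C.deg D + 1 - C.genus := by
  have := C.riemann_roch D
  rw [h0_eq_zero (D := C.K - D) (by rw [deg_sub, deg_K]; omega)] at this
  omega

theorem h0_sub_pt_le (D : C.Div) (P : C.Point) : C.h0 (D - C.pt P) ≤ C.h0 D :=
  Submodule.finrank_mono (H0_sub_pt_le D P)

theorem h0_le_sub_pt (D : C.Div) (P : C.Point) : C.h0 D ≤ C.h0 (D - C.pt P) + 1 := by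
  have h1 := C.riemann_roch D
  have h2 := C.riemann_roch (D - C.pt P)
  have h3 : C.h0 (C.K - D) ≤ C.h0 (C.K - (D - C.pt P)) := by
    apply h0_mono
    have := pt_nonneg P
    rw [show C.K - (D - C.pt P) = C.K - D + C.pt P by abel]
    exact le_add_of_nonneg_right this
  rw [deg_sub, deg_pt] at h2
  omega

theorem h0_le_sub {D E : C.Div} (hE : 0 ≤ E) : (C.h0 D : ℤ) ≤ C.h0 (D - E) + C.deg E := by
  obtain ⟨n, hn⟩ : ∃ n : ℕ, C.deg E = n := ⟨(C.deg E).toNat, by have := deg_nonneg hE; omega⟩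
  induction n generalizing E with
  | zero =>
    rw [eq_zero_of_deg hE hn, sub_zero, deg_zero]; omega
  | succ n ih =>
    have hne : E ≠ 0 := by rintro rfl; rw [deg_zero] at hn; omega
    obtain ⟨P, hP⟩ := exists_pt_le hE hne
    have hd : C.deg (E - C.pt P) = n := by rw [deg_sub, deg_pt]; omega
    have h1 := ih (E := E - C.pt P) (sub_nonneg.2 hP) hd
    have h2 := h0_le_sub_pt (D - (E - C.pt P)) P
    rw [show D - (E - C.pt P) - C.pt P = D - E by abel] at h2
    omega

theorem sub_pt_eq_or (D : C.Div) (P : C.Point) :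
    C.h0 (D - C.pt P) = C.h0 D ∨ C.h0 (D - C.pt P) + 1 = C.h0 D := by
  have := h0_sub_pt_le D P
  have := h0_le_sub_pt D P
  omega

theorem H0_sub_pt_eq_of_h0 {D : C.Div} {P : C.Point} (h : C.h0 (D - C.pt P) = C.h0 D) :
    C.H0 (D - C.pt P) = C.H0 D :=
  Submodule.eq_of_le_of_finrank_eq (H0_sub_pt_le D P) h

/-- Two sections agree up to scale modulo sections vanishing at `P`. -/
theorem exists_sub_smul_mem {D : C.Div} {P : C.Point} {a b : C.F} (ha : a ∈ C.H0 D)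
    (ha' : a ∉ C.H0 (D - C.pt P)) (hb : b ∈ C.H0 D) : ∃ c : ℂ, b - c • a ∈ C.H0 (D - C.pt P) := by
  have hle : C.H0 (D - C.pt P) ⊔ Submodule.span ℂ {a} ≤ C.H0 D :=
    sup_le (H0_sub_pt_le D P) (Submodule.span_le.2 (by simpa using ha))
  have hlt : C.H0 (D - C.pt P) < C.H0 (D - C.pt P) ⊔ Submodule.span ℂ {a} := by
    refine lt_of_le_of_ne le_sup_left fun h => ha' ?_
    rw [h]
    exact Submodule.mem_sup_right (Submodule.mem_span_singleton_self a)
  have : FiniteDimensional ℂ (C.H0 (D - C.pt P) ⊔ Submodule.span ℂ {a} : Submodule ℂ C.F) :=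
    Submodule.finiteDimensional_of_le hle
  have h1 := Submodule.finrank_lt_finrank_of_lt hlt
  have h2 := h0_le_sub_pt D P
  have h3 := Submodule.eq_of_le_of_finrank_le hle (by unfold h0 at h2; omega)
  rw [← h3] at hb
  obtain ⟨x, hx, y, hy, rfl⟩ := Submodule.mem_sup.1 hb
  obtain ⟨c, rfl⟩ := Submodule.mem_span_singleton.1 hy
  exact ⟨c, by simpa using hx⟩

theorem exists_residue {P : C.Point} {f : C.F} (hf : f ∈ C.van P 0) :
    ∃ c : ℂ, f - algebraMap ℂ C.F c ∈ C.van P 1 := by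
  rcases eq_or_ne f 0 with rfl | hf0
  · exact ⟨0, by simp⟩
  rw [mem_van_of_ne hf0] at hf
  let D : C.Div := (- C.divOf f) ⊔ 0
  have hD : D P = 0 := by
    simp only [D, Finsupp.sup_apply, Finsupp.neg_apply, divOf_apply hf0, Finsupp.zero_apply]
    omega
  have h1 : (1 : C.F) ∈ C.H0 D := by
    rw [mem_H0_of_ne one_ne_zero]
    have : C.divOf (1 : C.F) = 0 := by ext Q; rw [divOf_apply one_ne_zero, ord_one]; rfl
    rw [this, zero_add]
    exact le_sup_right
  have h2 : f ∈ C.H0 D := by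
    rw [mem_H0_of_ne hf0, ← neg_le_iff_add_nonneg']
    exact le_sup_left
  have h3 : (1 : C.F) ∉ C.H0 (D - C.pt P) := by
    rw [mem_H0_sub_pt, hD, mem_van_of_ne one_ne_zero, ord_one]
    rintro ⟨-, h⟩; omega
  obtain ⟨c, hc⟩ := exists_sub_smul_mem h1 h3 h2
  refine ⟨c, ?_⟩
  have := (mem_H0_sub_pt.1 hc).2
  rwa [hD, sub_zero, ← Algebra.algebraMap_eq_smul_one] at this

open Classical in
variable (C) in
/-- The value of a function at a point where it is regular. -/
def ev (P : C.Point) (f : C.F) : ℂ :=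
  if h : f ∈ C.van P 0 then (exists_residue h).choose else 0

theorem sub_ev_mem {P : C.Point} {f : C.F} (hf : f ∈ C.van P 0) :
    f - algebraMap ℂ C.F (C.ev P f) ∈ C.van P 1 := by
  rw [ev, dif_pos hf]
  exact (exists_residue hf).choose_spec

theorem ev_eq_iff {P : C.Point} {f : C.F} (hf : f ∈ C.van P 0) {c : ℂ} :
    C.ev P f = c ↔ f - algebraMap ℂ C.F c ∈ C.van P 1 := by
  constructor
  · rintro rfl; exact sub_ev_mem hf
  · intro h
    have h1 := sub_mem h (sub_ev_mem hf)
    rw [sub_sub_sub_cancel_left, ← map_sub] at h1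
    exact sub_eq_zero.1 (algebraMap_mem_van_one h1)

theorem ev_eq_zero_iff {P : C.Point} {f : C.F} (hf : f ∈ C.van P 0) :
    C.ev P f = 0 ↔ f ∈ C.van P 1 := by
  rw [ev_eq_iff hf, map_zero, sub_zero]

theorem ev_algebraMap (P : C.Point) (c : ℂ) : C.ev P (algebraMap ℂ C.F c) = c := by
  rw [ev_eq_iff (algebraMap_mem_van P c), sub_self]; exact zero_mem _

theorem ev_add {P : C.Point} {f g : C.F} (hf : f ∈ C.van P 0) (hg : g ∈ C.van P 0) :
    C.ev P (f + g) = C.ev P f + C.ev P g := by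
  rw [ev_eq_iff (add_mem hf hg), map_add, add_sub_add_comm]
  exact add_mem (sub_ev_mem hf) (sub_ev_mem hg)

theorem mul_mem_van_zero {P : C.Point} {f g : C.F} (hf : f ∈ C.van P 0) (hg : g ∈ C.van P 0) :
    f * g ∈ C.van P 0 := by simpa using mul_mem_van hf hg

theorem ev_mul {P : C.Point} {f g : C.F} (hf : f ∈ C.van P 0) (hg : g ∈ C.van P 0) :
    C.ev P (f * g) = C.ev P f * C.ev P g := by
  rw [ev_eq_iff (mul_mem_van_zero hf hg), map_mul]
  have h1 := mul_mem_van (sub_ev_mem hf) hg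
  have h2 := mul_mem_van (algebraMap_mem_van P (C.ev P f)) (sub_ev_mem hg)
  rw [add_zero] at h1
  rw [zero_add] at h2
  convert add_mem h1 h2 using 1
  ring

/-- The divisor of common zeros (and poles) of two functions. -/
def gcdDiv (x y : C.F) : C.Div := C.divOf x ⊓ C.divOf y

theorem mul_mem_and_iff {x y u : C.F} (hx : x ≠ 0) (hy : y ≠ 0) (M : C.Div) :
    (x * u ∈ C.H0 M ∧ y * u ∈ C.H0 M) ↔ u ∈ C.H0 (M + gcdDiv x y) := by
  rw [mul_mem_H0_iff hx, mul_mem_H0_iff hy]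
  rcases eq_or_ne u 0 with rfl | hu
  · simp
  rw [mem_H0_of_ne hu, mem_H0_of_ne hu, mem_H0_of_ne hu, gcdDiv]
  simp only [Finsupp.le_def, ← forall_and]
  refine forall_congr' fun P => ?_
  simp only [Finsupp.add_apply, Finsupp.inf_apply, Finsupp.zero_apply]
  omega

/-- The base point free pencil trick: the dimension of `x H⁰(M) + y H⁰(M)`. -/
theorem finrank_pencil {x y : C.F} (hx : x ≠ 0) (hy : y ≠ 0) (M : C.Div) :
    Module.finrank ℂ ((C.H0 M).map (LinearMap.mulLeft ℂ x) ⊔ (C.H0 M).map (LinearMap.mulLeft ℂ y) :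
      Submodule ℂ C.F) + C.h0 (M + gcdDiv x y) = 2 * C.h0 M := by
  have h1 := Submodule.finrank_sup_add_finrank_inf_eq
    ((C.H0 M).map (LinearMap.mulLeft ℂ x)) ((C.H0 M).map (LinearMap.mulLeft ℂ y))
  have h2 : (C.H0 M).map (LinearMap.mulLeft ℂ x) ⊓ (C.H0 M).map (LinearMap.mulLeft ℂ y) =
      (C.H0 (M + gcdDiv x y)).map (LinearMap.mulLeft ℂ (x * y)) := by
    ext f
    constructor
    · rintro ⟨⟨s, hs, hs'⟩, ⟨t, ht, ht'⟩⟩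
      simp only [LinearMap.mulLeft_apply] at hs' ht'
      refine ⟨f / (x * y), ?_, by simp; field_simp⟩
      rw [SetLike.mem_coe, ← mul_mem_and_iff hx hy]
      constructor
      · rw [← ht', show x * (y * t / (x * y)) = t by field_simp]; exact ht
      · rw [← hs', show y * (x * s / (x * y)) = s by field_simp]; exact hs
    · rintro ⟨u, hu, rfl⟩
      rw [SetLike.mem_coe, ← mul_mem_and_iff hx hy] at hu
      exact ⟨⟨y * u, hu.2, by simp⟩, ⟨x * u, hu.1, by simp; ring⟩⟩
  rw [h2, finrank_map_mul (mul_ne_zero hx hy), finrank_map_mul hx, finrank_map_mul hy] at h1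
  unfold h0
  omega

theorem h0_neg_or (D : C.Div) : C.deg D + 1 - C.genus ≤ C.h0 D := by
  have := C.riemann_roch D
  omega

theorem nonempty_point {D : C.Div} (h : 2 ≤ C.h0 D) : Nonempty C.Point := by
  by_contra hP
  rw [not_nonempty_iff] at hP
  have : D = 0 := by ext P; exact hP.elim P
  rw [this, C.h0_triv] at h
  omega

/-- On a curve which is neither hyperelliptic nor trigonal, divisors of degree at most three
have at most one section. -/
theorem h0_le_one (hH : ¬ C.Hyperelliptic) (hT : ¬ C.Trigonal) {D : C.Div} (h : C.deg D ≤ 3) :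
    C.h0 D ≤ 1 := by
  by_contra! h2
  obtain ⟨P⟩ := nonempty_point (D := D) h2
  obtain ⟨E, hE, hE2⟩ : ∃ E : C.Div, C.deg E = 3 ∧ 2 ≤ C.h0 E := by
    refine ⟨D + (3 - C.deg D).toNat • C.pt P, ?_, le_trans h2 (h0_mono ?_)⟩
    · rw [deg_add, deg_nsmul, deg_pt]; omega
    · exact le_add_of_nonneg_right (nsmul_nonneg (pt_nonneg P) _)
  refine hT ⟨E, hE, hE2, fun Q => ?_⟩
  rcases sub_pt_eq_or E Q with h3 | h3
  · exact absurd ⟨E - C.pt Q, by rw [deg_sub, deg_pt, hE]; rfl, by omega⟩ hH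
  · exact h3

theorem nonempty_point' : Nonempty C.Point := by
  by_contra hP
  rw [not_nonempty_iff] at hP
  obtain ⟨x, hx, -⟩ := C.trdeg_one
  have h1 : ∀ f : C.F, f ∈ C.H0 0 := fun f => Or.inr fun P => hP.elim P
  have h2 : C.H0 0 = ⊤ := eq_top_iff.2 fun f _ => h1 f
  have h3 : Module.finrank ℂ C.F = 1 := by
    have := C.h0_triv
    rw [h0, h2, finrank_top] at this
    exact this
  obtain ⟨v, hv⟩ := finrank_eq_one_iff'.1 h3
  obtain ⟨c, hc⟩ := hv.2 1
  obtain ⟨d, hd⟩ := hv.2 x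
  have hc0 : c ≠ 0 := by rintro rfl; simp at hc
  refine hx ?_
  have : x = algebraMap ℂ C.F (d / c) := by
    rw [← hd, Algebra.algebraMap_eq_smul_one, ← hc, smul_smul, div_mul_cancel₀ _ hc0]
  rw [this]
  exact isAlgebraic_algebraMap _

theorem four_le_genus (hH : ¬ C.Hyperelliptic) (hT : ¬ C.Trigonal) : 4 ≤ C.genus := by
  obtain ⟨P⟩ := nonempty_point' (C := C)
  by_contra! hg
  have key : ∀ D : C.Div, C.deg D ≤ 3 → C.h0 D ≤ 1 := fun D => h0_le_one hH hT
  have h1 := key (2 • C.pt P) (by rw [deg_nsmul, deg_pt]; norm_num)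
  have h2 := h0_neg_or (2 • C.pt P)
  rw [deg_nsmul, deg_pt] at h2
  have h3 := deg_K (C := C)
  have h4 := h0_K (C := C)
  have h5 := h0_le_sub_pt C.K P
  have h6 := key (C.K - C.pt P) (by rw [deg_sub, deg_pt]; omega)
  have h7 : C.genus ≠ 2 := fun h => by
    have := key C.K (by omega)
    omega
  push_cast at h2
  omega

end Curve

namespace Polynomial

/-- Evaluation of a bivariate polynomial in a commutative algebra. -/
def evalPair {k A : Type*} [CommRing k] [CommRing A] [Algebra k A] (f h : A) (G : k[X][X]) : A :=
  G.eval₂ (aeval f : k[X] →ₐ[k] A).toRingHom h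

section
variable {k A : Type*} [CommRing k] [CommRing A] [Algebra k A]

theorem evalPair_map {B : Type*} [CommRing B] [Algebra k B] (φ : A →ₐ[k] B) (f h : A)
    (G : k[X][X]) : evalPair (φ f) (φ h) G = φ (evalPair f h G) := by
  unfold evalPair
  rw [← AlgHom.coe_toRingHom φ, hom_eval₂]
  congr 1
  ext x
  · simp
  · simp

theorem exists_aeval_add (p : k[X]) (a : k) (u : A) : ∃ r : A,
    aeval (algebraMap k A a + u) p =
      algebraMap k A (p.eval a) + algebraMap k A (p.derivative.eval a) * u + r * u ^ 2 := by
  obtain ⟨r, hr⟩ := binomExpansion (p.map (algebraMap k A)) (algebraMap k A a) u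
  refine ⟨r, ?_⟩
  rw [aeval_def, ← eval_map, hr, derivative_map, eval_map, eval_map, eval₂_at_apply,
    eval₂_at_apply]

/-- Second order Taylor expansion of a bivariate polynomial. -/
theorem exists_evalPair_add (G : k[X][X]) (a b : k) (u v : A) : ∃ r s t : A,
    evalPair (algebraMap k A a + u) (algebraMap k A b + v) G =
      algebraMap k A ((G.eval (C b)).eval a) +
      algebraMap k A ((G.eval (C b)).derivative.eval a) * u +
      algebraMap k A ((G.derivative.eval (C b)).eval a) * v + r * u ^ 2 + s * u * v + t * v ^ 2 := by
  set φ := (aeval (algebraMap k A a + u) : k[X] →ₐ[k] A).toRingHom with hφ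
  obtain ⟨t, ht⟩ := binomExpansion (G.map φ) (algebraMap k A b) v
  have hb : ∀ H : k[X][X], (H.map φ).eval (algebraMap k A b) =
      aeval (algebraMap k A a + u) (H.eval (C b)) := by
    intro H
    have : algebraMap k A b = φ (C b) := by simp [hφ]
    rw [this, eval_map, eval₂_at_apply]
    rfl
  rw [derivative_map, hb, hb] at ht
  obtain ⟨r, hr⟩ := exists_aeval_add (G.eval (C b)) a u
  obtain ⟨s, hs⟩ := exists_aeval_add (G.derivative.eval (C b)) a u
  refine ⟨r, algebraMap k A (derivative (eval (C b) (derivative G)) |>.eval a) + s * u, t, ?_⟩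
  rw [evalPair, ← eval_map, ht, hr, hs]
  ring

end
end Polynomial

namespace Curve
open PreCurve Polynomial
variable {C : Curve}

variable (C) in
/-- The constant functions. -/
def IsConst (f : C.F) : Prop := ∃ c : ℂ, algebraMap ℂ C.F c = f

theorem aeval_ne_zero {f : C.F} (hf : ¬ C.IsConst f) {p : ℂ[X]} (hp : p ≠ 0) :
    aeval f p ≠ 0 := by
  induction hn : p.natDegree generalizing p with
  | zero =>
    obtain ⟨c, rfl⟩ := natDegree_eq_zero.1 hn
    rw [aeval_C]
    exact algebraMap_ne_zero fun h => hp (by rw [h, C_0])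
  | succ n ih =>
    obtain ⟨a, ha⟩ := IsAlgClosed.exists_root p (fun h => by
      rw [natDegree_eq_of_degree_eq_some h] at hn; exact absurd hn (by simp))
    obtain ⟨q, rfl⟩ := dvd_iff_isRoot.2 ha
    have hq : q ≠ 0 := right_ne_zero_of_mul hp
    rw [map_mul]
    refine mul_ne_zero ?_ (ih hq ?_)
    · rw [map_sub, aeval_X, aeval_C]
      exact fun h => hf ⟨a, (sub_eq_zero.1 h).symm⟩
    · rw [natDegree_mul (X_sub_C_ne_zero a) hq, natDegree_X_sub_C] at hn
      omega

theorem h0_le_deg {D : C.Div} (hD : 0 ≤ D) : (C.h0 D : ℤ) ≤ C.deg D + 1 := by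
  have := h0_le_sub (C := C) hD (D := D)
  rw [sub_self, C.h0_triv] at this
  omega

theorem pow_mem_H0 {D : C.Div} {f : C.F} (hf : f ∈ C.H0 D) (n : ℕ) : f ^ n ∈ C.H0 (n • D) := by
  induction n with
  | zero =>
    rw [pow_zero, zero_smul, mem_H0']
    exact fun P => by simpa using one_mem_van P
  | succ n ih =>
    rw [pow_succ, add_smul, one_smul]
    rw [mem_H0'] at ih hf ⊢
    intro P
    have := mul_mem_van (ih P) (hf P)
    rwa [← neg_add] at this

theorem exists_H0 (f : C.F) : ∃ D : C.Div, 0 ≤ D ∧ f ∈ C.H0 D := by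
  rcases eq_or_ne f 0 with rfl | hf
  · exact ⟨0, le_rfl, zero_mem _⟩
  · refine ⟨(- C.divOf f) ⊔ 0, le_sup_right, ?_⟩
    rw [mem_H0_of_ne hf, ← neg_le_iff_add_nonneg']
    exact le_sup_left

theorem exists_relation (f h : C.F) : ∃ G : ℂ[X][X], G ≠ 0 ∧ evalPair f h G = 0 := by
  obtain ⟨Df, hDf, hf⟩ := exists_H0 f
  obtain ⟨Dh, hDh, hh⟩ := exists_H0 h
  set Z := Df + Dh with hZ
  have hZ0 : 0 ≤ Z := add_nonneg hDf hDh
  obtain ⟨d, hd⟩ : ∃ d : ℕ, C.deg Z = d := ⟨(C.deg Z).toNat, by have := deg_nonneg hZ0; omega⟩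
  set m := d + 2
  let w : Fin m × Fin m → C.H0 (m • Z) := fun ij =>
    ⟨f ^ (ij.1 : ℕ) * h ^ (ij.2 : ℕ), by
      have h1 := pow_mem_H0 hf (ij.1 : ℕ)
      have h2 := pow_mem_H0 hh (ij.2 : ℕ)
      have h3 : (ij.1 : ℕ) • Df + (ij.2 : ℕ) • Dh ≤ m • Z := by
        rw [hZ, smul_add]
        exact add_le_add (nsmul_le_nsmul_left hDf ij.1.2.le) (nsmul_le_nsmul_left hDh ij.2.2.le)
      refine H0_le h3 ?_
      rw [mem_H0'] at h1 h2 ⊢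
      intro P
      have := mul_mem_van (h1 P) (h2 P)
      rwa [← neg_add] at this⟩
  have hw : ¬ LinearIndependent ℂ w := by
    intro hw
    have h1 := hw.fintype_card_le_finrank
    have h2 := h0_le_deg (C := C) (D := m • Z) (nsmul_nonneg hZ0 m)
    rw [deg_nsmul, hd] at h2
    unfold h0 at h2
    have h3 : (m * m : ℤ) ≤ m * d + 1 := by
      refine le_trans ?_ h2
      simpa using (Int.ofNat_le.2 h1)
    have : (m : ℤ) = d + 2 := by simp [m]
    have hd0 : (0 : ℤ) ≤ d := by positivity
    rw [this] at h3
    nlinarith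
  obtain ⟨c, hc, i, hi⟩ := Fintype.not_linearIndependent_iff.1 hw
  refine ⟨∑ ij, monomial (ij.2 : ℕ) (monomial (ij.1 : ℕ) (c ij)), fun h0 => hi ?_, ?_⟩
  · have h1 := congr_arg (fun G : ℂ[X][X] => (G.coeff (i.2 : ℕ)).coeff (i.1 : ℕ)) h0
    simp only [finsetSum_coeff, coeff_monomial, coeff_zero] at h1
    rw [Finset.sum_eq_single i] at h1
    · simpa using h1
    · intro j _ hj
      split_ifs with h2
      · rw [coeff_monomial, if_neg]
        exact fun h3 => hj (Prod.ext (Fin.ext h3) (Fin.ext h2))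
      · rw [coeff_zero]
    · simp
  · have h1 := congr_arg (fun x : C.H0 (m • Z) => (x : C.F)) hc
    simp only [evalPair, eval₂_finsetSum, eval₂_monomial]
    simpa [w, Algebra.smul_def, mul_assoc, aeval_monomial] using h1

theorem exists_relation_deriv {f : C.F} (hf : ¬ C.IsConst f) (h : C.F) :
    ∃ G : ℂ[X][X], evalPair f h G = 0 ∧ evalPair f h (derivative G) ≠ 0 := by
  classical
  have hex : ∃ n, ∃ G : ℂ[X][X], G ≠ 0 ∧ evalPair f h G = 0 ∧ G.natDegree = n := by
    obtain ⟨G, hG, hG'⟩ := exists_relation f h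
    exact ⟨_, G, hG, hG', rfl⟩
  obtain ⟨G, hG0, hG, hn⟩ := Nat.find_spec hex
  refine ⟨G, hG, fun hG' => ?_⟩
  have h1 : G.natDegree ≠ 0 := by
    intro h0
    obtain ⟨p, rfl⟩ := natDegree_eq_zero.1 h0
    rw [evalPair, eval₂_C] at hG
    exact aeval_ne_zero hf (fun h => hG0 (by rw [h, C_0])) hG
  refine Nat.find_min hex (m := (derivative G).natDegree) ?_ ⟨_, ?_, hG', rfl⟩
  · rw [← hn]; exact natDegree_derivative_lt h1
  · intro h2
    exact h1 (derivative_eq_zero.1 h2)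

variable (C) in
/-- The functions regular at `P`. -/
def regular (P : C.Point) : Subalgebra ℂ C.F where
  carrier := {f | f ∈ C.van P 0}
  mul_mem' := mul_mem_van_zero
  add_mem' := (C.van P 0).add_mem
  algebraMap_mem' := algebraMap_mem_van P

theorem finite_not_regular (f : C.F) : {P : C.Point | f ∉ C.van P 0}.Finite := by
  rcases eq_or_ne f 0 with rfl | hf
  · simp
  refine (C.ord_finite_support f hf).subset fun P hP h => hP ?_
  rw [mem_van_of_ne hf]
  exact h.ge

theorem finite_zeros {f : C.F} (hf : f ≠ 0) : {P : C.Point | f ∈ C.van P 1}.Finite := by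
  refine (C.ord_finite_support f hf).subset fun P hP h => ?_
  rw [Set.mem_ofPred_eq, mem_van_of_ne hf] at hP
  change C.ord P f = 0 at h
  omega

/-- At almost all points, `h` is to first order a function of `f`; the differential coefficient
depends only on the values of `f` and `h`. -/
theorem exists_slope {f : C.F} (hf : ¬ C.IsConst f) (h : C.F) :
    ∃ (Z : Set C.Point) (s : ℂ → ℂ → ℂ), Z.Finite ∧ ∀ P ∉ Z, f ∈ C.van P 0 ∧ h ∈ C.van P 0 ∧
      h - algebraMap ℂ C.F (C.ev P h) ∈ C.van P (C.ord P (f - algebraMap ℂ C.F (C.ev P f))) ∧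
      h - algebraMap ℂ C.F (C.ev P h) -
        s (C.ev P f) (C.ev P h) • (f - algebraMap ℂ C.F (C.ev P f)) ∈ C.van P 2 := by
  obtain ⟨G, hG, hG'⟩ := exists_relation_deriv hf h
  refine ⟨{P | f ∉ C.van P 0} ∪ {P | h ∉ C.van P 0} ∪ {P | evalPair f h (derivative G) ∈ C.van P 1},
    fun a b => - (((G.eval (Polynomial.C b)).derivative.eval a) /
      ((G.derivative.eval (Polynomial.C b)).eval a)),
    ((finite_not_regular f).union (finite_not_regular h)).union (finite_zeros hG'), ?_⟩
  intro P hP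
  simp only [Set.mem_union, Set.mem_ofPred_eq, not_or, not_not] at hP
  obtain ⟨⟨hfP, hhP⟩, hGP⟩ := hP
  refine ⟨hfP, hhP, ?_⟩
  beta_reduce
  set a := C.ev P f
  set b := C.ev P h
  have hu : f - algebraMap ℂ C.F a ∈ C.van P 1 := sub_ev_mem hfP
  have hv : h - algebraMap ℂ C.F b ∈ C.van P 1 := sub_ev_mem hhP
  obtain ⟨u, hu'⟩ : ∃ u : C.regular P, (u : C.F) = f - algebraMap ℂ C.F a :=
    ⟨⟨_, van_mono zero_le_one hu⟩, rfl⟩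
  obtain ⟨v, hv'⟩ : ∃ v : C.regular P, (v : C.F) = h - algebraMap ℂ C.F b :=
    ⟨⟨_, van_mono zero_le_one hv⟩, rfl⟩
  have hf' : f = (C.regular P).val (algebraMap ℂ _ a + u) := by
    rw [map_add, AlgHom.commutes, Subalgebra.coe_val, hu', add_sub_cancel]
  have hh' : h = (C.regular P).val (algebraMap ℂ _ b + v) := by
    rw [map_add, AlgHom.commutes, Subalgebra.coe_val, hv', add_sub_cancel]
  rw [← hu', ← hv']
  rw [← hu'] at hu
  rw [← hv'] at hv
  rw [hf', hh', evalPair_map] at hG hGP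
  obtain ⟨r, s, t, hT⟩ := exists_evalPair_add G a b u v
  obtain ⟨r', s', t', hT'⟩ := exists_evalPair_add (derivative G) a b u v
  rw [hT] at hG
  rw [hT'] at hGP
  generalize (G.eval (Polynomial.C b)).eval a = c0 at *
  generalize (G.eval (Polynomial.C b)).derivative.eval a = cX at *
  generalize ((derivative G).eval (Polynomial.C b)).eval a = cY at *
  generalize ((derivative G).eval (Polynomial.C b)).derivative.eval a = d1 at *
  generalize ((derivative (derivative G)).eval (Polynomial.C b)).eval a = d2 at *
  have hE : algebraMap ℂ C.F c0 + algebraMap ℂ C.F cX * u + algebraMap ℂ C.F cY * v + r * u ^ 2 +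
      s * u * v + t * v ^ 2 = 0 := by simpa using hG
  have hE' : algebraMap ℂ C.F cY + algebraMap ℂ C.F d1 * u + algebraMap ℂ C.F d2 * v + r' * u ^ 2 +
      s' * u * v + t' * v ^ 2 ∉ C.van P 1 := by simpa using hGP
  have hr : (r : C.F) ∈ C.van P 0 := r.2
  have hs : (s : C.F) ∈ C.van P 0 := s.2
  have ht : (t : C.F) ∈ C.van P 0 := t.2
  have hr' : (r' : C.F) ∈ C.van P 0 := r'.2
  have hs' : (s' : C.F) ∈ C.van P 0 := s'.2
  have ht' : (t' : C.F) ∈ C.van P 0 := t'.2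
  generalize (r : C.F) = r at *
  generalize (s : C.F) = s at *
  generalize (t : C.F) = t at *
  generalize (r' : C.F) = r' at *
  generalize (s' : C.F) = s' at *
  generalize (t' : C.F) = t' at *
  generalize (u : C.F) = u at *
  generalize (v : C.F) = v at *
  have hc := algebraMap_mem_van (C := C.toPreCurve) P
  have mul01 : ∀ {x y : C.F} {n : ℤ}, x ∈ C.van P 0 → y ∈ C.van P n → x * y ∈ C.van P n :=
    fun hx hy => by simpa using mul_mem_van hx hy
  have h2 : ∀ x y z : C.F, x ∈ C.van P 0 → y ∈ C.van P 0 → z ∈ C.van P 0 →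
      x * u ^ 2 + y * u * v + z * v ^ 2 ∈ C.van P 2 := by
    intro x y z hx hy hz
    have huu := mul_mem_van hu hu
    have huv := mul_mem_van hu hv
    have hvv := mul_mem_van hv hv
    rw [pow_two, pow_two, mul_assoc y]
    exact add_mem (add_mem (mul01 hx huu) (mul01 hy huv)) (mul01 hz hvv)
  have h21 : C.van P 2 ≤ C.van P 1 := van_mono one_le_two
  have hcY : cY ≠ 0 := by
    rintro rfl
    refine hE' ?_
    have := add_mem (add_mem (mul01 (hc d1) hu) (mul01 (hc d2) hv)) (h21 (h2 r' s' t' hr' hs' ht'))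
    convert this using 1
    rw [map_zero]; ring
  have hc0 : c0 = 0 := by
    refine algebraMap_mem_van_one (P := P) (C := C.toPreCurve) ?_
    have := neg_mem (add_mem (add_mem (mul01 (hc cX) hu) (mul01 (hc cY) hv))
      (h21 (h2 r s t hr hs ht)))
    convert this using 1
    linear_combination hE
  rw [hc0, map_zero, zero_add] at hE
  constructor
  · set W := algebraMap ℂ C.F cY + s * u + t * v with hW
    have hW0 : W ∈ C.van P 0 :=
      add_mem (add_mem (hc cY) (van_mono zero_le_one (mul01 hs hu)))
        (van_mono zero_le_one (mul01 ht hv))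
    have hW1 : W ∉ C.van P 1 := by
      intro h
      refine hcY (algebraMap_mem_van_one (P := P) (C := C.toPreCurve) ?_)
      have := sub_mem h (add_mem (mul01 hs hu) (mul01 ht hv))
      convert this using 1
      rw [hW]; ring
    have hWne : W ≠ 0 := fun h => hW1 (h ▸ zero_mem _)
    have hWi : W⁻¹ ∈ C.van P 0 := by
      rw [mem_van_of_ne hWne] at hW1
      rw [mem_van_of_ne (inv_ne_zero hWne), ord_inv]
      omega
    have hv2 : v = (- (algebraMap ℂ C.F cX + r * u) * W⁻¹) * u := by
      field_simp
      linear_combination hE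
    rw [hv2]
    refine mul01 (mul_mem_van_zero (neg_mem (add_mem (hc cX) ?_)) hWi) (Or.inr le_rfl)
    exact van_mono zero_le_one (mul01 hr hu)
  · have h3 := mul01 (hc (-cY⁻¹)) (h2 r s t hr hs ht)
    convert h3 using 1
    have h4 : algebraMap ℂ C.F (cY⁻¹) * algebraMap ℂ C.F cY = 1 := by
      rw [← map_mul, inv_mul_cancel₀ hcY, map_one]
    rw [Algebra.smul_def, map_neg, map_neg, div_eq_mul_inv, map_mul]
    linear_combination (-v) * h4 + algebraMap ℂ C.F cY⁻¹ * hE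

end Curve

namespace Curve
open PreCurve
variable {C : Curve}

theorem exists_uniform_slope {f : C.F} (hf : ¬ C.IsConst f) (W : Submodule ℂ C.F)
    [FiniteDimensional ℂ W] : ∃ Z : Set C.Point, Z.Finite ∧
      (∀ P ∉ Z, f ∈ C.van P 0 ∧ W ≤ C.van P 0 ∧ ∀ h ∈ W, ∃ c : ℂ,
        h - algebraMap ℂ C.F c ∈ C.van P (C.ord P (f - algebraMap ℂ C.F (C.ev P f)))) ∧
      ∀ P ∉ Z, ∀ Q ∉ Z, C.ev P f = C.ev Q f → (∀ h ∈ W, C.ev P h = C.ev Q h) →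
        ∀ h ∈ W, ∃ c d : ℂ,
          h - algebraMap ℂ C.F c - d • (f - algebraMap ℂ C.F (C.ev P f)) ∈ C.van P 2 ∧
          h - algebraMap ℂ C.F c - d • (f - algebraMap ℂ C.F (C.ev Q f)) ∈ C.van Q 2 := by
  let b := Module.finBasis ℂ W
  have hb : W = Submodule.span ℂ (Set.range fun i => (b i : C.F)) := by
    have := congr_arg (Submodule.map W.subtype) b.span_eq
    rw [Submodule.map_span, Submodule.map_top, Submodule.range_subtype, ← Set.range_comp] at this
    exact this.symm
  choose Z s hZ h using fun i => exists_slope hf (b i : C.F)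
  obtain ⟨Z0, hZ0, h0⟩ : ∃ Z0 : Set C.Point, Z0.Finite ∧ ∀ P ∉ Z0, f ∈ C.van P 0 :=
    ⟨_, finite_not_regular f, fun P hP => by simpa using hP⟩
  refine ⟨(⋃ i, Z i) ∪ Z0, (Set.finite_iUnion hZ).union hZ0, ?_, ?_⟩
  · intro P hP
    simp only [Set.mem_union, Set.mem_iUnion, not_or, not_exists] at hP
    refine ⟨h0 P hP.2, ?_, ?_⟩
    · rw [hb, Submodule.span_le]
      rintro _ ⟨i, rfl⟩
      exact (h i P (hP.1 i)).2.1
    · intro w hw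
      rw [hb] at hw
      induction hw using Submodule.span_induction with
      | mem x hx =>
        obtain ⟨i, rfl⟩ := hx
        exact ⟨_, (h i P (hP.1 i)).2.2.1⟩
      | zero => exact ⟨0, by simp⟩
      | add x y _ _ hx hy =>
        obtain ⟨c, hc⟩ := hx
        obtain ⟨d, hd⟩ := hy
        exact ⟨c + d, by rw [map_add, add_sub_add_comm]; exact add_mem hc hd⟩
      | smul a x _ hx =>
        obtain ⟨c, hc⟩ := hx
        refine ⟨a * c, ?_⟩
        rw [map_mul, ← Algebra.smul_def, ← smul_sub]
        exact Submodule.smul_mem _ _ hc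
  · intro P hP Q hQ hPQ hPQ' w hw
    simp only [Set.mem_union, Set.mem_iUnion, not_or, not_exists] at hP hQ
    rw [hb] at hw
    induction hw using Submodule.span_induction with
    | mem x hx =>
      obtain ⟨i, rfl⟩ := hx
      refine ⟨_, _, (h i P (hP.1 i)).2.2.2, ?_⟩
      rw [hPQ, hPQ' _ (b i).2]
      exact (h i Q (hQ.1 i)).2.2.2
    | zero => exact ⟨0, 0, by simp, by simp⟩
    | add x y _ _ hx hy =>
      obtain ⟨c, d, h1, h2⟩ := hx
      obtain ⟨c', d', h1', h2'⟩ := hy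
      refine ⟨c + c', d + d', ?_, ?_⟩
      · convert add_mem h1 h1' using 1
        rw [map_add, add_smul]; ring
      · convert add_mem h2 h2' using 1
        rw [map_add, add_smul]; ring
    | smul a x _ hx =>
      obtain ⟨c, d, h1, h2⟩ := hx
      refine ⟨a * c, a * d, ?_, ?_⟩
      · convert Submodule.smul_mem _ a h1 using 1
        simp only [map_mul, ← Algebra.smul_def, mul_smul, smul_sub]
      · convert Submodule.smul_mem _ a h2 using 1
        simp only [map_mul, ← Algebra.smul_def, mul_smul, smul_sub]

theorem mem_H0_sub_pt_pt {D : C.Div} {P : C.Point} {f : C.F} :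
    f ∈ C.H0 (D - C.pt P - C.pt P) ↔ f ∈ C.H0 D ∧ f ∈ C.van P (2 - D P) := by
  rw [mem_H0_sub_pt, mem_H0_sub_pt, Finsupp.sub_apply, pt_self,
    show 1 - (D P - 1) = 2 - D P by ring, and_assoc]
  exact and_congr_right fun _ => and_iff_right_of_imp fun h => van_mono (by omega) h

theorem sub_ev_ne_zero {f : C.F} (hf : ¬ C.IsConst f) (c : ℂ) : f - algebraMap ℂ C.F c ≠ 0 :=
  fun h => hf ⟨c, (sub_eq_zero.1 h).symm⟩

/-- A nonconstant function is unramified at almost all points. -/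
theorem exists_unramified {f : C.F} (hf : ¬ C.IsConst f) : ∃ Z : Set C.Point, Z.Finite ∧
    ∀ P ∉ Z, f ∈ C.van P 0 ∧ C.ord P (f - algebraMap ℂ C.F (C.ev P f)) = 1 := by
  obtain ⟨P₀⟩ := nonempty_point' (C := C)
  set E := (2 * C.genus + 1) • C.pt P₀ with hE
  have hEd : C.deg E = 2 * C.genus + 1 := by rw [hE, deg_nsmul, deg_pt]; push_cast; ring
  obtain ⟨Z, hZ, h1, -⟩ := exists_uniform_slope hf (C.H0 E)
  refine ⟨Z ∪ {P₀}, hZ.union (Set.finite_singleton _), fun P hP => ?_⟩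
  simp only [Set.mem_union, Set.mem_singleton_iff, not_or] at hP
  obtain ⟨h2, h3, h4⟩ := h1 P hP.1
  refine ⟨h2, ?_⟩
  have h5 := (mem_van_of_ne (sub_ev_ne_zero hf _)).1 (sub_ev_mem h2)
  by_contra h6
  have hEP : E P = 0 := by rw [hE, Finsupp.smul_apply, pt_ne (Ne.symm hP.2), smul_zero]
  have h7 : C.H0 (E - C.pt P) ≤ C.H0 (E - C.pt P - C.pt P) := by
    intro h hh
    rw [mem_H0_sub_pt, hEP] at hh
    rw [mem_H0_sub_pt_pt, hEP]
    refine ⟨hh.1, ?_⟩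
    obtain ⟨c, hc⟩ := h4 h hh.1
    have hc2 := van_mono (show (2 : ℤ) ≤ _ by omega) hc
    have hc1 := sub_mem hh.2 (van_mono (by omega) hc2 : _ ∈ C.van P (1 - 0))
    rw [sub_sub_cancel] at hc1
    rw [algebraMap_mem_van_one hc1, map_zero, sub_zero] at hc2
    exact hc2
  have h8 := Submodule.finrank_mono h7
  change C.h0 _ ≤ C.h0 _ at h8
  have h9 := h0_of_deg (D := E - C.pt P) (by rw [deg_sub, deg_pt]; omega)
  have h10 := h0_of_deg (D := E - C.pt P - C.pt P) (by rw [deg_sub, deg_sub, deg_pt]; omega)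
  rw [deg_sub _ (C.pt P), deg_pt] at h10
  omega

theorem div_mem_van_iff {P : C.Point} {s s₀ : C.F} (h : s₀ ≠ 0) (n : ℤ) :
    s / s₀ ∈ C.van P n ↔ s ∈ C.van P (n + C.ord P s₀) := by
  rcases eq_or_ne s 0 with rfl | hs
  · simp
  rw [mem_van_of_ne hs, mem_van_of_ne (div_ne_zero hs h), ord_div P hs h]
  omega

theorem exists_mem_ne_zero {D : C.Div} (h : 1 ≤ C.h0 D) : ∃ s ∈ C.H0 D, s ≠ 0 := by
  have : C.H0 D ≠ ⊥ := by
    intro h'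
    rw [h0, h', finrank_bot] at h
    omega
  exact Submodule.exists_mem_ne_zero_of_ne_bot this

theorem exists_pencil {D : C.Div} (h : 2 ≤ C.h0 D) : ∃ s ∈ C.H0 D, ∃ t ∈ C.H0 D, s ≠ 0 ∧
    ¬ C.IsConst (t / s) := by
  obtain ⟨s, hs, hs0⟩ := exists_mem_ne_zero (by omega : 1 ≤ C.h0 D)
  obtain ⟨t, ht, hts⟩ : ∃ t ∈ C.H0 D, t ∉ Submodule.span ℂ {s} := by
    by_contra! hc
    have h1 := Submodule.finrank_mono hc
    rw [finrank_span_singleton hs0] at h1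
    exact absurd h (by unfold h0; omega)
  refine ⟨s, hs, t, ht, hs0, ?_⟩
  rintro ⟨c, hc⟩
  refine hts (Submodule.mem_span_singleton.2 ⟨c, ?_⟩)
  rw [Algebra.smul_def, hc, div_mul_cancel₀ _ hs0]

/-- The zeros of a nonzero section are finite in number. -/
theorem finite_section_zeros (D : C.Div) {s : C.F} (hs : s ≠ 0) :
    {P : C.Point | s ∈ C.van P (1 - D P)}.Finite := by
  refine ((C.ord_finite_support s hs).union D.hasFiniteSupport).subset fun P hP => ?_
  rw [Set.mem_ofPred_eq, mem_van_of_ne hs] at hP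
  by_contra h
  simp only [Set.mem_union, mem_support, not_or, not_not] at h
  omega

/-- At almost all points `Q`, sections of `M` separate first order tangent vectors, and if `R` has
the same image as `Q` then it has the same tangent line. -/
theorem exists_tangent_separation {M : C.Div} (hM : 2 ≤ C.h0 M) : ∃ Z : Set C.Point, Z.Finite ∧
    (∀ Q ∉ Z, C.h0 (M - C.pt Q - C.pt Q) + 2 = C.h0 M) ∧
    (C.BasePointFree M → ∀ Q ∉ Z, ∀ R, C.H0 (M - C.pt Q) ≤ C.H0 (M - C.pt R) →
      C.H0 (M - C.pt Q - C.pt Q) ≤ C.H0 (M - C.pt R - C.pt R)) := by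
  obtain ⟨s, hs, t, ht, hs0, hf⟩ := exists_pencil hM
  set W := (C.H0 M).map (LinearMap.mulLeft ℂ s⁻¹) with hW
  have hWm : ∀ x ∈ C.H0 M, x / s ∈ W := fun x hx => ⟨x, hx, by
    simp [div_eq_inv_mul]⟩
  obtain ⟨Z₁, hZ₁, h1, h2⟩ := exists_uniform_slope hf W
  obtain ⟨Z₂, hZ₂, h3⟩ := exists_unramified hf
  set Z := Z₁ ∪ Z₂ ∪ {P : C.Point | s ∈ C.van P (1 - M P)} with hZdef
  have hZ : Z.Finite := (hZ₁.union hZ₂).union (finite_section_zeros M hs0)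
  have hord : ∀ P ∉ Z, C.ord P s = - M P := by
    intro P hP
    simp only [hZdef, Set.mem_union, not_or, Set.mem_ofPred_eq, mem_van_of_ne hs0] at hP
    have := (mem_van_of_ne hs0).1 (mem_H0'.1 hs P)
    omega
  have hv1 : ∀ P ∉ Z, ∀ x ∈ C.H0 M, x ∈ C.H0 (M - C.pt P) ↔ x / s ∈ C.van P 1 := by
    intro P hP x hx
    rw [mem_H0_sub_pt, and_iff_right hx, div_mem_van_iff hs0, hord P hP]
    rfl
  have hv2 : ∀ P ∉ Z, ∀ x ∈ C.H0 M, x ∈ C.H0 (M - C.pt P - C.pt P) ↔ x / s ∈ C.van P 2 := by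
    intro P hP x hx
    rw [mem_H0_sub_pt_pt, and_iff_right hx, div_mem_van_iff hs0, hord P hP]
    rfl
  have hsub : ∀ (x : C.F) (c : ℂ), (x - c • s) / s = x / s - algebraMap ℂ C.F c := by
    intro x c
    rw [Algebra.smul_def]
    field_simp
  have hsep : ∀ Q ∉ Z, C.h0 (M - C.pt Q - C.pt Q) + 2 = C.h0 M := by
    intro Q hQ
    have hQ' := hQ
    simp only [hZdef, Set.mem_union, not_or] at hQ'
    obtain ⟨h4, h5⟩ := h3 Q hQ'.1.2
    have h6 : s ∉ C.H0 (M - C.pt Q) := by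
      rw [hv1 Q hQ s hs, div_self hs0, mem_van_of_ne one_ne_zero, ord_one]; omega
    have hm : t - C.ev Q (t / s) • s ∈ C.H0 M := sub_mem ht (Submodule.smul_mem _ _ hs)
    have h7 : t - C.ev Q (t / s) • s ∈ C.H0 (M - C.pt Q) := by
      rw [hv1 Q hQ _ hm, hsub]; exact sub_ev_mem h4
    have h8 : t - C.ev Q (t / s) • s ∉ C.H0 (M - C.pt Q - C.pt Q) := by
      rw [hv2 Q hQ _ hm, hsub, mem_van_of_ne (sub_ev_ne_zero hf _), h5]; omega
    rcases sub_pt_eq_or M Q with h9 | h9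
    · exact absurd (H0_sub_pt_eq_of_h0 h9 ▸ hs) h6
    rcases sub_pt_eq_or (M - C.pt Q) Q with h10 | h10
    · exact absurd (H0_sub_pt_eq_of_h0 h10 ▸ h7) h8
    omega
  have hex : ∀ R : C.Point, ∃ s ∈ C.H0 (M - C.pt R), s ≠ 0 := fun R =>
    exists_mem_ne_zero (by have := h0_le_sub_pt M R; omega)
  choose r hr hr0 using hex
  refine ⟨Z ∪ ⋃ R ∈ Z, {P : C.Point | r R ∈ C.van P (1 - M P)}, hZ.union
    (hZ.biUnion fun R _ => finite_section_zeros M (hr0 R)), fun Q hQ => hsep Q ?_, ?_⟩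
  · exact fun h => hQ (Or.inl h)
  intro hbpf Q hQ R hQR
  rw [Set.mem_union, not_or] at hQ
  obtain ⟨hQ, hQ2⟩ := hQ
  simp only [Set.mem_iUnion, not_exists] at hQ2
  have hR : R ∉ Z := by
    intro hR
    have h4 : C.H0 (M - C.pt Q) = C.H0 (M - C.pt R) := by
      refine Submodule.eq_of_le_of_finrank_eq hQR ?_
      have := hbpf Q
      have := hbpf R
      change C.h0 _ = C.h0 _
      omega
    have h5 := hr R
    rw [← h4, mem_H0_sub_pt] at h5
    exact hQ2 R hR h5.2
  have hQ' := hQ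
  have hR' := hR
  simp only [hZdef, Set.mem_union, not_or] at hQ' hR'
  have hev : ∀ h ∈ W, C.ev Q h = C.ev R h := by
    rintro _ ⟨x, hx, rfl⟩
    simp only [LinearMap.mulLeft_apply, ← div_eq_inv_mul]
    have hxQ := (h1 Q hQ'.1.1).2.1 (hWm x hx)
    have hxR := (h1 R hR'.1.1).2.1 (hWm x hx)
    symm
    rw [ev_eq_iff hxR, ← hsub, ← hv1 R hR _ (sub_mem hx (Submodule.smul_mem _ _ hs))]
    refine hQR ?_
    rw [hv1 Q hQ _ (sub_mem hx (Submodule.smul_mem _ _ hs)), hsub]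
    exact sub_ev_mem hxQ
  intro x hx
  have hxM := (mem_H0_sub_pt_pt.1 hx).1
  rw [hv2 Q hQ x hxM] at hx
  rw [hv2 R hR x hxM]
  obtain ⟨c, d, hc, hd⟩ := h2 Q hQ'.1.1 R hR'.1.1 (hev _ (hWm t ht)) hev _ (hWm x hxM)
  obtain ⟨h4, h5⟩ := h3 Q hQ'.1.2
  have h6 := sub_mem hx hc
  rw [sub_sub, sub_sub_cancel] at h6
  have h7 : c = 0 := by
    have h8 := Submodule.smul_mem _ d (sub_ev_mem h4)
    have h9 := sub_mem (van_mono one_le_two h6) h8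
    rw [add_sub_cancel_right] at h9
    exact algebraMap_mem_van_one h9
  have h8 : d = 0 := by
    by_contra h8
    rw [h7, map_zero, zero_add, mem_van_of_ne, ord_smul _ h8, h5] at h6
    · omega
    · exact smul_ne_zero h8 (sub_ev_ne_zero hf _)
  rw [h7, h8, map_zero, zero_smul, sub_zero, sub_zero] at hd
  exact hd

end Curve

namespace Curve
open PreCurve
variable {C : Curve}

theorem one_mem_H0 {D : C.Div} (hD : 0 ≤ D) : (1 : C.F) ∈ C.H0 D := by
  rw [mem_H0']
  exact fun P => van_mono (by have := hD P; simp at this; omega) (one_mem_van P)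

/-- An effective divisor with one section has only constant sections. -/
theorem isConst_of_mem {D : C.Div} (hD : 0 ≤ D) (h : C.h0 D ≤ 1) {f : C.F} (hf : f ∈ C.H0 D) :
    C.IsConst f := by
  have h1 : Submodule.span ℂ {(1 : C.F)} = C.H0 D := by
    refine Submodule.eq_of_le_of_finrank_le ?_ ?_
    · rw [Submodule.span_le, Set.singleton_subset_iff]
      exact one_mem_H0 hD
    · rw [finrank_span_singleton one_ne_zero]
      exact h
  rw [← h1, Submodule.mem_span_singleton] at hf
  obtain ⟨c, rfl⟩ := hf
  exact ⟨c, Algebra.algebraMap_eq_smul_one c⟩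

theorem divOf_inv {f : C.F} (hf : f ≠ 0) : C.divOf f⁻¹ = - C.divOf f := by
  ext P
  rw [divOf_apply (inv_ne_zero hf), Finsupp.neg_apply, divOf_apply hf, ord_inv]

/-- A nonconstant function has a zero. -/
theorem exists_zero {f : C.F} (hf : ¬ C.IsConst f) : ∃ P : C.Point, f ∈ C.van P 1 := by
  have hf0 : f ≠ 0 := by rintro rfl; exact hf ⟨0, map_zero _⟩
  by_contra! h
  have h1 : 0 ≤ - C.divOf f := by
    intro P
    have h2 := h P
    rw [mem_van_of_ne hf0] at h2
    rw [Finsupp.neg_apply, divOf_apply hf0, Finsupp.zero_apply]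
    omega
  have h2 := eq_zero_of_deg h1 (by rw [deg_neg, deg_divOf hf0, neg_zero])
  refine hf (isConst_of_mem le_rfl C.h0_triv.le ?_)
  rw [mem_H0_of_ne hf0, neg_eq_zero.1 h2, zero_add]

theorem exists_ev_eq {f : C.F} (hf : ¬ C.IsConst f) (c : ℂ) :
    ∃ P : C.Point, f ∈ C.van P 0 ∧ C.ev P f = c := by
  have h1 : ¬ C.IsConst (f - algebraMap ℂ C.F c) := by
    rintro ⟨d, hd⟩
    exact hf ⟨d + c, by rw [map_add, hd]; ring⟩
  obtain ⟨P, hP⟩ := exists_zero h1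
  have h2 : f ∈ C.van P 0 := by
    have := add_mem (van_mono (by omega) hP) (algebraMap_mem_van P c)
    rwa [sub_add_cancel] at this
  exact ⟨P, h2, (ev_eq_iff h2).2 hP⟩

theorem exists_nonconst : ∃ f : C.F, ¬ C.IsConst f := by
  obtain ⟨x, hx, -⟩ := C.trdeg_one
  refine ⟨x, ?_⟩
  rintro ⟨c, rfl⟩
  exact hx (isAlgebraic_algebraMap _)

theorem not_countable_point : ¬ (Set.univ : Set C.Point).Countable := by
  intro h
  obtain ⟨f, hf⟩ := exists_nonconst (C := C)
  have h1 : Surjective fun P => C.ev P f := fun c => by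
    obtain ⟨P, -, hP⟩ := exists_ev_eq hf c
    exact ⟨P, hP⟩
  have h2 := h.image fun P => C.ev P f
  rw [Set.image_univ, h1.range_eq] at h2
  exact not_countable_complex h2

theorem h0_sub_comm_pt (D : C.Div) (P Q : C.Point) :
    D - C.pt P - C.pt Q = D - C.pt Q - C.pt P := sub_right_comm _ _ _

theorem exists_base_point {D : C.Div} (h : ¬ C.BasePointFree D) :
    ∃ R, C.H0 D ≤ C.H0 (D - C.pt R) := by
  unfold BasePointFree at h
  push Not at h
  obtain ⟨R, hR⟩ := h
  exact ⟨R, (H0_sub_pt_eq_of_h0 ((sub_pt_eq_or D R).resolve_right hR)).ge⟩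

theorem exists_uncountable_sub_pt {L : C.Div} (hL : C.BasePointFree L) (h4 : 4 ≤ C.h0 L)
    {S : Set C.Point} (hS : ¬ S.Countable) (hSb : ∀ P ∈ S, C.BasePointFree (L - C.pt P))
    {F₀ : Set C.Point} (hF₀ : F₀.Finite) :
    ∃ P ∈ S, P ∉ F₀ ∧ ¬ {Q | C.BasePointFree (L - C.pt P - C.pt Q)}.Countable := by
  by_contra! h
  have hinf : (S \ F₀).Infinite := by
    intro hf
    exact hS ((hf.union hF₀).countable.mono fun P hP => by
      by_cases hPF : P ∈ F₀
      · exact Or.inr hPF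
      · exact Or.inl ⟨hP, hPF⟩)
  set p : ℕ → C.Point := fun i => (hinf.natEmbedding (S \ F₀) i : C.Point) with hp
  have hpi : Injective p := Subtype.val_injective.comp (hinf.natEmbedding (S \ F₀)).injective
  have hpS : ∀ i, p i ∈ S := fun i => (hinf.natEmbedding (S \ F₀) i).2.1
  have hpF : ∀ i, p i ∉ F₀ := fun i => (hinf.natEmbedding (S \ F₀) i).2.2
  have hM : ∀ P, 3 ≤ C.h0 (L - C.pt P) := fun P => by have := hL P; omega
  choose Z hZ h1 h2 using fun i =>
    exists_tangent_separation (M := L - C.pt (p i)) (by have := hM (p i); omega)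
  obtain ⟨Q, hQS, hQ⟩ : ∃ Q ∈ S, Q ∉ ⋃ i, ({Q | C.BasePointFree (L - C.pt (p i) - C.pt Q)} ∪
      (Z i ∪ {p i})) := by
    by_contra! hc
    refine hS (Set.Countable.mono hc (Set.countable_iUnion fun i => ?_))
    exact (h _ (hpS i) (hpF i)).union ((hZ i).countable.union (Set.countable_singleton _))
  simp only [Set.mem_iUnion, Set.mem_union, Set.mem_ofPred_eq, Set.mem_singleton_iff, not_exists,
    not_or] at hQ
  choose R hR using fun i => exists_base_point (hQ i).1
  have hRQ : ∀ i, R i ≠ Q := by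
    intro i hi
    have h3 := Submodule.finrank_mono (hR i)
    have h4 := h1 i Q (hQ i).2.1
    have h5 := h0_le_sub_pt (L - C.pt (p i)) Q
    rw [hi] at h3
    unfold h0 at *
    omega
  obtain ⟨Z', hZ', h1', -⟩ := exists_tangent_separation (M := L - C.pt Q)
    (by have := hM Q; omega)
  have hRp : ∀ i, p i ∉ Z' → R i ≠ p i := by
    intro i hi hi'
    have h3 := Submodule.finrank_mono (hR i)
    have h4 := h1' (p i) hi
    have h5 := h0_le_sub_pt (L - C.pt Q) (p i)
    rw [hi', h0_sub_comm_pt L] at h3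
    unfold h0 at *
    omega
  have h3 : ∀ i, C.H0 (L - C.pt (p i) - C.pt Q - C.pt Q) ≤
      C.H0 (L - C.pt (p i) - C.pt (R i) - C.pt (R i)) := by
    intro i
    refine h2 i (hSb _ (hpS i)) Q (hQ i).2.1 (R i) ((hR i).trans ?_)
    rw [h0_sub_comm_pt]
    exact H0_sub_pt_le _ _
  set N := L - C.pt Q - C.pt Q with hN
  obtain ⟨ZN, hZN, h1N, -⟩ := exists_tangent_separation (M := N) (by
    have := hM Q
    have : C.h0 (L - C.pt Q) ≤ C.h0 N + 1 := h0_le_sub_pt (L - C.pt Q) Q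
    omega)
  have hRN : ∀ i, p i ∉ Z' → R i ∈ ZN := by
    intro i hi
    have h5 : C.H0 (N - C.pt (p i)) ≤ C.H0 (N - C.pt (R i) - C.pt (R i)) := by
      intro f hf
      have hf1 := H0_sub_pt_le _ _ hf
      have hf2 : f ∈ C.H0 (L - C.pt (p i) - C.pt Q - C.pt Q) := by
        rwa [show L - C.pt (p i) - C.pt Q - C.pt Q = N - C.pt (p i) by rw [hN]; abel]
      have hf3 := (mem_H0_sub_pt_pt.1 (h3 i hf2)).2
      rw [mem_H0_sub_pt_pt]
      refine ⟨hf1, ?_⟩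
      rw [Finsupp.sub_apply, pt_ne (hRp i hi).symm] at hf3
      rw [hN, Finsupp.sub_apply, Finsupp.sub_apply, pt_ne (hRQ i).symm]
      simpa using hf3
    by_contra hc
    have h6 := h1N _ hc
    have h7 := h0_le_sub_pt N (p i)
    have h8 := Submodule.finrank_mono h5
    unfold h0 at *
    omega
  have hIinf : {i | p i ∉ Z'}.Infinite := by
    have : {i | p i ∈ Z'}.Finite := hZ'.preimage hpi.injOn
    exact this.infinite_compl
  obtain ⟨R₀, hR₀⟩ : ∃ R₀, {i | p i ∉ Z' ∧ R i = R₀}.Infinite := by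
    by_contra! hc
    refine hIinf ((hZN.biUnion fun R₀ _ => hc R₀).subset fun i hi => ?_)
    simp only [Set.mem_iUnion]
    exact ⟨R i, hRN i hi, hi, rfl⟩
  obtain ⟨s, hs, hs0⟩ := exists_mem_ne_zero (D := L - C.pt Q - C.pt R₀) (by
    have := hM Q
    have := h0_le_sub_pt (L - C.pt Q) R₀
    omega)
  refine hR₀ (((finite_section_zeros (L - C.pt Q) hs0).preimage hpi.injOn).subset ?_)
  rintro i ⟨-, hi⟩
  have h5 : C.H0 (L - C.pt Q - C.pt (p i)) ≤ C.H0 (L - C.pt Q - C.pt R₀) := by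
    rw [h0_sub_comm_pt L, ← hi]
    refine (hR i).trans ?_
    exact H0_le (sub_le_sub_right (sub_le_sub_right (sub_le_self _ (pt_nonneg _)) _) _)
  have h6 : C.H0 (L - C.pt Q - C.pt (p i)) = C.H0 (L - C.pt Q - C.pt R₀) := by
    refine Submodule.eq_of_le_of_finrank_eq h5 ?_
    have := hSb Q hQS (p i)
    have := hSb Q hQS R₀
    change C.h0 _ = C.h0 _
    omega
  rw [← h6, mem_H0_sub_pt] at hs
  exact hs.2

theorem canonical_bpf (hH : ¬ C.Hyperelliptic) (hT : ¬ C.Trigonal) {D : C.Div}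
    (hD : C.deg D ≤ 2) (hD' : C.h0 D = 1) : C.BasePointFree (C.K - D) := by
  intro P
  have h1 := C.riemann_roch D
  have h2 := C.riemann_roch (D + C.pt P)
  have h3 := h0_le_one hH hT (D := D + C.pt P) (by rw [deg_add, deg_pt]; omega)
  have h4 := h0_mono (le_add_of_nonneg_right (pt_nonneg P) : D ≤ D + C.pt P)
  rw [deg_add, deg_pt] at h2
  rw [sub_sub]
  omega

/-- `K` is very ample. -/
theorem canonical_veryAmple (hH : ¬ C.Hyperelliptic) (hT : ¬ C.Trigonal) : C.VeryAmple C.K := by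
  intro P Q
  have h1 := C.riemann_roch (C.pt P + C.pt Q)
  have h3 := h0_le_one hH hT (D := C.pt P + C.pt Q) (by rw [deg_add, deg_pt, deg_pt]; omega)
  have h4 := h0_mono (add_nonneg (pt_nonneg P) (pt_nonneg Q) : (0 : C.Div) ≤ C.pt P + C.pt Q)
  rw [deg_add, deg_pt, deg_pt] at h1
  rw [sub_sub]
  have := h0_K (C := C)
  have := C.h0_triv
  omega

theorem exists_partial_general_position (hH : ¬ C.Hyperelliptic) (hT : ¬ C.Trigonal)
    {F₀ : Set C.Point} (hF₀ : F₀.Finite) (j : ℕ) (hj : j + 3 ≤ C.genus) :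
    ∃ T : Finset C.Point, T.card = j ∧ (∀ P ∈ T, P ∉ F₀) ∧
      C.BasePointFree (C.K - ∑ P ∈ T, C.pt P) ∧ C.h0 (C.K - ∑ P ∈ T, C.pt P) + j = C.genus ∧
      ¬ {Q | C.BasePointFree (C.K - ∑ P ∈ T, C.pt P - C.pt Q)}.Countable := by
  classical
  induction j with
  | zero =>
    refine ⟨∅, rfl, by simp, ?_, by simp [h0_K], ?_⟩
    · rw [Finset.sum_empty]
      exact canonical_bpf hH hT (by rw [deg_zero]; norm_num) C.h0_triv
    · refine fun hc => not_countable_point (C := C) (hc.mono fun Q _ => ?_)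
      rw [Finset.sum_empty, sub_zero, Set.mem_ofPred_eq]
      refine canonical_bpf hH hT (by rw [deg_pt]; norm_num) ?_
      have h3 := h0_le_one hH hT (D := C.pt Q) (by rw [deg_pt]; omega)
      have h4 := h0_mono (pt_nonneg Q)
      have := C.h0_triv
      omega
  | succ j ih =>
    obtain ⟨T, h1, h2, h3, h4, h5⟩ := ih (by omega)
    obtain ⟨P, hP1, hP2, hP3⟩ := exists_uncountable_sub_pt h3 (by omega) h5 (fun P hP => hP)
      (hF₀.union T.finite_toSet)
    simp only [Set.mem_union, Finset.mem_coe, not_or] at hP2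
    have h6 : C.K - ∑ P ∈ insert P T, C.pt P = C.K - ∑ P ∈ T, C.pt P - C.pt P := by
      rw [Finset.sum_insert hP2.2]; abel
    refine ⟨insert P T, by rw [Finset.card_insert_of_notMem hP2.2, h1], ?_, ?_, ?_, ?_⟩
    · intro Q hQ
      rcases Finset.mem_insert.1 hQ with rfl | hQ
      · exact hP2.1
      · exact h2 Q hQ
    · rw [h6]; exact hP1
    · rw [h6]
      have := h3 P
      omega
    · rw [h6]; exact hP3

/-- Points of the curve in general position: they span a pencil of hyperplanes of the canonical
space without further common zeros. -/
def GenPos {ι : Type*} [Fintype ι] (P : ι → C.Point) : Prop :=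
  C.h0 (C.K - ∑ i, C.pt (P i)) = 2 ∧ C.BasePointFree (C.K - ∑ i, C.pt (P i))

theorem exists_genPos (hH : ¬ C.Hyperelliptic) (hT : ¬ C.Trigonal)
    {F₀ : Set C.Point} (hF₀ : F₀.Finite) {n : ℕ} (hn : n + 2 = C.genus) :
    ∃ P : Fin n → C.Point, Injective P ∧ (∀ i, P i ∉ F₀) ∧ GenPos P := by
  classical
  have hg := four_le_genus hH hT
  obtain ⟨T, h1, h2, h3, h4, h5⟩ :=
    exists_partial_general_position hH hT hF₀ (n - 1) (by omega)
  obtain ⟨P, hP, hP2⟩ : ∃ P ∈ {Q | C.BasePointFree (C.K - ∑ P ∈ T, C.pt P - C.pt Q)},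
      P ∉ F₀ ∪ T := by
    by_contra! hc
    exact h5 (Set.Countable.mono hc (hF₀.union T.finite_toSet).countable)
  simp only [Set.mem_union, Finset.mem_coe, not_or] at hP2
  have hcard : (insert P T).card = n := by
    rw [Finset.card_insert_of_notMem hP2.2, h1]; omega
  set e := (insert P T).equivFinOfCardEq hcard
  have hsum : ∑ i, C.pt (e.symm i : C.Point) = ∑ Q ∈ insert P T, C.pt Q := by
    rw [Equiv.sum_comp e.symm (fun Q : {x // x ∈ insert P T} => C.pt (Q : C.Point)),
      Finset.sum_coe_sort]
  have h6 : C.K - ∑ i, C.pt (e.symm i : C.Point) = C.K - ∑ P ∈ T, C.pt P - C.pt P := by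
    rw [hsum, Finset.sum_insert hP2.2]; abel
  refine ⟨fun i => e.symm i, Subtype.val_injective.comp e.symm.injective, fun i => ?_, ?_⟩
  · rcases Finset.mem_insert.1 (e.symm i).2 with h | h
    · exact fun h' => hP2.1 (by rwa [← h])
    · exact h2 _ h
  · rw [GenPos, h6]
    refine ⟨?_, hP⟩
    have := h3 P
    omega

end Curve

/-- A set of tuples all of whose one-variable slices are empty or cofinite. -/
def SliceOpen {ι T : Type*} [DecidableEq ι] (U : Set (ι → T)) : Prop :=
  ∀ (P : ι → T) (k : ι), (∃ Q, update P k Q ∈ U) → {Q | update P k Q ∉ U}.Finite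

namespace SliceOpen
variable {ι T : Type*} [DecidableEq ι]

theorem inter {U V : Set (ι → T)} (hU : SliceOpen U) (hV : SliceOpen V) : SliceOpen (U ∩ V) := by
  rintro P k ⟨Q, hQ⟩
  refine ((hU P k ⟨Q, hQ.1⟩).union (hV P k ⟨Q, hQ.2⟩)).subset fun R hR => ?_
  by_contra h
  simp only [Set.mem_union, Set.mem_ofPred_eq, not_or, not_not] at h
  exact hR h

theorem iInter {κ : Type*} [Finite κ] {U : κ → Set (ι → T)} (hU : ∀ a, SliceOpen (U a)) :
    SliceOpen (⋂ a, U a) := by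
  rintro P k ⟨Q, hQ⟩
  rw [Set.mem_iInter] at hQ
  refine (Set.finite_iUnion fun a => hU a P k ⟨Q, hQ a⟩).subset fun R hR => ?_
  simpa using hR

theorem inter_nonempty [Finite ι] [Infinite T] {U V : Set (ι → T)} (hU : SliceOpen U)
    (hV : SliceOpen V) (hU' : U.Nonempty) (hV' : V.Nonempty) : (U ∩ V).Nonempty := by
  classical
  have := Fintype.ofFinite ι
  obtain ⟨A, hA⟩ := hU'
  obtain ⟨B, hB⟩ := hV'
  obtain ⟨n, hn⟩ : ∃ n, (Finset.univ.filter fun k => A k ≠ B k).card = n := ⟨_, rfl⟩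
  induction n generalizing A B with
  | zero =>
    rw [Finset.card_eq_zero, Finset.filter_eq_empty_iff] at hn
    have : A = B := funext fun k => by simpa using hn (Finset.mem_univ k)
    exact ⟨A, hA, this ▸ hB⟩
  | succ n ih =>
    obtain ⟨k, hk⟩ := Finset.card_pos.1 (by omega : 0 < (Finset.univ.filter
      fun k => A k ≠ B k).card)
    have h1 := hU A k ⟨A k, by rwa [update_eq_self]⟩
    have h2 := hV B k ⟨B k, by rwa [update_eq_self]⟩
    obtain ⟨Q, hQ⟩ := (h1.union h2).infinite_compl.nonempty
    simp only [Set.mem_compl_iff, Set.mem_union, Set.mem_ofPred_eq, not_or, not_not] at hQ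
    refine ih (update A k Q) hQ.1 (update B k Q) hQ.2 ?_
    have h3 : (Finset.univ.filter fun j => update A k Q j ≠ update B k Q j) =
        (Finset.univ.filter fun j => A j ≠ B j).erase k := by
      ext j
      rcases eq_or_ne j k with rfl | hj <;> simp [*]
    rw [h3, Finset.card_erase_of_mem hk, hn]
    rfl

theorem iInter_nonempty [Finite ι] [Infinite T] {κ : Type*} [Finite κ] {U : κ → Set (ι → T)}
    (hU : ∀ a, SliceOpen (U a)) (hU' : ∀ a, (U a).Nonempty) : (⋂ a, U a).Nonempty := by
  classical
  have := Fintype.ofFinite κ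
  suffices h : ∀ s : Finset κ, (⋂ a : s, U a).Nonempty by
    obtain ⟨P, hP⟩ := h Finset.univ
    exact ⟨P, by simpa using hP⟩
  intro s
  induction s using Finset.induction_on with
  | empty =>
    obtain ⟨t⟩ : Nonempty T := inferInstance
    exact ⟨fun _ => t, by simp⟩
  | insert a s ha ih =>
    obtain ⟨P, hP⟩ := inter_nonempty (hU a) (iInter fun b : s => hU b) (hU' a) ih
    exact ⟨P, by simpa using hP⟩

end SliceOpen

section
variable {T : Type*} {k F : Type*} [Field k] [AddCommGroup F] [Module k F]

theorem det_mem_subalgebra {ι : Type*} [Fintype ι] [DecidableEq ι] (A : Subalgebra k (T → k))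
    (M : T → Matrix ι ι k) (hM : ∀ i j, (fun Q => M Q i j) ∈ A) : (fun Q => (M Q).det) ∈ A := by
  have : (fun Q => (M Q).det) = (Matrix.of fun i j => fun Q => M Q i j).det := by
    ext Q
    exact (Pi.evalRingHom (fun _ : T => k) Q).map_det (Matrix.of fun i j => fun Q => M Q i j) |>.symm
  rw [this, Matrix.det_apply]
  refine sum_mem fun σ _ => ?_
  rw [Units.smul_def]
  exact zsmul_mem (prod_mem fun i _ => hM _ _) _

theorem adjugate_mem_subalgebra {ι : Type*} [Fintype ι] [DecidableEq ι] (A : Subalgebra k (T → k))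
    (M : T → Matrix ι ι k) (hM : ∀ i j, (fun Q => M Q i j) ∈ A) (i j : ι) :
    (fun Q => (M Q).adjugate i j) ∈ A := by
  simp only [Matrix.adjugate_apply]
  refine det_mem_subalgebra A _ fun a b => ?_
  simp only [Matrix.updateRow_apply]
  split_ifs
  · exact A.algebraMap_mem ((Pi.single i 1 : ι → k) b)
  · exact hM a b

/-- Rank conditions are open. -/
theorem finite_rank_lt (A : Subalgebra k (T → k))
    (hA : ∀ f ∈ A, ∀ Q, f Q ≠ 0 → {Q | f Q = 0}.Finite) {α : Type*} [Finite α] (v : T → α → F)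
    (hv : ∀ a (φ : F →ₗ[k] k), (fun Q => φ (v Q a)) ∈ A) (m : ℕ)
    (hm : ∃ Q, m ≤ Module.finrank k (Submodule.span k (Set.range (v Q)))) :
    {Q | ¬ m ≤ Module.finrank k (Submodule.span k (Set.range (v Q)))}.Finite := by
  classical
  obtain ⟨Q₀, hQ₀⟩ := hm
  obtain ⟨b, hb1, hb2, hb3⟩ := exists_linearIndependent k (Set.range (v Q₀))
  have hbf : b.Finite := (Set.finite_range _).subset hb1
  have := hbf.fintype
  have : FiniteDimensional k (Submodule.span k (Set.range (v Q₀))) :=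
    FiniteDimensional.span_of_finite k (Set.finite_range _)
  have hbc : m ≤ Fintype.card b := by
    rw [← hb2, finrank_span_set_eq_card hb3, Set.toFinset_card] at hQ₀
    exact hQ₀
  choose c hc using fun x : b => hb1 x.2
  obtain ⟨φ, hφ⟩ := LinearMap.exists_leftInverse_of_injective
    (Finsupp.linearCombination k (Subtype.val : b → F)) (LinearMap.ker_eq_bot.2 hb3)
  have hφ' : ∀ x y : b, (Finsupp.lapply x ∘ₗ φ) (v Q₀ (c y)) = if x = y then 1 else 0 := by
    intro x y
    have := LinearMap.congr_fun hφ (Finsupp.single y 1)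
    simp only [LinearMap.comp_apply, Finsupp.linearCombination_single, one_smul,
      LinearMap.id_apply] at this
    rw [hc, LinearMap.comp_apply, this, Finsupp.lapply_apply, Finsupp.single_apply]
    simp [eq_comm]
  set M : T → Matrix b b k := fun Q => Matrix.of fun x y => (Finsupp.lapply x ∘ₗ φ) (v Q (c y))
    with hM
  have h1 : (M Q₀).det = 1 := by
    have : M Q₀ = 1 := by
      ext x y
      rw [Matrix.one_apply, ← hφ']
      rfl
    rw [this, Matrix.det_one]
  refine (hA _ (det_mem_subalgebra A M fun x y => hv (c y) (Finsupp.lapply x ∘ₗ φ)) Q₀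
    (by rw [h1]; exact one_ne_zero)).subset fun Q hQ => ?_
  by_contra hd
  apply hQ
  have h2 : LinearIndependent k fun y : b => v Q (c y) := by
    refine LinearIndependent.of_comp φ ?_
    refine LinearIndependent.of_comp (Finsupp.linearEquivFunOnFinite k k b).toLinearMap ?_
    have h3 := Matrix.linearIndependent_cols_iff_isUnit.2 ((Matrix.isUnit_iff_isUnit_det _).2
      (isUnit_iff_ne_zero.2 hd))
    exact h3
  refine hbc.trans ?_
  have : FiniteDimensional k (Submodule.span k (Set.range (v Q))) :=
    FiniteDimensional.span_of_finite k (Set.finite_range _)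
  rw [← finrank_span_eq_card h2]
  exact Submodule.finrank_mono (Submodule.span_mono (by
    rintro _ ⟨y, rfl⟩; exact ⟨c y, rfl⟩))

end

namespace Curve
open PreCurve
variable {C : Curve}

theorem ev_smul {P : C.Point} {f : C.F} (hf : f ∈ C.van P 0) (c : ℂ) :
    C.ev P (c • f) = c * C.ev P f := by
  rw [Algebra.smul_def, ev_mul (algebraMap_mem_van P c) hf, ev_algebraMap]

variable (C) in
/-- The points at which `s` is a local generator of the canonical bundle. -/
def Chart (s : C.F) : Type := {P : C.Point // C.ord P s = - C.K P}

theorem finite_not_chart {s : C.F} (hs : s ∈ C.H0 C.K) (hs0 : s ≠ 0) :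
    {P : C.Point | ¬ C.ord P s = - C.K P}.Finite := by
  refine (finite_section_zeros C.K hs0).subset fun P hP => ?_
  rw [Set.mem_ofPred_eq, mem_van_of_ne hs0]
  have := (mem_van_of_ne hs0).1 (mem_H0'.1 hs P)
  rw [Set.mem_ofPred_eq] at hP
  omega

theorem infinite_point : Infinite C.Point := by
  by_contra h
  rw [not_infinite_iff_finite] at h
  exact not_countable_point (C := C) (Set.toFinite _).countable

theorem infinite_chart {s : C.F} (hs : s ∈ C.H0 C.K) (hs0 : s ≠ 0) : Infinite (C.Chart s) := by
  have := infinite_point (C := C)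
  exact (finite_not_chart hs hs0).infinite_compl.to_subtype.of_injective
    (fun P => (⟨P.1, not_not.1 P.2⟩ : C.Chart s)) fun P Q h => Subtype.ext (by
      simpa using congrArg Subtype.val h)

section chart
variable {s : C.F}

theorem div_chart_mem_iff (hs0 : s ≠ 0) (P : C.Chart s) {f : C.F} (n : ℤ) :
    f / s ∈ C.van P.1 n ↔ f ∈ C.van P.1 (n - C.K P.1) := by
  rw [div_mem_van_iff hs0, P.2, sub_eq_add_neg]

theorem div_chart_mem (hs0 : s ≠ 0) (P : C.Chart s) {f : C.F} (hf : f ∈ C.H0 C.K) :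
    f / s ∈ C.van P.1 0 := by
  rw [div_chart_mem_iff hs0, zero_sub]
  exact mem_H0'.1 hf P.1

/-- The value of a section of the canonical bundle. -/
def evK (hs0 : s ≠ 0) (P : C.Chart s) : C.H0 C.K →ₗ[ℂ] ℂ where
  toFun f := C.ev P.1 (f / s)
  map_add' f g := by
    rw [Submodule.coe_add, add_div, ev_add (div_chart_mem hs0 P f.2) (div_chart_mem hs0 P g.2)]
  map_smul' c f := by
    rw [Submodule.coe_smul, smul_div_assoc, ev_smul (div_chart_mem hs0 P f.2)]
    rfl

theorem evK_eq_zero_iff (hs0 : s ≠ 0) (P : C.Chart s) (f : C.H0 C.K) :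
    evK hs0 P f = 0 ↔ (f : C.F) ∈ C.van P.1 (1 - C.K P.1) := by
  rw [← div_chart_mem_iff hs0, ← ev_eq_zero_iff (div_chart_mem hs0 P f.2)]
  rfl

variable (C s) in
/-- The functions on the chart induced by regular functions. -/
def chartFun : Subalgebra ℂ (C.Chart s → ℂ) where
  carrier := {u | ∃ f : C.F, (∀ P : C.Chart s, f ∈ C.van P.1 0) ∧ u = fun P => C.ev P.1 f}
  mul_mem' := by
    rintro _ _ ⟨f, hf, rfl⟩ ⟨g, hg, rfl⟩
    exact ⟨f * g, fun P => mul_mem_van_zero (hf P) (hg P),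
      funext fun P => (ev_mul (hf P) (hg P)).symm⟩
  add_mem' := by
    rintro _ _ ⟨f, hf, rfl⟩ ⟨g, hg, rfl⟩
    exact ⟨f + g, fun P => add_mem (hf P) (hg P),
      funext fun P => (ev_add (hf P) (hg P)).symm⟩
  algebraMap_mem' c := ⟨algebraMap ℂ C.F c, fun P => algebraMap_mem_van P.1 c,
    funext fun P => (ev_algebraMap P.1 c).symm⟩

theorem chartFun_zeros {u : C.Chart s → ℂ} (hu : u ∈ C.chartFun s) (Q : C.Chart s) (hQ : u Q ≠ 0) :
    {Q | u Q = 0}.Finite := by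
  obtain ⟨f, hf, rfl⟩ := hu
  have hf0 : f ≠ 0 := by
    rintro rfl
    exact hQ ((ev_eq_zero_iff (hf Q)).2 (zero_mem _))
  exact ((finite_zeros hf0).preimage Subtype.val_injective.injOn).subset fun P hP =>
    (ev_eq_zero_iff (hf P)).1 hP

theorem evK_mem_chartFun (hs0 : s ≠ 0) (f : C.H0 C.K) :
    (fun P => evK hs0 P f) ∈ C.chartFun s :=
  ⟨f / s, fun P => div_chart_mem hs0 P f.2, rfl⟩

variable {ι : Type} [Fintype ι] [DecidableEq ι] (b : Module.Basis ι ℂ (C.H0 C.K)) (hs0 : s ≠ 0)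

/-- The matrix of values of a basis of canonical sections. -/
def evMatrix (P : ι → C.Chart s) : Matrix ι ι ℂ := Matrix.of fun r j => evK hs0 (P r) (b j)

/-- The sections vanishing at all but one of the points of a tuple. -/
def dualSec (P : ι → C.Chart s) (r : ι) : C.H0 C.K := ∑ j, (evMatrix b hs0 P).adjugate j r • b j

theorem evK_dualSec (P : ι → C.Chart s) (t r : ι) :
    evK hs0 (P t) (dualSec b hs0 P r) = if t = r then (evMatrix b hs0 P).det else 0 := by
  have h := congrFun (congrFun (Matrix.mul_adjugate (evMatrix b hs0 P)) t) r
  rw [Matrix.mul_apply, Matrix.smul_apply, Matrix.one_apply, smul_eq_mul, mul_ite, mul_one,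
    mul_zero] at h
  rw [← h, dualSec, map_sum]
  refine Finset.sum_congr rfl fun j _ => ?_
  rw [map_smul, smul_eq_mul, mul_comm]
  rfl

theorem mulVec_repr (P : ι → C.Chart s) (f : C.H0 C.K) :
    (evMatrix b hs0 P).mulVec (b.repr f) = fun t => evK hs0 (P t) f := by
  ext t
  conv_rhs => rw [← b.sum_repr f, map_sum]
  rw [Matrix.mulVec_eq_sum, Finset.sum_apply]
  refine Finset.sum_congr rfl fun j _ => ?_
  rw [map_smul]
  exact mul_comm _ _

variable {b hs0}

theorem eq_zero_of_evK {P : ι → C.Chart s} (hP : (evMatrix b hs0 P).det ≠ 0) {f : C.H0 C.K}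
    (hf : ∀ t, evK hs0 (P t) f = 0) : f = 0 := by
  have h1 := Matrix.eq_zero_of_mulVec_eq_zero hP (v := b.repr f)
    (by rw [mulVec_repr]; exact funext hf)
  rw [← b.sum_repr f]
  exact Finset.sum_eq_zero fun j _ => by rw [h1, Pi.zero_apply, zero_smul]

theorem det_evMatrix_ne_zero {P : ι → C.Chart s}
    (h : ∀ f : C.H0 C.K, (∀ t, evK hs0 (P t) f = 0) → f = 0) : (evMatrix b hs0 P).det ≠ 0 := by
  intro hd
  obtain ⟨v, hv, hv'⟩ := Matrix.exists_mulVec_eq_zero_iff.2 hd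
  set f := b.equivFun.symm v with hf
  have hr : ⇑(b.repr f) = v := b.equivFun.apply_symm_apply v
  have h1 := h f fun t => by
    have h2 := mulVec_repr b hs0 P f
    rw [hr, hv'] at h2
    exact (congrFun h2 t).symm
  rw [h1] at hf
  exact hv (by rw [← hr, h1, map_zero]; rfl)

theorem eq_sum_dualSec {P : ι → C.Chart s} (hP : (evMatrix b hs0 P).det ≠ 0) (f : C.H0 C.K) :
    f = ∑ r, (evK hs0 (P r) f / (evMatrix b hs0 P).det) • dualSec b hs0 P r := by
  rw [← sub_eq_zero]
  refine eq_zero_of_evK hP fun t => ?_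
  rw [map_sub, map_sum]
  simp only [map_smul, evK_dualSec, smul_eq_mul, mul_ite, mul_zero]
  rw [Finset.sum_ite_eq, if_pos (Finset.mem_univ _), div_mul_cancel₀ _ hP, sub_self]

theorem injective_of_det {P : ι → C.Chart s} (hP : (evMatrix b hs0 P).det ≠ 0) : Injective P := by
  intro i j hij
  by_contra hne
  refine hP (Matrix.det_zero_of_row_eq hne ?_)
  ext k
  change evK hs0 (P i) (b k) = evK hs0 (P j) (b k)
  rw [hij]

variable (b hs0)

theorem evMatrix_slice (P : ι → C.Chart s) (k r j : ι) :
    (fun Q => evMatrix b hs0 (update P k Q) r j) ∈ C.chartFun s := by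
  rcases eq_or_ne r k with rfl | h
  · simp only [evMatrix, Matrix.of_apply, update_self]
    exact evK_mem_chartFun hs0 _
  · simp only [evMatrix, Matrix.of_apply, update_of_ne h]
    exact (C.chartFun s).algebraMap_mem (evK hs0 (P r) (b j))

theorem sliceOpen_det : SliceOpen {P : ι → C.Chart s | (evMatrix b hs0 P).det ≠ 0} := by
  rintro P k ⟨Q, hQ⟩
  refine (chartFun_zeros (det_mem_subalgebra (C.chartFun s)
    (fun Q => evMatrix b hs0 (update P k Q)) fun i j => evMatrix_slice b hs0 P k i j) Q hQ).subset
    fun R hR => ?_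
  simpa using hR

theorem sliceOpen_rank {α : Type} [Finite α] (p q : α → ι) (m : ℕ) :
    SliceOpen {P : ι → C.Chart s | m ≤ Module.finrank ℂ (Submodule.span ℂ (Set.range fun a =>
      (dualSec b hs0 P (p a) : C.F) * dualSec b hs0 P (q a)))} := by
  rintro P k ⟨Q, hQ⟩
  refine finite_rank_lt (C.chartFun s) (fun f hf => chartFun_zeros hf)
    (fun Q a => (dualSec b hs0 (update P k Q) (p a) : C.F) * dualSec b hs0 (update P k Q) (q a))
    (fun a φ => ?_) m ⟨Q, hQ⟩
  have hadj := adjugate_mem_subalgebra (C.chartFun s)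
    (fun Q => evMatrix b hs0 (update P k Q)) fun i j => evMatrix_slice b hs0 P k i j
  have : (fun Q => φ ((dualSec b hs0 (update P k Q) (p a) : C.F) *
      dualSec b hs0 (update P k Q) (q a))) = ∑ i, ∑ j, (φ ((b i : C.F) * b j)) •
        ((fun Q => (evMatrix b hs0 (update P k Q)).adjugate i (p a)) *
          fun Q => (evMatrix b hs0 (update P k Q)).adjugate j (q a)) := by
    ext Q
    simp only [dualSec, Submodule.coe_sum, Submodule.coe_smul, Finset.sum_mul_sum, map_sum,
      smul_mul_smul_comm, map_smul, Finset.sum_apply, Pi.smul_apply, Pi.mul_apply, smul_eq_mul]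
    refine Finset.sum_congr rfl fun i _ => Finset.sum_congr rfl fun j _ => mul_comm _ _
  rw [this]
  exact sum_mem fun i _ => sum_mem fun j _ => Subalgebra.smul_mem _ (mul_mem (hadj _ _) (hadj _ _)) _

end chart
end Curve

theorem Submodule.span_pair_mul {k A : Type*} [CommRing k] [CommRing A] [Algebra k A] (x y : A)
    (N : Submodule k A) : Submodule.span k {x, y} * N =
      N.map (LinearMap.mulLeft k x) ⊔ N.map (LinearMap.mulLeft k y) := by
  have h : ∀ z : A, Submodule.span k {z} * N = N.map (LinearMap.mulLeft k z) := by
    intro z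
    ext w
    rw [Submodule.mem_span_singleton_mul]
    rfl
  rw [Submodule.span_insert, Submodule.sup_mul, h, h]

theorem Submodule.mem_span_pair_mul {k A : Type*} [CommRing k] [CommRing A] [Algebra k A] {x y : A}
    {N : Submodule k A} {f : A} : f ∈ Submodule.span k {x, y} * N ↔
      ∃ u ∈ N, ∃ v ∈ N, x * u + y * v = f := by
  rw [Submodule.span_pair_mul, Submodule.mem_sup]
  constructor
  · rintro ⟨_, ⟨u, hu, rfl⟩, _, ⟨v, hv, rfl⟩, rfl⟩
    exact ⟨u, hu, v, hv, rfl⟩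
  · rintro ⟨u, hu, v, hv, rfl⟩
    exact ⟨_, ⟨u, hu, rfl⟩, _, ⟨v, hv, rfl⟩, rfl⟩

namespace Curve
open PreCurve
variable {C : Curve}

theorem two_le_h0 {x y : C.F} (h : LinearIndependent ℂ ![x, y]) {D : C.Div} (hx : x ∈ C.H0 D)
    (hy : y ∈ C.H0 D) : 2 ≤ C.h0 D := by
  have h1 := finrank_span_eq_card h
  rw [Fintype.card_fin] at h1
  refine h1.symm.le.trans ?_
  refine Submodule.finrank_mono (Submodule.span_le.2 ?_)
  rintro _ ⟨i, rfl⟩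
  fin_cases i
  · exact hx
  · exact hy

theorem H0_eq_span_pair {x y : C.F} (h : LinearIndependent ℂ ![x, y]) {D : C.Div} (hx : x ∈ C.H0 D)
    (hy : y ∈ C.H0 D) (hD : C.h0 D = 2) : C.H0 D = Submodule.span ℂ {x, y} := by
  have h1 := finrank_span_eq_card h
  rw [Fintype.card_fin, Matrix.range_cons_cons_empty] at h1
  refine (Submodule.eq_of_le_of_finrank_eq ?_ ?_).symm
  · rw [Submodule.span_le]
    rintro _ (rfl | rfl)
    · exact hx
    · exact hy
  · rw [h1]; exact hD.symm

theorem exists_pair {D : C.Div} (h : C.h0 D = 2) : ∃ x y : C.F, x ∈ C.H0 D ∧ y ∈ C.H0 D ∧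
    LinearIndependent ℂ ![x, y] := by
  have b := Module.finBasisOfFinrankEq ℂ (C.H0 D) h
  refine ⟨b 0, b 1, (b 0).2, (b 1).2, ?_⟩
  have h1 := b.linearIndependent.map' (C.H0 D).subtype (Submodule.ker_subtype _)
  have h2 : ![((b 0 : C.H0 D) : C.F), b 1] = (C.H0 D).subtype ∘ b := by
    ext i
    fin_cases i <;> rfl
  rw [h2]
  exact h1

theorem le_gcdDiv {x y : C.F} (hx0 : x ≠ 0) (hy0 : y ≠ 0) {D : C.Div} (hx : x ∈ C.H0 D)
    (hy : y ∈ C.H0 D) : - D ≤ gcdDiv x y := by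
  rw [mem_H0_of_ne hx0] at hx
  rw [mem_H0_of_ne hy0] at hy
  rw [gcdDiv, le_inf_iff, neg_le_iff_add_nonneg, neg_le_iff_add_nonneg]
  exact ⟨hx, hy⟩

theorem mem_H0_of_le_gcdDiv {x y : C.F} (hx0 : x ≠ 0) (hy0 : y ≠ 0) {D : C.Div}
    (h : - D ≤ gcdDiv x y) : x ∈ C.H0 D ∧ y ∈ C.H0 D := by
  rwa [gcdDiv, le_inf_iff, neg_le_iff_add_nonneg, neg_le_iff_add_nonneg, ← mem_H0_of_ne hx0,
    ← mem_H0_of_ne hy0] at h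

/-- A basis of a base point free pencil has no common zeros. -/
theorem gcdDiv_of_bpf {x y : C.F} (h : LinearIndependent ℂ ![x, y]) {D : C.Div} (hx : x ∈ C.H0 D)
    (hy : y ∈ C.H0 D) (hD : C.h0 D = 2) (hb : C.BasePointFree D) : gcdDiv x y = - D := by
  have hx0 : x ≠ 0 := h.ne_zero 0
  have hy0 : y ≠ 0 := h.ne_zero 1
  by_contra hne
  obtain ⟨P, hP⟩ := exists_pt_le (sub_nonneg.2 (le_gcdDiv hx0 hy0 hx hy)) (sub_ne_zero.2 hne)
  have h1 := mem_H0_of_le_gcdDiv hx0 hy0 (D := D - C.pt P) (by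
    rw [neg_sub, sub_eq_add_neg]; exact le_sub_iff_add_le.1 hP)
  have h2 := two_le_h0 h h1.1 h1.2
  have h3 := hb P
  omega

theorem mem_H0_sub_sum {κ : Type*} {P : κ → C.Point} (hP : Injective P) (B : Finset κ)
    (D : C.Div) (f : C.F) : f ∈ C.H0 (D - ∑ r ∈ B, C.pt (P r)) ↔
      f ∈ C.H0 D ∧ ∀ r ∈ B, f ∈ C.van (P r) (1 - D (P r)) := by
  classical
  induction B using Finset.induction_on with
  | empty => simp
  | insert a B ha ih =>
    have h1 : (∑ r ∈ B, C.pt (P r)) (P a) = 0 := by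
      rw [Finsupp.finsetSum_apply]
      exact Finset.sum_eq_zero fun r hr => pt_ne fun h => ha (hP h ▸ hr)
    rw [Finset.sum_insert ha, add_comm, ← sub_sub, mem_H0_sub_pt, ih, Finsupp.sub_apply, h1,
      sub_zero, and_assoc]
    refine and_congr_right fun _ => ?_
    rw [Finset.forall_mem_insert, and_comm]

section bad
variable {ι : Type} [Fintype ι]

theorem pt_add_pt_le_sum (P : ι → C.Point) {i k : ι} (h : i ≠ k) :
    C.pt (P i) + C.pt (P k) ≤ ∑ r, C.pt (P r) :=
  Finset.add_le_sum (fun r _ => pt_nonneg (P r)) (Finset.mem_univ i) (Finset.mem_univ k) h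

theorem pt_le_sum (P : ι → C.Point) (i : ι) : C.pt (P i) ≤ ∑ r, C.pt (P r) :=
  Finset.single_le_sum (fun r _ => pt_nonneg (P r)) (Finset.mem_univ i)

theorem sum_pt_nonneg (P : ι → C.Point) : 0 ≤ ∑ r, C.pt (P r) :=
  Finset.sum_nonneg fun r _ => pt_nonneg (P r)

/-- The products of sections through all points but `P i` and all points but `P j` lie in the
ideal generated by the pencil and vanish at `P k`. -/
def Bad (P : ι → C.Point) (i j k : ι) : Prop :=
  C.H0 (C.K - ∑ r, C.pt (P r) + C.pt (P i)) * C.H0 (C.K - ∑ r, C.pt (P r) + C.pt (P j)) ≤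
    C.H0 (C.K - ∑ r, C.pt (P r)) * C.H0 (C.K - C.pt (P k))

theorem H0_add_pt_eq {D : C.Div} {P : C.Point} {u : C.F} (hu : u ∈ C.H0 (D + C.pt P))
    (hu' : u ∉ C.H0 D) : C.H0 (D + C.pt P) = C.H0 D ⊔ Submodule.span ℂ {u} := by
  have h0 : D + C.pt P - C.pt P = D := add_sub_cancel_right _ _
  refine le_antisymm (fun f hf => ?_) (sup_le (H0_le (le_add_of_nonneg_right (pt_nonneg P)))
    (by rwa [Submodule.span_le, Set.singleton_subset_iff]))
  obtain ⟨c, hc⟩ := exists_sub_smul_mem (P := P) hu (by rwa [h0]) hf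
  rw [h0] at hc
  exact Submodule.mem_sup.2 ⟨_, hc, _, Submodule.mem_span_singleton.2 ⟨c, rfl⟩, by abel⟩

theorem bad_iff {P : ι → C.Point} {i j k : ι} (hik : i ≠ k) (hjk : j ≠ k) {u v : C.F}
    (hu : u ∈ C.H0 (C.K - ∑ r, C.pt (P r) + C.pt (P i))) (hu' : u ∉ C.H0 (C.K - ∑ r, C.pt (P r)))
    (hv : v ∈ C.H0 (C.K - ∑ r, C.pt (P r) + C.pt (P j))) (hv' : v ∉ C.H0 (C.K - ∑ r, C.pt (P r))) :
    Bad P i j k ↔ u * v ∈ C.H0 (C.K - ∑ r, C.pt (P r)) * C.H0 (C.K - C.pt (P k)) := by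
  refine ⟨fun h => h (Submodule.mul_mem_mul hu hv), fun h => ?_⟩
  have h1 : ∀ l, l ≠ k → C.H0 (C.K - ∑ r, C.pt (P r) + C.pt (P l)) ≤ C.H0 (C.K - C.pt (P k)) := by
    intro l hl
    refine H0_le ?_
    have := pt_add_pt_le_sum P hl
    rw [← sub_nonneg] at this ⊢
    convert this using 1
    abel
  have h2 := h1 i hik
  rw [H0_add_pt_eq hu hu'] at h2
  unfold Bad
  rw [H0_add_pt_eq hu hu', Submodule.sup_mul]
  refine sup_le (mul_le_mul' le_rfl (h1 j hjk)) ?_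
  rw [H0_add_pt_eq hv hv', Submodule.mul_sup]
  refine sup_le ?_ ?_
  · rw [mul_comm]
    exact mul_le_mul' le_rfl (le_sup_right.trans h2)
  · rw [Submodule.span_mul_span, Set.singleton_mul_singleton, Submodule.span_le,
      Set.singleton_subset_iff]
    exact h

theorem GenPos.h0_sum {P : ι → C.Point} (hn : Fintype.card ι + 2 = C.genus) (hP : GenPos P) :
    C.h0 (∑ r, C.pt (P r)) = 1 := by
  have h := C.riemann_roch (∑ r, C.pt (P r))
  rw [hP.1, deg_sum] at h
  simp only [deg_pt, Finset.sum_const, Finset.card_univ, nsmul_eq_mul, mul_one] at h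
  omega

theorem GenPos.h0_of_le {P : ι → C.Point} (hn : Fintype.card ι + 2 = C.genus) (hP : GenPos P)
    {D : C.Div} (hD : 0 ≤ D) (hD' : D ≤ ∑ r, C.pt (P r)) : C.h0 D = 1 := by
  have h1 := h0_mono hD'
  have h2 := h0_mono hD
  have := C.h0_triv
  rw [hP.h0_sum hn] at h1
  omega

theorem GenPos.of_gcdDiv {P : ι → C.Point} (hn : Fintype.card ι + 2 = C.genus) {x y : C.F}
    (h : LinearIndependent ℂ ![x, y]) (hx : x ∈ C.H0 (C.K - ∑ r, C.pt (P r)))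
    (hy : y ∈ C.H0 (C.K - ∑ r, C.pt (P r))) (h1 : C.h0 (C.K + gcdDiv x y) ≤ 1) : GenPos P := by
  have hx0 : x ≠ 0 := h.ne_zero 0
  have hy0 : y ≠ 0 := h.ne_zero 1
  set D := ∑ r, C.pt (P r) with hD
  have hDd : C.deg D = Fintype.card ι := by
    rw [hD, deg_sum]
    simp only [deg_pt, Finset.sum_const, Finset.card_univ, nsmul_eq_mul, mul_one]
  set Z := C.K + gcdDiv x y with hZ
  have hDZ : D ≤ Z := by
    have h2 := le_gcdDiv hx0 hy0 hx hy
    rw [neg_sub, sub_le_iff_le_add, add_comm] at h2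
    exact h2
  have h2 := two_le_h0 h (mem_H0_of_le_gcdDiv hx0 hy0 (D := C.K - Z) (by rw [hZ]; simp)).1
    (mem_H0_of_le_gcdDiv hx0 hy0 (D := C.K - Z) (by rw [hZ]; simp)).2
  have h3 := C.riemann_roch Z
  have h4 : Z = D := by
    have h5 := eq_zero_of_deg (sub_nonneg.2 hDZ) (by
      have := deg_nonneg (sub_nonneg.2 hDZ)
      rw [deg_sub] at this ⊢
      omega)
    exact sub_eq_zero.1 h5
  have h0D : 1 ≤ C.h0 D := by
    have := h0_mono (sum_pt_nonneg P)
    rwa [C.h0_triv] at this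
  rw [h4] at h3 h1 h2
  have h6 : C.h0 (C.K - D) = 2 := by omega
  refine ⟨h6, fun R => ?_⟩
  refine (sub_pt_eq_or _ R).resolve_left fun h7 => ?_
  have h8 := H0_sub_pt_eq_of_h0 h7
  have h9 := le_gcdDiv hx0 hy0 (h8 ▸ hx) (h8 ▸ hy)
  have h10 : D + C.pt R ≤ D := by
    conv_rhs => rw [← h4, hZ]
    rw [← sub_nonneg] at h9 ⊢
    convert h9 using 1
    abel
  have := deg_mono h10
  rw [deg_add, deg_pt] at this
  omega

end bad
end Curve

theorem Submodule.span_range_mul {k A ι κ : Type*} [CommRing k] [CommRing A] [Algebra k A]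
    (u : ι → A) (v : κ → A) : Submodule.span k (Set.range fun a : ι × κ => u a.1 * v a.2) =
      Submodule.span k (Set.range u) * Submodule.span k (Set.range v) := by
  rw [Submodule.span_mul_span]
  congr 1
  ext w
  simp [Set.mem_mul]

namespace Curve
open PreCurve
variable {C : Curve} {s : C.F} {n : ℕ} {b : Module.Basis (Fin n ⊕ Fin 2) ℂ (C.H0 C.K)}
  {hs0 : s ≠ 0} {P : Fin n ⊕ Fin 2 → C.Chart s}

/-- The points of a tuple of points of the chart indexed by the first summand. -/
def basePts (P : Fin n ⊕ Fin 2 → C.Chart s) (i : Fin n) : C.Point := (P (Sum.inl i)).1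

theorem linearIndependent_dualSec (hP : (evMatrix b hs0 P).det ≠ 0) :
    LinearIndependent ℂ ![(dualSec b hs0 P (Sum.inr 0) : C.F), dualSec b hs0 P (Sum.inr 1)] := by
  rw [LinearIndependent.pair_iff]
  intro c d h
  have h1 : c • dualSec b hs0 P (Sum.inr 0) + d • dualSec b hs0 P (Sum.inr 1) = 0 :=
    Subtype.ext (by simpa using h)
  have h2 := congrArg (evK hs0 (P (Sum.inr 0))) h1
  have h3 := congrArg (evK hs0 (P (Sum.inr 1))) h1
  simp only [map_add, map_smul, evK_dualSec, smul_eq_mul, map_zero] at h2 h3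
  simp at h2 h3
  exact ⟨h2.resolve_right hP, h3.resolve_right hP⟩

theorem basePts_injective (hP : (evMatrix b hs0 P).det ≠ 0) : Injective (basePts P) :=
  Subtype.val_injective.comp ((injective_of_det hP).comp Sum.inl_injective)

theorem dualSec_mem_sub_sum (hP : (evMatrix b hs0 P).det ≠ 0) (B : Finset (Fin n))
    (r : Fin n ⊕ Fin 2) : (dualSec b hs0 P r : C.F) ∈ C.H0 (C.K - ∑ i ∈ B, C.pt (basePts P i)) ↔
      ∀ i ∈ B, Sum.inl i ≠ r := by
  rw [mem_H0_sub_sum (basePts_injective hP), and_iff_right (dualSec b hs0 P r).2]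
  refine forall₂_congr fun i _ => ?_
  rw [basePts, ← evK_eq_zero_iff hs0, evK_dualSec]
  simp [hP]

theorem H0_eq_span_dualSec (hP : (evMatrix b hs0 P).det ≠ 0) (A : Set (Fin n ⊕ Fin 2))
    {N : Submodule ℂ C.F} (hN : N ≤ C.H0 C.K)
    (h : ∀ f : C.H0 C.K, (f : C.F) ∈ N ↔ ∀ r ∉ A, evK hs0 (P r) f = 0) :
    N = Submodule.span ℂ (Set.range fun r : A => (dualSec b hs0 P r : C.F)) := by
  classical
  refine le_antisymm (fun f hf => ?_) (Submodule.span_le.2 ?_)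
  · have h1 := eq_sum_dualSec hP ⟨f, hN hf⟩
    have h2 := congrArg Subtype.val h1
    simp only [Submodule.coe_sum, Submodule.coe_smul] at h2
    rw [h2]
    refine sum_mem fun r _ => ?_
    by_cases hr : r ∈ A
    · exact Submodule.smul_mem _ _ (Submodule.subset_span ⟨⟨r, hr⟩, rfl⟩)
    · rw [(h ⟨f, hN hf⟩).1 hf r hr, zero_div, zero_smul]
      exact zero_mem _
  · rintro _ ⟨⟨r, hr⟩, rfl⟩
    refine (h _).2 fun t ht => ?_
    rw [evK_dualSec, if_neg]
    rintro rfl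
    exact ht hr

theorem range_inr_dualSec : (Set.range fun a : Fin 2 => (dualSec b hs0 P (Sum.inr a) : C.F)) =
    {(dualSec b hs0 P (Sum.inr 0) : C.F), (dualSec b hs0 P (Sum.inr 1) : C.F)} := by
  ext w
  simp [Fin.exists_fin_two, eq_comm]

theorem finrank_dualSec (hP : (evMatrix b hs0 P).det ≠ 0) (A : Set (Fin n ⊕ Fin 2))
    {E : C.Div} (hE : C.H0 E ≤ C.H0 C.K)
    (h : ∀ f : C.H0 C.K, (f : C.F) ∈ C.H0 E ↔ ∀ r ∉ A, evK hs0 (P r) f = 0) :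
    Module.finrank ℂ (Submodule.span ℂ (Set.range fun a : Fin 2 × A =>
      (dualSec b hs0 P (Sum.inr a.1) : C.F) * dualSec b hs0 P a.2)) +
      C.h0 (E + gcdDiv (dualSec b hs0 P (Sum.inr 0) : C.F) (dualSec b hs0 P (Sum.inr 1))) =
      2 * C.h0 E := by
  have hLI := linearIndependent_dualSec hP
  rw [Submodule.span_range_mul (fun a : Fin 2 => (dualSec b hs0 P (Sum.inr a) : C.F))
    (fun r : A => (dualSec b hs0 P r : C.F)), ← H0_eq_span_dualSec hP A hE h, range_inr_dualSec,
    Submodule.span_pair_mul]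
  exact finrank_pencil (hLI.ne_zero 0) (hLI.ne_zero 1) E

theorem inr_mem (hP : (evMatrix b hs0 P).det ≠ 0) (a : Fin 2) :
    (dualSec b hs0 P (Sum.inr a) : C.F) ∈ C.H0 (C.K - ∑ i, C.pt (basePts P i)) := by
  rw [dualSec_mem_sub_sum hP]
  simp

theorem gcdDiv_dualSec (hP : (evMatrix b hs0 P).det ≠ 0) (hG : GenPos (basePts P)) :
    gcdDiv (dualSec b hs0 P (Sum.inr 0) : C.F) (dualSec b hs0 P (Sum.inr 1)) =
      - (C.K - ∑ i, C.pt (basePts P i)) :=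
  gcdDiv_of_bpf (linearIndependent_dualSec hP) (inr_mem hP 0) (inr_mem hP 1) hG.1 hG.2

theorem genPos_iff_rank (hn : n + 2 = C.genus) (hP : (evMatrix b hs0 P).det ≠ 0) :
    GenPos (basePts P) ↔ 2 * C.genus - 1 ≤ Module.finrank ℂ (Submodule.span ℂ
      (Set.range fun a : Fin 2 × (Set.univ : Set (Fin n ⊕ Fin 2)) =>
        (dualSec b hs0 P (Sum.inr a.1) : C.F) * dualSec b hs0 P a.2)) := by
  have h1 := finrank_dualSec hP Set.univ le_rfl fun f => by simp
  have hg : Fintype.card (Fin n) + 2 = C.genus := by simpa using hn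
  rw [h0_K] at h1
  constructor
  · intro hG
    rw [gcdDiv_dualSec hP hG, neg_sub, add_sub_cancel, hG.h0_sum hg] at h1
    omega
  · intro h
    exact GenPos.of_gcdDiv hg (linearIndependent_dualSec hP) (inr_mem hP 0) (inr_mem hP 1)
      (by omega)

theorem not_bad_iff_rank (hn : n + 2 = C.genus) (hP : (evMatrix b hs0 P).det ≠ 0)
    (hG : GenPos (basePts P)) {i j k : Fin n} (hik : i ≠ k) (hjk : j ≠ k) :
    ¬ Bad (basePts P) i j k ↔ 2 * C.genus - 2 ≤ Module.finrank ℂ (Submodule.span ℂ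
      (Set.range fun a : Option (Fin 2 × {r : Fin n ⊕ Fin 2 | r ≠ Sum.inl k}) =>
        (dualSec b hs0 P (a.elim (Sum.inl i) fun a => Sum.inr a.1) : C.F) *
          dualSec b hs0 P (a.elim (Sum.inl j) fun a => a.2))) := by
  have hg : Fintype.card (Fin n) + 2 = C.genus := by simpa using hn
  have hiff : ∀ f : C.H0 C.K, (f : C.F) ∈ C.H0 (C.K - C.pt (basePts P k)) ↔
      ∀ r ∉ {r : Fin n ⊕ Fin 2 | r ≠ Sum.inl k}, evK hs0 (P r) f = 0 := by
    intro f
    rw [mem_H0_sub_pt, and_iff_right f.2, basePts, ← evK_eq_zero_iff hs0]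
    simp
  have h1 := finrank_dualSec hP _ (H0_sub_pt_le C.K (basePts P k)) hiff
  set W := Submodule.span ℂ (Set.range fun a : Fin 2 × {r : Fin n ⊕ Fin 2 | r ≠ Sum.inl k} =>
    (dualSec b hs0 P (Sum.inr a.1) : C.F) * dualSec b hs0 P a.2) with hW
  have hWfin : FiniteDimensional ℂ W := FiniteDimensional.span_of_finite ℂ (Set.finite_range _)
  have hW2 : W = C.H0 (C.K - ∑ i, C.pt (basePts P i)) * C.H0 (C.K - C.pt (basePts P k)) := by
    rw [hW, Submodule.span_range_mul (fun a : Fin 2 => (dualSec b hs0 P (Sum.inr a) : C.F))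
      (fun r : {r : Fin n ⊕ Fin 2 | r ≠ Sum.inl k} => (dualSec b hs0 P r : C.F)),
      ← H0_eq_span_dualSec hP _ (H0_sub_pt_le C.K (basePts P k)) hiff, range_inr_dualSec,
      ← H0_eq_span_pair (linearIndependent_dualSec hP) (inr_mem hP 0) (inr_mem hP 1) hG.1]
  have h2 : C.K - C.pt (basePts P k) + -(C.K - ∑ i, C.pt (basePts P i)) =
      ∑ i, C.pt (basePts P i) - C.pt (basePts P k) := by abel
  rw [gcdDiv_dualSec hP hG, h2, hG.h0_of_le hg (sub_nonneg.2 (pt_le_sum _ _))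
    (sub_le_self _ (pt_nonneg _))] at h1
  have h3 : C.h0 (C.K - C.pt (basePts P k)) + 1 = C.genus := by
    have h4 := C.riemann_roch (C.pt (basePts P k))
    rw [hG.h0_of_le hg (pt_nonneg _) (pt_le_sum _ _), deg_pt] at h4
    omega
  have hmem : ∀ l, (dualSec b hs0 P (Sum.inl l) : C.F) ∈
      C.H0 (C.K - ∑ r, C.pt (basePts P r) + C.pt (basePts P l)) := by
    intro l
    rw [← Finset.sum_erase_add _ _ (Finset.mem_univ l), ← sub_sub, sub_add_cancel,
      dualSec_mem_sub_sum hP]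
    intro i hi h
    exact Finset.ne_of_mem_erase hi (Sum.inl_injective h)
  have hnmem : ∀ l, (dualSec b hs0 P (Sum.inl l) : C.F) ∉
      C.H0 (C.K - ∑ r, C.pt (basePts P r)) := by
    intro l h
    exact (dualSec_mem_sub_sum hP _ _).1 h l (Finset.mem_univ l) rfl
  rw [bad_iff hik hjk (hmem i) (hnmem i) (hmem j) (hnmem j), ← hW2]
  set v := (dualSec b hs0 P (Sum.inl i) : C.F) * dualSec b hs0 P (Sum.inl j) with hv
  have h5 : Submodule.span ℂ
      (Set.range fun a : Option (Fin 2 × {r : Fin n ⊕ Fin 2 | r ≠ Sum.inl k}) =>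
        (dualSec b hs0 P (a.elim (Sum.inl i) fun a => Sum.inr a.1) : C.F) *
          dualSec b hs0 P (a.elim (Sum.inl j) fun a => a.2)) = W ⊔ Submodule.span ℂ {v} := by
    rw [hW, ← Submodule.span_union]
    congr 1
    ext w
    rw [Set.mem_range, Option.exists]
    simp only [Option.elim, Set.mem_union, Set.mem_singleton_iff, Set.mem_range]
    rw [or_comm, eq_comm (a := w)]
  rw [h5]
  constructor
  · intro hvW
    have h6 : W < W ⊔ Submodule.span ℂ {v} := by
      refine lt_of_le_of_ne le_sup_left fun h => hvW ?_
      rw [h]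
      exact Submodule.mem_sup_right (Submodule.mem_span_singleton_self v)
    have := Submodule.finrank_lt_finrank_of_lt h6
    omega
  · intro h hvW
    rw [sup_eq_left.2 (Submodule.span_le.2 (Set.singleton_subset_iff.2 hvW))] at h
    omega

theorem exists_extension (hs : s ∈ C.H0 C.K) (b : Module.Basis (Fin n ⊕ Fin 2) ℂ (C.H0 C.K))
    (hs0 : s ≠ 0) {p : Fin n → C.Chart s} (hp : Injective p)
    (hG : GenPos fun i => (p i).1) : ∃ P : Fin n ⊕ Fin 2 → C.Chart s,
      basePts P = (fun i => (p i).1) ∧ (evMatrix b hs0 P).det ≠ 0 := by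
  have := infinite_chart hs hs0
  obtain ⟨q₁, hq₁⟩ := (Set.finite_range p).infinite_compl.nonempty
  set E := C.K - ∑ i, C.pt (p i).1 - C.pt q₁.1 with hE
  have hE1 : C.h0 E = 1 := by
    have h1 : C.h0 E + 1 = C.h0 (C.K - ∑ i, C.pt (p i).1) := hG.2 q₁.1
    have h2 : C.h0 (C.K - ∑ i, C.pt (p i).1) = 2 := hG.1
    omega
  obtain ⟨t, ht, ht0⟩ := exists_mem_ne_zero hE1.ge
  obtain ⟨q₂, hq₂⟩ := (((Set.finite_range p).union (Set.finite_singleton q₁)).union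
    ((finite_section_zeros E ht0).preimage
      (Subtype.val_injective (p := fun P => C.ord P s = - C.K P)).injOn)).infinite_compl.nonempty
  simp only [Set.mem_compl_iff, Set.mem_union, not_or, Set.mem_singleton_iff, Set.mem_preimage,
    Set.mem_ofPred_eq, Set.mem_range] at hq₁ hq₂
  refine ⟨Sum.elim p ![q₁, q₂], rfl, det_evMatrix_ne_zero fun f hf => ?_⟩
  have hinj : Injective fun r => (Sum.elim p ![q₁, q₂] r).1 := by
    refine Subtype.val_injective.comp (hp.sumElim ?_ ?_)
    · intro a b h
      fin_cases a <;> fin_cases b <;> simp_all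
    · intro a b h
      fin_cases b
      · exact hq₁ ⟨a, h⟩
      · exact hq₂.1.1 ⟨a, h⟩
  have h2 : (f : C.F) ∈ C.H0 (E - C.pt q₂.1) := by
    have h3 := (mem_H0_sub_sum hinj Finset.univ C.K f).2
      ⟨f.2, fun r _ => (evK_eq_zero_iff hs0 _ f).1 (hf r)⟩
    rw [Fintype.sum_sum_type, Fin.sum_univ_two] at h3
    have h5 : E - C.pt q₂.1 = C.K - (∑ i, C.pt (p i).1 + (C.pt q₁.1 + C.pt q₂.1)) := by
      rw [hE]; abel
    rw [h5]
    exact h3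
  rcases sub_pt_eq_or E q₂.1 with h3 | h3
  · rw [← H0_sub_pt_eq_of_h0 h3, mem_H0_sub_pt] at ht
    exact absurd ht.2 hq₂.2
  · have h4 : C.h0 (E - C.pt q₂.1) = 0 := by omega
    rw [h0, Submodule.finrank_eq_zero] at h4
    rw [h4] at h2
    exact Subtype.ext ((Submodule.mem_bot ℂ).1 h2)

theorem GenPos.comp {ι : Type} [Fintype ι] {p : ι → C.Point} (h : GenPos p) (e : Equiv.Perm ι) :
    GenPos (p ∘ e) := by
  have : ∑ i, C.pt ((p ∘ e) i) = ∑ i, C.pt (p i) := Equiv.sum_comp e fun i => C.pt (p i)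
  rw [GenPos, this]
  exact h

theorem bad_comp {ι : Type} [Fintype ι] {p : ι → C.Point} (e : Equiv.Perm ι) (i j k : ι) :
    Bad (p ∘ e) i j k ↔ Bad p (e i) (e j) (e k) := by
  have : ∑ i, C.pt ((p ∘ e) i) = ∑ i, C.pt (p i) := Equiv.sum_comp e fun i => C.pt (p i)
  rw [Bad, this]
  rfl

/-- There is a tuple of points in general position for which either all triples of indices are bad,
or all triples beginning with two given indices are good. -/
theorem bad_dichotomy (hH : ¬ C.Hyperelliptic) (hT : ¬ C.Trigonal) (hn : n + 2 = C.genus) :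
    ∃ p : Fin n → C.Point, Injective p ∧ GenPos p ∧
      ((∀ i j k, i ≠ j → i ≠ k → j ≠ k → Bad p i j k) ∨
        ∃ i j, i ≠ j ∧ ∃ k, i ≠ k ∧ j ≠ k ∧ ∀ k, i ≠ k → j ≠ k → ¬ Bad p i j k) := by
  classical
  obtain ⟨s, hs, hs0⟩ := exists_mem_ne_zero (D := C.K) (by rw [h0_K]; omega)
  by_cases hall : ∀ p : Fin n → C.Chart s, Injective p → GenPos (fun i => (p i).1) →
      ∀ i j k, i ≠ j → i ≠ k → j ≠ k → Bad (fun i => (p i).1) i j k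
  · obtain ⟨p, hp1, hp2, hp3⟩ := exists_genPos hH hT (finite_not_chart hs hs0) hn
    set q : Fin n → C.Chart s := fun i => ⟨p i, not_not.1 (hp2 i)⟩ with hq
    exact ⟨p, hp1, hp3, Or.inl (hall q (fun i j h => hp1 (congrArg Subtype.val h)) hp3)⟩
  push Not at hall
  obtain ⟨p, hp, hG, i, j, k₀, hij, hik, hjk, hbad⟩ := hall
  have hfr : Module.finrank ℂ (C.H0 C.K) = n + 2 := hn ▸ h0_K
  set b : Module.Basis (Fin n ⊕ Fin 2) ℂ (C.H0 C.K) :=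
    (Module.finBasisOfFinrankEq ℂ (C.H0 C.K) hfr).reindex finSumFinEquiv.symm with hb
  have := infinite_chart hs hs0
  set U : {k : Fin n // i ≠ k ∧ j ≠ k} → Set (Fin n ⊕ Fin 2 → C.Chart s) := fun k =>
    {P | (evMatrix b hs0 P).det ≠ 0} ∩ ({P | 2 * C.genus - 1 ≤ Module.finrank ℂ (Submodule.span ℂ
      (Set.range fun a : Fin 2 × (Set.univ : Set (Fin n ⊕ Fin 2)) =>
        (dualSec b hs0 P (Sum.inr a.1) : C.F) * dualSec b hs0 P a.2))} ∩
    {P | 2 * C.genus - 2 ≤ Module.finrank ℂ (Submodule.span ℂ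
      (Set.range fun a : Option (Fin 2 × {r : Fin n ⊕ Fin 2 | r ≠ Sum.inl k.1}) =>
        (dualSec b hs0 P (a.elim (Sum.inl i) fun a => Sum.inr a.1) : C.F) *
          dualSec b hs0 P (a.elim (Sum.inl j) fun a => a.2)))}) with hU
  have hmem : ∀ k P, P ∈ U k ↔ (evMatrix b hs0 P).det ≠ 0 ∧ GenPos (basePts P) ∧
      ¬ Bad (basePts P) i j k.1 := by
    intro k P
    constructor
    · rintro ⟨h1, h2, h3⟩
      have h4 := (genPos_iff_rank hn h1).2 h2
      exact ⟨h1, h4, (not_bad_iff_rank hn h1 h4 k.2.1 k.2.2).2 h3⟩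
    · rintro ⟨h1, h2, h3⟩
      exact ⟨h1, (genPos_iff_rank hn h1).1 h2, (not_bad_iff_rank hn h1 h2 k.2.1 k.2.2).1 h3⟩
  have hopen : ∀ k, SliceOpen (U k) := fun k =>
    (sliceOpen_det b hs0).inter ((sliceOpen_rank b hs0 _ _ _).inter (sliceOpen_rank b hs0 _ _ _))
  have hne : ∀ k, (U k).Nonempty := by
    rintro ⟨k, hk1, hk2⟩
    set e := Equiv.swap k k₀ with he
    have hei : e i = i := Equiv.swap_apply_of_ne_of_ne hk1 hik
    have hej : e j = j := Equiv.swap_apply_of_ne_of_ne hk2 hjk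
    have hek : e k = k₀ := Equiv.swap_apply_left k k₀
    obtain ⟨P, hP1, hP2⟩ := exists_extension hs b hs0 (p := p ∘ e) (hp.comp e.injective)
      (hG.comp e)
    refine ⟨P, (hmem _ _).2 ⟨hP2, ?_, ?_⟩⟩
    · rw [hP1]; exact hG.comp e
    · rw [hP1]
      have := (bad_comp (p := fun i => (p i).1) e i j k).not
      rw [hei, hej, hek] at this
      exact this.2 hbad
  obtain ⟨P, hP⟩ := SliceOpen.iInter_nonempty hopen hne
  rw [Set.mem_iInter] at hP
  have h1 := (hmem _ _).1 (hP ⟨k₀, hik, hjk⟩)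
  refine ⟨basePts P, basePts_injective h1.1, h1.2.1, Or.inr ⟨i, j, hij, k₀, hik, hjk, ?_⟩⟩
  intro k hik hjk
  exact ((hmem _ _).1 (hP ⟨k, hik, hjk⟩)).2.2

end Curve

namespace Curve
open PreCurve Polynomial
variable {C : Curve}

theorem mul_aeval_mem {D : C.Div} {x y : C.F} (hx0 : x ≠ 0) (hx : x ∈ C.H0 D) (hy : y ∈ C.H0 D)
    {A : ℂ[X]} (hA : A.natDegree ≤ 1) : x * aeval (y / x) A ∈ C.H0 D := by
  rw [eq_X_add_C_of_natDegree_le_one hA]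
  have : x * aeval (y / x) (Polynomial.C (A.coeff 1) * X + Polynomial.C (A.coeff 0)) = A.coeff 1 • y + A.coeff 0 • x := by
    simp only [map_add, map_mul, aeval_C, aeval_X, Algebra.smul_def]
    field_simp
  rw [this]
  exact add_mem (Submodule.smul_mem _ _ hy) (Submodule.smul_mem _ _ hx)

theorem exists_mul_aeval_eq {x y f : C.F} (hx0 : x ≠ 0) (hf : f ∈ Submodule.span ℂ {x, y}) :
    ∃ A : ℂ[X], A.natDegree ≤ 1 ∧ x * aeval (y / x) A = f := by
  obtain ⟨a, b, rfl⟩ := Submodule.mem_span_pair.1 hf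
  refine ⟨Polynomial.C b * X + Polynomial.C a, natDegree_linear_le, ?_⟩
  simp only [map_add, map_mul, aeval_C, aeval_X, Algebra.smul_def]
  field_simp
  ring

theorem not_isConst_div {x y : C.F} (h : LinearIndependent ℂ ![x, y]) : ¬ C.IsConst (y / x) := by
  rintro ⟨c, hc⟩
  have hx0 : x ≠ 0 := h.ne_zero 0
  rw [eq_div_iff hx0, ← Algebra.smul_def] at hc
  have h1 := LinearIndependent.pair_iff.1 h c (-1) (by rw [hc]; simp)
  simpa using h1.2

section relations
variable {ι : Type} [Fintype ι] {p : ι → C.Point} {x y : C.F}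

theorem GenPos.deg_sub (hn : Fintype.card ι + 2 = C.genus) :
    C.deg (C.K - ∑ r, C.pt (p r)) = C.genus := by
  rw [PreCurve.deg_sub, deg_K, deg_sum]
  simp only [deg_pt, Finset.sum_const, Finset.card_univ, nsmul_eq_mul, mul_one]
  omega

theorem GenPos.mul_H0_K (hn : Fintype.card ι + 2 = C.genus) (hG : GenPos p)
    (h : LinearIndependent ℂ ![x, y]) (hx : x ∈ C.H0 (C.K - ∑ r, C.pt (p r)))
    (hy : y ∈ C.H0 (C.K - ∑ r, C.pt (p r))) :
    Submodule.span ℂ {x, y} * C.H0 C.K = C.H0 (C.K - ∑ r, C.pt (p r) + C.K) := by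
  refine Submodule.eq_of_le_of_finrank_eq ?_ ?_
  · refine Submodule.mul_le.2 fun a ha b hb => mul_mem_H0 _ ?_ hb
    rwa [H0_eq_span_pair h hx hy hG.1]
  · have hx0 : x ≠ 0 := h.ne_zero 0
    have hy0 : y ≠ 0 := h.ne_zero 1
    have h1 := finrank_pencil hx0 hy0 C.K
    rw [← Submodule.span_pair_mul, gcdDiv_of_bpf h hx hy hG.1 hG.2, neg_sub, add_sub_cancel,
      hG.h0_sum hn, h0_K] at h1
    have h2 := h0_of_deg (D := C.K - ∑ r, C.pt (p r) + C.K)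
      (by rw [deg_add, GenPos.deg_sub hn, deg_K]; omega)
    rw [deg_add, GenPos.deg_sub hn, deg_K, h0] at h2
    omega

theorem exists_pair_relation (hn : Fintype.card ι + 2 = C.genus) (hp : Injective p)
    (hG : GenPos p) (h : LinearIndependent ℂ ![x, y]) (hx : x ∈ C.H0 (C.K - ∑ r, C.pt (p r)))
    (hy : y ∈ C.H0 (C.K - ∑ r, C.pt (p r))) {i j : ι} (hij : i ≠ j) {u v : C.F}
    (hu : u ∈ C.H0 (C.K - ∑ r, C.pt (p r) + C.pt (p i))) (hu' : u ∉ C.H0 (C.K - ∑ r, C.pt (p r)))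
    (hv : v ∈ C.H0 (C.K - ∑ r, C.pt (p r) + C.pt (p j))) (hv' : v ∉ C.H0 (C.K - ∑ r, C.pt (p r)))
    (hbad : ∀ k, i ≠ k → j ≠ k → Bad p i j k) :
    ∃ A B c : ℂ[X], A.natDegree ≤ 1 ∧ B.natDegree ≤ 1 ∧ c.natDegree ≤ 2 ∧
      (u / x - aeval (y / x) A) * (v / x - aeval (y / x) B) = aeval (y / x) c := by
  classical
  have hx0 : x ≠ 0 := h.ne_zero 0
  have hy0 : y ≠ 0 := h.ne_zero 1
  set M := C.K - ∑ r, C.pt (p r) with hM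
  have hspan := H0_eq_span_pair h hx hy hG.1
  have hgcd := gcdDiv_of_bpf h hx hy hG.1 hG.2
  have huv : u * v ∈ Submodule.span ℂ {x, y} * C.H0 C.K := by
    rw [hG.mul_H0_K hn h hx hy, ← hM]
    refine H0_le ?_ (mul_mem_H0 _ hu hv)
    have := pt_add_pt_le_sum p hij
    rw [← sub_nonneg] at this ⊢
    convert this using 1
    rw [hM]; abel
  obtain ⟨l, hl, m, hm, hlm⟩ := Submodule.mem_span_pair_mul.1 huv
  have hk : ∀ k, i ≠ k → j ≠ k → l ∈ C.H0 (C.K - C.pt (p k)) ∧ m ∈ C.H0 (C.K - C.pt (p k)) := by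
    intro k hik hjk
    have h1 := hbad k hik hjk (Submodule.mul_mem_mul hu hv)
    rw [← hM, hspan] at h1
    obtain ⟨l', hl', m', hm', hlm'⟩ := Submodule.mem_span_pair_mul.1 h1
    have hMk : C.H0 M ≤ C.H0 (C.K - C.pt (p k)) :=
      H0_le (by rw [hM]; exact sub_le_sub_left (pt_le_sum p k) _)
    have hyf : y * ((m' - m) / x) = l - l' := by
      field_simp
      linear_combination hlm' - hlm
    have hxf : x * ((m' - m) / x) = m' - m := by field_simp
    have hf := (mul_mem_and_iff hx0 hy0 C.K).1
      ⟨hxf ▸ sub_mem (H0_sub_pt_le _ _ hm') hm, hyf ▸ sub_mem hl (H0_sub_pt_le _ _ hl')⟩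
    rw [hgcd, hM, neg_sub, add_sub_cancel] at hf
    obtain ⟨c, hc⟩ := isConst_of_mem (sum_pt_nonneg p) (hG.h0_sum hn).le hf
    rw [← hc, mul_comm, ← Algebra.smul_def] at hxf hyf
    constructor
    · rw [← sub_add_cancel l l', ← hyf]
      exact add_mem (Submodule.smul_mem _ _ (hMk hy)) hl'
    · rw [← sub_sub_cancel m' m, ← hxf]
      exact sub_mem hm' (Submodule.smul_mem _ _ (hMk hx))
  have hB : ∀ f ∈ C.H0 C.K, (∀ k, i ≠ k → j ≠ k → f ∈ C.H0 (C.K - C.pt (p k))) →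
      f ∈ C.H0 (M + C.pt (p i) + C.pt (p j)) := by
    intro f hf hfk
    have h1 := (mem_H0_sub_sum hp ((Finset.univ.erase i).erase j) C.K f).2 ⟨hf, fun r hr => ?_⟩
    · convert h1 using 2
      rw [hM, ← Finset.add_sum_erase _ _ (Finset.mem_univ i),
        ← Finset.add_sum_erase _ _ (Finset.mem_erase.2 ⟨hij.symm, Finset.mem_univ j⟩)]
      abel
    · rw [Finset.mem_erase, Finset.mem_erase] at hr
      exact (mem_H0_sub_pt.1 (hfk r hr.2.1.symm hr.1.symm)).2
  have hvi : v ∉ C.H0 (M + C.pt (p i)) := by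
    intro hvi
    apply hv'
    rw [← add_sub_cancel_right M (C.pt (p j)), mem_H0_sub_pt]
    refine ⟨hv, ?_⟩
    have h1 := mem_H0'.1 hvi (p j)
    rw [Finsupp.add_apply, pt_ne (fun h => hij (hp h)), add_zero] at h1
    rw [Finsupp.add_apply, pt_self]
    convert h1 using 2
    ring
  have hdec : ∀ f ∈ C.H0 (M + C.pt (p i) + C.pt (p j)), ∃ L : ℂ[X], ∃ α β : ℂ, L.natDegree ≤ 1 ∧
      f = x * aeval (y / x) L + α • u + β • v := by
    intro f hf
    rw [H0_add_pt_eq (H0_le (by rw [add_right_comm]; exact le_add_of_nonneg_right (pt_nonneg _)) hv)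
      hvi, H0_add_pt_eq hu hu', hspan] at hf
    obtain ⟨f1, hf1, f2, hf2, rfl⟩ := Submodule.mem_sup.1 hf
    obtain ⟨f3, hf3, f4, hf4, rfl⟩ := Submodule.mem_sup.1 hf1
    obtain ⟨β, rfl⟩ := Submodule.mem_span_singleton.1 hf2
    obtain ⟨α, rfl⟩ := Submodule.mem_span_singleton.1 hf4
    obtain ⟨L, hL, rfl⟩ := exists_mul_aeval_eq hx0 hf3
    exact ⟨L, α, β, hL, rfl⟩
  obtain ⟨L, α, β, hL, hl2⟩ := hdec l (hB l hl fun k h1 h2 => (hk k h1 h2).1)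
  obtain ⟨N, α', β', hN, hm2⟩ := hdec m (hB m hm fun k h1 h2 => (hk k h1 h2).2)
  refine ⟨Polynomial.C β' * X + Polynomial.C β, Polynomial.C α' * X + Polynomial.C α, L + X * N + (Polynomial.C β' * X + Polynomial.C β) * (Polynomial.C α' * X + Polynomial.C α),
    natDegree_linear_le, natDegree_linear_le, ?_, ?_⟩
  · refine natDegree_add_le_of_degree_le (natDegree_add_le_of_degree_le (hL.trans (by norm_num)) ?_)
      ?_
    · exact natDegree_mul_le_of_le (m := 1) (n := 1) natDegree_X_le hN
    · exact natDegree_mul_le_of_le (m := 1) (n := 1) natDegree_linear_le natDegree_linear_le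
  · clear_value M
    rw [hl2, hm2] at hlm
    simp only [Algebra.smul_def] at hlm
    simp only [map_add, map_mul, aeval_C, aeval_X]
    field_simp
    field_simp at hlm
    linear_combination -hlm

end relations
end Curve

namespace Curve
open PreCurve Polynomial
variable {C : Curve} {x y : C.F}

theorem aeval_mem_van {P : C.Point} {f : C.F} (hf : f ∈ C.van P 0) (A : ℂ[X]) :
    aeval f A ∈ C.van P 0 ∧ C.ev P (aeval f A) = A.eval (C.ev P f) := by
  induction A using Polynomial.induction_on' with
  | add p q hp hq =>
    rw [map_add, eval_add, ev_add hp.1 hq.1, hp.2, hq.2]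
    exact ⟨add_mem hp.1 hq.1, rfl⟩
  | monomial n a =>
    have h : f ^ n ∈ C.van P 0 ∧ C.ev P (f ^ n) = C.ev P f ^ n := by
      induction n with
      | zero =>
        rw [pow_zero, pow_zero]
        exact ⟨one_mem_van P, by simpa using ev_algebraMap P (1 : ℂ)⟩
      | succ n ih =>
        rw [pow_succ, pow_succ, ev_mul ih.1 hf, ih.2]
        exact ⟨mul_mem_van_zero ih.1 hf, rfl⟩
    rw [aeval_monomial, eval_monomial, ev_mul (algebraMap_mem_van P a) h.1, ev_algebraMap, h.2]
    exact ⟨mul_mem_van_zero (algebraMap_mem_van P a) h.1, rfl⟩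

theorem ord_eq_of_not_mem {D : C.Div} {P : C.Point} (hx0 : x ≠ 0) (hx : x ∈ C.H0 D)
    (hP : x ∉ C.van P (1 - D P)) : C.ord P x = - D P := by
  have h1 := mem_H0'.1 hx P
  rw [mem_van_of_ne hx0] at h1 hP
  omega

theorem not_mem_van_of_bpf (h : LinearIndependent ℂ ![x, y]) {D : C.Div} (hx : x ∈ C.H0 D)
    (hy : y ∈ C.H0 D) (hD : C.h0 D = 2) (hb : C.BasePointFree D) {P : C.Point}
    (hxP : x ∈ C.van P (1 - D P)) : y ∉ C.van P (1 - D P) := by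
  intro hyP
  have h1 := two_le_h0 h (mem_H0_sub_pt.2 ⟨hx, hxP⟩) (mem_H0_sub_pt.2 ⟨hy, hyP⟩)
  have := hb P
  omega

/-- Almost all fibres of a base point free pencil are reduced, and avoid a given finite set. -/
theorem exists_fiber (h : LinearIndependent ℂ ![x, y]) {D : C.Div} (hx : x ∈ C.H0 D)
    (hy : y ∈ C.H0 D) (hD : C.h0 D = 2) (hb : C.BasePointFree D) {S : Set C.Point}
    (hS : S.Finite) : ∃ B : Set ℂ, B.Finite ∧ ∀ c ∉ B, ∃ T : Finset C.Point,
      C.deg D = T.card ∧ ∀ R ∈ T, R ∉ S ∧ y / x ∈ C.van R 0 ∧ C.ev R (y / x) = c := by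
  have ht := not_isConst_div h
  have hx0 : x ≠ 0 := h.ne_zero 0
  obtain ⟨Z, hZ, hZ2⟩ := exists_unramified ht
  refine ⟨(fun R => C.ev R (y / x)) '' (Z ∪ S), (hZ.union hS).image _, fun c hc => ?_⟩
  have hs0 : y / x - algebraMap ℂ C.F c ≠ 0 := sub_ev_ne_zero ht c
  set s := y - algebraMap ℂ C.F c * x with hs
  have hsx : s / x = y / x - algebraMap ℂ C.F c := by rw [hs]; field_simp
  have hs0' : s ≠ 0 := fun h => hs0 (by rw [← hsx, h, zero_div])
  have hsD : s ∈ C.H0 D := sub_mem hy (by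
    rw [← Algebra.smul_def]; exact Submodule.smul_mem _ _ hx)
  have hE := (mem_H0_of_ne hs0').1 hsD
  set E := C.divOf s + D with hEdef
  have hR : ∀ R ∈ E.support, R ∉ Z ∪ S ∧ y / x ∈ C.van R 0 ∧ C.ev R (y / x) = c ∧ E R = 1 := by
    intro R hR
    have h1 : 1 ≤ E R := by
      have h2 := hE R
      have h3 := Finsupp.mem_support_iff.1 hR
      rw [Finsupp.zero_apply] at h2
      omega
    have hER : E R = C.ord R s + D R := by rw [hEdef, Finsupp.add_apply, divOf_apply hs0']
    have hsR : s ∈ C.van R (1 - D R) := by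
      rw [mem_van_of_ne hs0']
      omega
    have hxR : x ∉ C.van R (1 - D R) := by
      intro hxR
      refine not_mem_van_of_bpf h hx hy hD hb hxR ?_
      rw [← sub_add_cancel y (algebraMap ℂ C.F c * x)]
      refine add_mem hsR ?_
      rw [← Algebra.smul_def]; exact Submodule.smul_mem _ _ hxR
    have hox := ord_eq_of_not_mem hx0 hx hxR
    have h4 : y / x - algebraMap ℂ C.F c ∈ C.van R 1 := by
      rw [← hsx, div_mem_van_iff hx0, hox]
      exact hsR
    have h5 : y / x ∈ C.van R 0 := by
      rw [← sub_add_cancel (y / x) (algebraMap ℂ C.F c)]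
      exact add_mem (van_mono (by norm_num) h4) (algebraMap_mem_van R c)
    have h6 := (ev_eq_iff h5).2 h4
    have h7 : R ∉ Z ∪ S := fun h7 => hc ⟨R, h7, h6⟩
    have h8 := (hZ2 R fun h => h7 (Or.inl h)).2
    rw [h6, ← hsx, ord_div R hs0' hx0, hox] at h8
    exact ⟨h7, h5, h6, by omega⟩
  refine ⟨E.support, ?_, fun R hR' => ?_⟩
  · have h1 : C.deg E = C.deg D := by rw [hEdef, deg_add, deg_divOf hs0', zero_add]
    rw [← h1, deg, Finsupp.sum, Finset.sum_congr rfl fun R hR' => (hR R hR').2.2.2]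
    simp
  · obtain ⟨h1, h2, h3, -⟩ := hR R hR'
    exact ⟨fun h => h1 (Or.inr h), h2, h3⟩

/-- If `w` separates the points of almost all fibres of a pencil of degree at least three, then it
satisfies no quadratic equation over the field generated by the pencil. -/
theorem quadratic_eq_zero (h : LinearIndependent ℂ ![x, y]) {D : C.Div} (hx : x ∈ C.H0 D)
    (hy : y ∈ C.H0 D) (hD : C.h0 D = 2) (hb : C.BasePointFree D) (hd : 3 ≤ C.deg D)
    {S : Set C.Point} (hS : S.Finite) {w : C.F}
    (hw : ∀ R ∉ S, ∀ R' ∉ S, R ≠ R' → C.ev R (y / x) = C.ev R' (y / x) → C.ev R w ≠ C.ev R' w)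
    {q₀ q₁ q₂ : ℂ[X]} (hq : aeval (y / x) q₀ + aeval (y / x) q₁ * w + aeval (y / x) q₂ * w ^ 2 = 0) :
    q₀ = 0 ∧ q₁ = 0 ∧ q₂ = 0 := by
  obtain ⟨B, hB, hBT⟩ := exists_fiber h hx hy hD hb (hS.union (finite_not_regular w))
  have key : ∀ c ∉ B, q₀.eval c = 0 ∧ q₁.eval c = 0 ∧ q₂.eval c = 0 := by
    intro c hc
    obtain ⟨T, hT, hTR⟩ := hBT c hc
    obtain ⟨R₁, h1, R₂, h2, R₃, h3, h12, h13, h23⟩ :=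
      Finset.two_lt_card.1 (show 2 < T.card by omega)
    have hz : ∀ R ∈ T, q₀.eval c + q₁.eval c * C.ev R w + q₂.eval c * (C.ev R w * C.ev R w) = 0 := by
      intro R hR
      obtain ⟨hR1, hR2, hR3⟩ := hTR R hR
      have hwR : w ∈ C.van R 0 := by
        by_contra h
        exact hR1 (Or.inr h)
      have e0 := aeval_mem_van hR2 q₀
      have e1 := aeval_mem_van hR2 q₁
      have e2 := aeval_mem_van hR2 q₂
      have h4 := congrArg (C.ev R) hq
      rw [pow_two, ev_add (add_mem e0.1 (mul_mem_van_zero e1.1 hwR))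
        (mul_mem_van_zero e2.1 (mul_mem_van_zero hwR hwR)), ev_add e0.1 (mul_mem_van_zero e1.1 hwR),
        ev_mul e1.1 hwR, ev_mul e2.1 (mul_mem_van_zero hwR hwR), ev_mul hwR hwR, e0.2, e1.2, e2.2,
        hR3] at h4
      rw [h4]
      simpa using ev_algebraMap R (0 : ℂ)
    have hd : ∀ R ∈ T, ∀ R' ∈ T, R ≠ R' → C.ev R w - C.ev R' w ≠ 0 := by
      intro R hR R' hR' hne
      refine sub_ne_zero.2 (hw R (fun h => (hTR R hR).1 (Or.inl h)) R'
        (fun h => (hTR R' hR').1 (Or.inl h)) hne ?_)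
      rw [(hTR R hR).2.2, (hTR R' hR').2.2]
    have d12 := hd _ h1 _ h2 h12
    have d13 := hd _ h1 _ h3 h13
    have d23 := hd _ h2 _ h3 h23
    have z1 := hz _ h1
    have z2 := hz _ h2
    have z3 := hz _ h3
    have e12 : q₁.eval c + q₂.eval c * (C.ev R₁ w + C.ev R₂ w) = 0 :=
      mul_left_cancel₀ d12 (by linear_combination z1 - z2)
    have e13 : q₁.eval c + q₂.eval c * (C.ev R₁ w + C.ev R₃ w) = 0 :=
      mul_left_cancel₀ d13 (by linear_combination z1 - z3)
    have e2 : q₂.eval c = 0 := mul_left_cancel₀ d23 (by linear_combination e12 - e13)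
    rw [e2, zero_mul, add_zero] at e12
    rw [e12, e2] at z1
    exact ⟨by simpa using z1, e12, e2⟩
  have hinf : ∀ q : ℂ[X], (∀ c ∉ B, q.eval c = 0) → q = 0 := fun q h =>
    eq_zero_of_infinite_isRoot q (hB.infinite_compl.mono fun c hc => h c hc)
  exact ⟨hinf _ fun c hc => (key c hc).1, hinf _ fun c hc => (key c hc).2.1,
    hinf _ fun c hc => (key c hc).2.2⟩

section relations
variable {ι : Type} {p : ι → C.Point} {ω : ι → C.F}

theorem H0_add_sum_eq {M : C.Div} (hp : Injective p)
    (hω : ∀ i, ω i ∈ C.H0 (M + C.pt (p i))) (hω' : ∀ i, ω i ∉ C.H0 M) (B : Finset ι) :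
    C.H0 (M + ∑ r ∈ B, C.pt (p r)) = C.H0 M ⊔ Submodule.span ℂ (ω '' B) := by
  classical
  induction B using Finset.induction_on with
  | empty => simp
  | insert a B ha ih =>
    have h1 : (∑ r ∈ B, C.pt (p r)) (p a) = 0 := by
      rw [Finsupp.finsetSum_apply]
      exact Finset.sum_eq_zero fun r hr => pt_ne fun h => ha (hp h ▸ hr)
    rw [Finset.sum_insert ha, add_comm (C.pt (p a)), ← add_assoc, H0_add_pt_eq (u := ω a), ih,
      sup_assoc, ← Submodule.span_union, Finset.coe_insert, Set.image_insert_eq,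
      Set.insert_eq, Set.union_comm]
    · refine H0_le ?_ (hω a)
      rw [add_right_comm]
      exact le_add_of_nonneg_right (Finset.sum_nonneg fun r _ => pt_nonneg _)
    · intro h
      apply hω' a
      rw [← add_sub_cancel_right M (C.pt (p a)), mem_H0_sub_pt]
      refine ⟨hω a, ?_⟩
      have h2 := mem_H0'.1 h (p a)
      rw [Finsupp.add_apply, h1, add_zero] at h2
      rw [Finsupp.add_apply, pt_self]
      convert h2 using 2
      ring

/-- The function `ω i / x` separates the points of almost all fibres. -/
theorem separates_fiber [Fintype ι] (hVA : C.VeryAmple C.K) (hp : Injective p) (hG : GenPos p)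
    (h : LinearIndependent ℂ ![x, y]) (hx : x ∈ C.H0 (C.K - ∑ r, C.pt (p r)))
    (hy : y ∈ C.H0 (C.K - ∑ r, C.pt (p r)))
    (hω : ∀ i, ω i ∈ C.H0 (C.K - ∑ r, C.pt (p r) + C.pt (p i)))
    (hω' : ∀ i, ω i ∉ C.H0 (C.K - ∑ r, C.pt (p r))) {i : ι} {A B c : ι → ℂ[X]}
    (hrel : ∀ j ≠ i, (ω i / x - aeval (y / x) (A j)) * (ω j / x - aeval (y / x) (B j)) =
      aeval (y / x) (c j)) (hc : ∀ j ≠ i, c j ≠ 0) :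
    ∃ S : Set C.Point, S.Finite ∧ ∀ R ∉ S, ∀ R' ∉ S, R ≠ R' →
      C.ev R (y / x) = C.ev R' (y / x) → C.ev R (ω i / x) ≠ C.ev R' (ω i / x) := by
  have hx0 : x ≠ 0 := h.ne_zero 0
  have ht := not_isConst_div h
  have hMK : C.H0 (C.K - ∑ r, C.pt (p r)) ≤ C.H0 C.K := H0_le (sub_le_self _ (sum_pt_nonneg p))
  refine ⟨{P | x ∈ C.van P (1 - C.K P)} ∪ {P | y / x ∉ C.van P 0} ∪ (⋃ j, {P | ω j / x ∉ C.van P 0})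
    ∪ ⋃ j ∈ {j | j ≠ i}, {P | aeval (y / x) (c j) ∈ C.van P 1}, ?_, ?_⟩
  · refine (((finite_section_zeros C.K hx0).union (finite_not_regular _)).union
      (Set.finite_iUnion fun j => finite_not_regular _)).union
      ((Set.toFinite _).biUnion fun j hj => finite_zeros (aeval_ne_zero ht (hc j hj)))
  intro R hR R' hR' hne htR hwR
  simp only [Set.mem_union, not_or, Set.mem_iUnion, not_exists, Set.mem_ofPred_eq, not_not]
    at hR hR'
  have hstep : ∀ Q : C.Point, (((x ∉ C.van Q (1 - C.K Q) ∧ y / x ∈ C.van Q 0) ∧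
      ∀ j, ω j / x ∈ C.van Q 0) ∧ ∀ j, j ≠ i → aeval (y / x) (c j) ∉ C.van Q 1) → ∀ j ≠ i,
      (C.ev Q (ω i / x) - (A j).eval (C.ev Q (y / x))) *
        (C.ev Q (ω j / x) - (B j).eval (C.ev Q (y / x))) = (c j).eval (C.ev Q (y / x)) ∧
      (c j).eval (C.ev Q (y / x)) ≠ 0 := by
    intro Q hQ j hj
    have hsub : ∀ f g : C.F, f ∈ C.van Q 0 → g ∈ C.van Q 0 → C.ev Q (f - g) = C.ev Q f - C.ev Q g := by
      intro f g hf hg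
      have := ev_add (sub_mem hf hg) hg
      rw [sub_add_cancel] at this
      rw [this, add_sub_cancel_right]
    have a1 := aeval_mem_van hQ.1.1.2 (A j)
    have b1 := aeval_mem_van hQ.1.1.2 (B j)
    have c1 := aeval_mem_van hQ.1.1.2 (c j)
    have h1 := congrArg (C.ev Q) (hrel j hj)
    rw [ev_mul (sub_mem (hQ.1.2 i) a1.1) (sub_mem (hQ.1.2 j) b1.1), hsub _ _ (hQ.1.2 i) a1.1,
      hsub _ _ (hQ.1.2 j) b1.1, a1.2, b1.2, c1.2] at h1
    refine ⟨h1, ?_⟩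
    rw [← c1.2, Ne, ev_eq_zero_iff c1.1]
    exact hQ.2 j hj
  have hwj : ∀ j, C.ev R (ω j / x) = C.ev R' (ω j / x) := by
    intro j
    rcases eq_or_ne j i with rfl | hj
    · exact hwR
    obtain ⟨e1, n1⟩ := hstep R hR j hj
    obtain ⟨e2, n2⟩ := hstep R' hR' j hj
    rw [← htR, ← hwR] at e2
    rw [← e1] at n1
    exact sub_left_inj.1 (mul_left_cancel₀ (left_ne_zero_of_mul n1) (e1.trans e2.symm))
  have hall : ∀ f ∈ C.H0 C.K, f / x ∈ C.van R 0 ∧ f / x ∈ C.van R' 0 ∧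
      C.ev R (f / x) = C.ev R' (f / x) := by
    have hK : C.H0 C.K = Submodule.span ℂ ({x, y} ∪ Set.range ω) := by
      have h1 := H0_add_sum_eq hp hω hω' Finset.univ
      rw [sub_add_cancel, H0_eq_span_pair h hx hy hG.1, ← Submodule.span_union, Finset.coe_univ,
        Set.image_univ] at h1
      exact h1
    intro f hf
    rw [hK] at hf
    induction hf using Submodule.span_induction with
    | mem f hf =>
      rcases hf with (rfl | rfl) | ⟨j, rfl⟩
      · rw [div_self hx0, ← map_one (algebraMap ℂ C.F), ev_algebraMap, ev_algebraMap]
        exact ⟨algebraMap_mem_van _ _, algebraMap_mem_van _ _, rfl⟩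
      · exact ⟨hR.1.1.2, hR'.1.1.2, htR⟩
      · exact ⟨hR.1.2 j, hR'.1.2 j, hwj j⟩
    | zero => simpa using (ev_algebraMap R (0 : ℂ)).trans (ev_algebraMap R' 0).symm
    | add f g _ _ hf hg =>
      rw [add_div, ev_add hf.1 hg.1, ev_add hf.2.1 hg.2.1, hf.2.2, hg.2.2]
      exact ⟨add_mem hf.1 hg.1, add_mem hf.2.1 hg.2.1, rfl⟩
    | smul a f _ hf =>
      rw [smul_div_assoc, ev_smul hf.1, ev_smul hf.2.1, hf.2.2]
      exact ⟨Submodule.smul_mem _ _ hf.1, Submodule.smul_mem _ _ hf.2.1, rfl⟩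
  have hle : C.H0 (C.K - C.pt R) ≤ C.H0 (C.K - C.pt R - C.pt R') := by
    intro f hf
    refine mem_H0_sub_pt.2 ⟨hf, ?_⟩
    have hf := mem_H0_sub_pt.1 hf
    obtain ⟨h1, h2, h3⟩ := hall f hf.1
    have oR := ord_eq_of_not_mem hx0 (hMK hx) hR.1.1.1
    have oR' := ord_eq_of_not_mem hx0 (hMK hx) hR'.1.1.1
    have h4 : f / x ∈ C.van R 1 := by
      rw [div_mem_van_iff hx0, oR]
      exact hf.2
    rw [← ev_eq_zero_iff h1, h3, ev_eq_zero_iff h2, div_mem_van_iff hx0, oR'] at h4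
    rw [Finsupp.sub_apply, pt_ne hne, sub_zero]
    exact h4
  have h1 := hVA R R'
  have h2 := h0_le_sub_pt C.K R
  have h3 : C.h0 (C.K - C.pt R) ≤ C.h0 (C.K - C.pt R - C.pt R') := Submodule.finrank_mono hle
  omega

end relations
end Curve

namespace Polynomial

theorem exists_eq_mul_of_natDegree_le_two {k : Type*} [Field k] [IsAlgClosed k] {c : k[X]}
    (hc : c.natDegree ≤ 2) : ∃ P Q : k[X], P.natDegree ≤ 1 ∧ Q.natDegree ≤ 1 ∧ P * Q = c := by
  by_cases h : c.natDegree ≤ 1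
  · exact ⟨1, c, by simp, h, one_mul c⟩
  obtain ⟨a, ha⟩ := IsAlgClosed.exists_root c (degree_ne_of_natDegree_ne (n := 0) (by omega))
  obtain ⟨Q, hQ⟩ := dvd_iff_isRoot.2 ha
  refine ⟨X - C a, Q, natDegree_X_sub_C_le a, ?_, hQ.symm⟩
  rcases eq_or_ne Q 0 with rfl | hQ0
  · simp
  rw [hQ, natDegree_mul (X_sub_C_ne_zero a) hQ0, natDegree_X_sub_C] at hc
  omega

variable {k : Type*} [Field k]

/-- The determinant of a pair of linear polynomials. -/
def linDet (l m : k[X]) : k := l.coeff 0 * m.coeff 1 - l.coeff 1 * m.coeff 0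

theorem linear_eq_zero {l : k[X]} (hl : l.natDegree ≤ 1) (h0 : l.coeff 0 = 0)
    (h1 : l.coeff 1 = 0) : l = 0 := by
  rw [eq_X_add_C_of_natDegree_le_one hl, h0, h1]
  simp

theorem linDet_eq_zero_trans {l m r : k[X]} (hr : r.natDegree ≤ 1) (hr0 : r ≠ 0)
    (hl : linDet l r = 0) (hm : linDet m r = 0) : linDet l m = 0 := by
  by_contra h
  apply hr0
  unfold linDet at *
  refine linear_eq_zero hr (mul_left_cancel₀ h ?_) (mul_left_cancel₀ h ?_)
  · linear_combination m.coeff 0 * hl - l.coeff 0 * hm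
  · linear_combination m.coeff 1 * hl - l.coeff 1 * hm

theorem exists_smul_of_linDet {l m : k[X]} (hl : l.natDegree ≤ 1) (hm : m.natDegree ≤ 1)
    (hl0 : l ≠ 0) (h : linDet l m = 0) : ∃ a : k, m = C a * l := by
  unfold linDet at h
  by_cases h0 : l.coeff 0 = 0
  · have h1 : l.coeff 1 ≠ 0 := fun h1 => hl0 (linear_eq_zero hl h0 h1)
    refine ⟨m.coeff 1 / l.coeff 1, ?_⟩
    rw [h0, zero_mul, zero_sub, neg_eq_zero] at h
    rw [← sub_eq_zero]
    refine linear_eq_zero (natDegree_sub_le_of_le hm ((natDegree_C_mul_le _ _).trans hl)) ?_ ?_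
    · rw [coeff_sub, coeff_C_mul, h0, (mul_eq_zero.1 h).resolve_left h1]
      simp
    · rw [coeff_sub, coeff_C_mul]
      field_simp
      ring
  · refine ⟨m.coeff 0 / l.coeff 0, ?_⟩
    rw [← sub_eq_zero]
    refine linear_eq_zero (natDegree_sub_le_of_le hm ((natDegree_C_mul_le _ _).trans hl)) ?_ ?_
    · rw [coeff_sub, coeff_C_mul]
      field_simp
      ring
    · rw [coeff_sub, coeff_C_mul]
      field_simp
      linear_combination h

theorem linDet_mul_eq_zero {l₁ m₁ l₂ m₂ : k[X]} (hl₁ : l₁.natDegree ≤ 1) (hm₁ : m₁.natDegree ≤ 1)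
    (hl₂ : l₂.natDegree ≤ 1) (hm₂ : m₂.natDegree ≤ 1) (h : l₁ * m₁ = l₂ * m₂) :
    linDet l₁ l₂ = 0 ∨ linDet l₁ m₂ = 0 := by
  have h2 : ∀ l m : k[X], l.natDegree ≤ 1 → m.natDegree ≤ 1 →
      (l * m).coeff 2 = l.coeff 1 * m.coeff 1 := by
    intro l m hl hm
    exact coeff_mul_add_eq_of_natDegree_le hl hm
  have e0 := congrArg (fun q => q.coeff 0) h
  have e1 := congrArg (fun q => q.coeff 1) h
  have e2 := congrArg (fun q => q.coeff 2) h
  simp only [mul_coeff_zero, mul_coeff_one, h2 _ _ hl₁ hm₁, h2 _ _ hl₂ hm₂] at e0 e1 e2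
  rw [← mul_eq_zero]
  unfold linDet
  linear_combination - l₁.coeff 1 ^ 2 * e0 + l₁.coeff 0 * l₁.coeff 1 * e1 - l₁.coeff 0 ^ 2 * e2

/-- Three linear factors of a binary quadratic form are not pairwise independent. -/
theorem linDet_of_three_factors {c : k[X]} (hc : c ≠ 0) {l m : Fin 3 → k[X]}
    (hl : ∀ i, (l i).natDegree ≤ 1) (hm : ∀ i, (m i).natDegree ≤ 1) (h : ∀ i, l i * m i = c) :
    linDet (l 0) (l 1) = 0 ∨ linDet (l 0) (l 2) = 0 ∨ linDet (l 1) (l 2) = 0 := by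
  rcases linDet_mul_eq_zero (hl 0) (hm 0) (hl 2) (hm 2) ((h 0).trans (h 2).symm) with h1 | h1
  · exact Or.inr (Or.inl h1)
  rcases linDet_mul_eq_zero (hl 1) (hm 1) (hl 2) (hm 2) ((h 1).trans (h 2).symm) with h2 | h2
  · exact Or.inr (Or.inr h2)
  refine Or.inl (linDet_eq_zero_trans (hm 2) ?_ h1 h2)
  rintro h0
  exact hc (by rw [← h 2, h0, mul_zero])

theorem linDet_sub_of_four {a b c d : k[X]} (ha : a.natDegree ≤ 1) (hb : b.natDegree ≤ 1)
    (hc : c.natDegree ≤ 1) (hd : d.natDegree ≤ 1) (had : a ≠ d) (hbd : b ≠ d) (hcd : c ≠ d)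
    (h1 : linDet (a - b) (a - c) = 0 ∨ linDet (a - b) (a - d) = 0 ∨ linDet (a - c) (a - d) = 0)
    (h2 : linDet (b - a) (b - c) = 0 ∨ linDet (b - a) (b - d) = 0 ∨ linDet (b - c) (b - d) = 0)
    (h3 : linDet (c - a) (c - b) = 0 ∨ linDet (c - a) (c - d) = 0 ∨ linDet (c - b) (c - d) = 0) :
    linDet (a - b) (a - c) = 0 := by
  have e1 := fun (h : linDet (a - b) (a - d) = 0) (h' : linDet (a - c) (a - d) = 0) =>
    linDet_eq_zero_trans (r := a - d) (natDegree_sub_le_of_le ha hd) (sub_ne_zero.2 had) h h'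
  have e2 := fun (h : linDet (b - a) (b - d) = 0) (h' : linDet (b - c) (b - d) = 0) =>
    linDet_eq_zero_trans (r := b - d) (natDegree_sub_le_of_le hb hd) (sub_ne_zero.2 hbd) h h'
  have e3 := fun (h : linDet (c - a) (c - d) = 0) (h' : linDet (c - b) (c - d) = 0) =>
    linDet_eq_zero_trans (r := c - d) (natDegree_sub_le_of_le hc hd) (sub_ne_zero.2 hcd) h h'
  have s1 : linDet (b - a) (b - c) = - linDet (a - b) (a - c) := by
    simp only [linDet, coeff_sub]; ring
  have s2 : linDet (c - a) (c - b) = linDet (a - b) (a - c) := by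
    simp only [linDet, coeff_sub]; ring
  have s3 : linDet (b - a) (b - d) = - linDet (a - b) (a - d) := by
    simp only [linDet, coeff_sub]; ring
  have s4 : linDet (c - a) (c - d) = - linDet (a - c) (a - d) := by
    simp only [linDet, coeff_sub]; ring
  have s5 : linDet (c - b) (c - d) = - linDet (b - c) (b - d) := by
    simp only [linDet, coeff_sub]; ring
  rw [s1, s3, neg_eq_zero, neg_eq_zero] at h2 e2
  rw [s2, s4, s5, neg_eq_zero, neg_eq_zero] at h3 e3
  clear s1 s2 s3 s4 s5
  generalize linDet (a - b) (a - c) = p at *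
  generalize linDet (a - b) (a - d) = q at *
  generalize linDet (a - c) (a - d) = r at *
  generalize linDet (b - c) (b - d) = s at *
  rcases h1 with h | h | h
  · exact h
  · rcases h2 with h' | h' | h'
    · exact h'
    · rcases h3 with h'' | h'' | h''
      · exact h''
      · exact e1 h h''
      · exact e2 h h''
    · exact e2 h h'
  · rcases h2 with h' | h' | h'
    · exact h'
    · exact e1 h' h
    · exact e3 h h'

end Polynomial

namespace Curve
open PreCurve Polynomial
variable {C : Curve}

theorem relation_eq {t w₁ w₂ w₃ : C.F}
    (hQ : ∀ q₀ q₁ q₂ : ℂ[X], aeval t q₀ + aeval t q₁ * w₁ + aeval t q₂ * w₁ ^ 2 = 0 →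
      q₀ = 0 ∧ q₁ = 0 ∧ q₂ = 0) {A₂ B₂ c₂ A₃ B₃ c₃ a b c : ℂ[X]}
    (h₂ : (w₁ - aeval t A₂) * (w₂ - aeval t B₂) = aeval t c₂)
    (h₃ : (w₁ - aeval t A₃) * (w₃ - aeval t B₃) = aeval t c₃)
    (h : (w₂ - aeval t a) * (w₃ - aeval t b) = aeval t c) (hc₃ : c₃ ≠ 0) :
    c₂ = (A₂ - A₃) * (B₂ - a) := by
  obtain ⟨h0, h1, h2⟩ := hQ
    ((c₂ - (B₂ - a) * A₂) * (c₃ - (B₃ - b) * A₃) - c * A₂ * A₃)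
    ((B₂ - a) * (c₃ - (B₃ - b) * A₃) + (c₂ - (B₂ - a) * A₂) * (B₃ - b) + c * (A₂ + A₃))
    ((B₂ - a) * (B₃ - b) - c) (by
      simp only [map_add, map_sub, map_mul]
      linear_combination
        (- (w₁ - aeval t A₃) * (w₃ - aeval t b)) * h₂
        - ((aeval t B₂ - aeval t a) * (w₁ - aeval t A₂) + aeval t c₂) * h₃
        + (w₁ - aeval t A₂) * (w₁ - aeval t A₃) * h)
  refine mul_left_cancel₀ hc₃ ?_
  linear_combination h0 + A₃ * h1 + A₃ ^ 2 * h2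

end Curve

namespace Curve
open PreCurve Polynomial
variable {C : Curve}

theorem two_le_h0_of_not_isConst {u : C.F} (hu : ¬ C.IsConst u) :
    2 ≤ C.h0 (-gcdDiv (1 : C.F) u) := by
  have hu0 : u ≠ 0 := by rintro rfl; exact hu ⟨0, map_zero _⟩
  have h1 := (mul_mem_and_iff (one_ne_zero (α := C.F)) hu0 (-gcdDiv (1 : C.F) u) (u := 1)).2
    (by rw [neg_add_cancel]; exact one_mem_H0 le_rfl)
  rw [mul_one, mul_one] at h1
  refine two_le_h0 (x := 1) (y := u) ?_ h1.1 h1.2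
  rw [LinearIndependent.pair_iff]
  intro s t hst
  have ht : t = 0 := by
    by_contra ht
    refine hu ⟨-s / t, ?_⟩
    rw [Algebra.smul_def, Algebra.smul_def, mul_one] at hst
    have ht' := algebraMap_ne_zero (C := C.toPreCurve) ht
    rw [map_div₀, map_neg, div_eq_iff ht']
    linear_combination -hst
  refine ⟨?_, ht⟩
  rw [ht, zero_smul, add_zero] at hst
  exact (smul_eq_zero.1 hst).resolve_right one_ne_zero

variable {n : ℕ} {p : Fin n → C.Point} {x y : C.F} {ω : Fin n → C.F}

theorem GenPos.h0_add_sum (hn : n + 2 = C.genus) (hG : GenPos p) (J : Finset (Fin n)) :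
    C.h0 (C.K - ∑ r, C.pt (p r) + ∑ r ∈ J, C.pt (p r)) = 2 + J.card := by
  have h1 : ∑ r, C.pt (p r) = ∑ r ∈ J, C.pt (p r) + ∑ r ∈ Jᶜ, C.pt (p r) :=
    (Finset.sum_add_sum_compl J _).symm
  have h2 : C.K - ∑ r, C.pt (p r) + ∑ r ∈ J, C.pt (p r) = C.K - ∑ r ∈ Jᶜ, C.pt (p r) := by
    rw [h1]; abel
  have h0 : 0 ≤ ∑ r ∈ Jᶜ, C.pt (p r) := Finset.sum_nonneg fun r _ => pt_nonneg (p r)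
  have h0' : 0 ≤ ∑ r ∈ J, C.pt (p r) := Finset.sum_nonneg fun r _ => pt_nonneg (p r)
  have h3 := hG.h0_of_le (by simpa using hn) h0 (by rw [h1]; exact le_add_of_nonneg_left h0')
  have h4 := C.riemann_roch (∑ r ∈ Jᶜ, C.pt (p r))
  rw [h3, deg_sum] at h4
  simp only [deg_pt, Finset.sum_const, nsmul_eq_mul, mul_one, Finset.card_compl,
    Fintype.card_fin] at h4
  have h5 : J.card ≤ n := by simpa using J.card_le_univ
  rw [h2]
  push_cast [h5] at h4
  omega

theorem card_lt_h0 (hn : n + 2 = C.genus) (hp : Injective p) (hG : GenPos p)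
    (hω : ∀ i, ω i ∈ C.H0 (C.K - ∑ r, C.pt (p r) + C.pt (p i)))
    (hω' : ∀ i, ω i ∉ C.H0 (C.K - ∑ r, C.pt (p r))) {B : C.Div} (J : Finset (Fin n))
    {z : C.F} (hz : z ≠ 0) (hzM : z ∈ C.H0 (C.K - ∑ r, C.pt (p r))) (hzB : z ∈ C.H0 B)
    (hJ : ∀ j ∈ J, ∃ m ∈ C.H0 (C.K - ∑ r, C.pt (p r)), ω j - m ∈ C.H0 B) :
    J.card + 1 ≤ C.h0 B := by
  set M := C.K - ∑ r, C.pt (p r) with hM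
  have h1 := Submodule.finrank_sup_add_finrank_inf_eq (C.H0 B) (C.H0 M)
  have h2 : C.H0 (M + ∑ r ∈ J, C.pt (p r)) ≤ C.H0 B ⊔ C.H0 M := by
    rw [H0_add_sum_eq hp hω hω' J, sup_le_iff, Submodule.span_le]
    refine ⟨le_sup_right, ?_⟩
    rintro _ ⟨j, hj, rfl⟩
    obtain ⟨m, hm, hm'⟩ := hJ j hj
    have := Submodule.add_mem_sup hm' hm
    rwa [sub_add_cancel] at this
  have h3 := Submodule.finrank_mono h2
  have h4 : 1 ≤ Module.finrank ℂ (C.H0 B ⊓ C.H0 M : Submodule ℂ C.F) := by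
    rw [Nat.one_le_iff_ne_zero, ← Nat.pos_iff_ne_zero, Module.finrank_pos_iff_exists_ne_zero]
    exact ⟨⟨z, hzB, hzM⟩, by simpa [Subtype.ext_iff] using hz⟩
  have h5 : Module.finrank ℂ (C.H0 M) = 2 := hG.1
  have h6 : Module.finrank ℂ (C.H0 (M + ∑ r ∈ J, C.pt (p r))) = 2 + J.card :=
    hG.h0_add_sum hn J
  change _ ≤ Module.finrank ℂ (C.H0 B)
  omega

theorem exists_divisor_of_mul (hn : n + 2 = C.genus) (hp : Injective p) (hG : GenPos p)
    (h : LinearIndependent ℂ ![x, y]) (hx : x ∈ C.H0 (C.K - ∑ r, C.pt (p r)))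
    (hy : y ∈ C.H0 (C.K - ∑ r, C.pt (p r)))
    (hω : ∀ i, ω i ∈ C.H0 (C.K - ∑ r, C.pt (p r) + C.pt (p i)))
    (hω' : ∀ i, ω i ∉ C.H0 (C.K - ∑ r, C.pt (p r))) {i : Fin n} {J s : Finset (Fin n)}
    (hi : i ∈ s) (hJ : J ⊆ s) {A P : ℂ[X]} {B : Fin n → ℂ[X]} (hA : A.natDegree ≤ 1)
    (hP : P.natDegree ≤ 1) (hP0 : P ≠ 0) (hB : ∀ j ∈ J, (B j).natDegree ≤ 1) {u : C.F}
    (hu : u * aeval (y / x) P = ω i / x - aeval (y / x) A)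
    (huJ : ∀ j ∈ J, x * (u * (ω j / x - aeval (y / x) (B j))) ∈
      C.H0 (C.K - ∑ r, C.pt (p r) + ∑ r ∈ s, C.pt (p r))) :
    ∃ D : C.Div, 2 ≤ C.h0 D ∧
      J.card + 1 ≤ C.h0 (C.K - ∑ r, C.pt (p r) + ∑ r ∈ s, C.pt (p r) - D) := by
  have hx0 : x ≠ 0 := h.ne_zero 0
  have ht := not_isConst_div h
  have hAM := mul_aeval_mem hx0 hx hy hA
  have hPM := mul_aeval_mem hx0 hx hy hP
  set M := C.K - ∑ r, C.pt (p r) with hM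
  have hu' : u * (x * aeval (y / x) P) = ω i - x * aeval (y / x) A := by
    rw [mul_left_comm, hu, mul_sub, mul_div_cancel₀ _ hx0]
  have hun : ¬ C.IsConst u := by
    rintro ⟨c, rfl⟩
    rw [← Algebra.smul_def] at hu'
    apply hω' i
    rw [← sub_add_cancel (ω i) (x * aeval (y / x) A), ← hu']
    exact add_mem (Submodule.smul_mem _ _ hPM) hAM
  have hu0 : u ≠ 0 := by rintro rfl; exact hun ⟨0, map_zero _⟩
  have hs : ∀ j ∈ s, C.H0 (M + C.pt (p j)) ≤ C.H0 (M + ∑ r ∈ s, C.pt (p r)) := fun j hj =>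
    H0_le (add_le_add_right (Finset.single_le_sum (f := fun r => C.pt (p r))
      (fun r _ => pt_nonneg (p r)) hj) M)
  have hMs : C.H0 M ≤ C.H0 (M + ∑ r ∈ s, C.pt (p r)) :=
    H0_le (le_add_of_nonneg_right (Finset.sum_nonneg fun r _ => pt_nonneg (p r)))
  have hmem : ∀ f, f ∈ C.H0 (M + ∑ r ∈ s, C.pt (p r)) → u * f ∈ C.H0 (M + ∑ r ∈ s, C.pt (p r)) →
      f ∈ C.H0 (M + ∑ r ∈ s, C.pt (p r) - -gcdDiv 1 u) := by
    intro f h1 h2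
    rw [sub_neg_eq_add, ← mul_mem_and_iff one_ne_zero hu0, one_mul]
    exact ⟨h1, h2⟩
  refine ⟨-gcdDiv 1 u, two_le_h0_of_not_isConst hun, ?_⟩
  refine card_lt_h0 hn hp hG hω hω' J (z := x * aeval (y / x) P)
    (mul_ne_zero hx0 (aeval_ne_zero ht hP0)) hPM (hmem _ (hMs hPM) ?_) ?_
  · rw [hu']
    exact sub_mem (hs i hi (hω i)) (hMs hAM)
  · intro j hj
    have hBM := mul_aeval_mem hx0 hx hy (hB j hj)
    refine ⟨_, hBM, hmem _ (sub_mem (hs j (hJ hj) (hω j)) (hMs hBM)) ?_⟩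
    convert huJ j hj using 1
    field_simp

theorem false_of_two_le (hH : ¬ C.Hyperelliptic) (hT : ¬ C.Trigonal) {D E : C.Div}
    (hdeg : C.deg E ≤ 6) (hD : 2 ≤ C.h0 D) (hE : 2 ≤ C.h0 (E - D)) : False := by
  have h1 : 3 < C.deg D := by
    by_contra! h1
    have := h0_le_one hH hT h1
    omega
  have h2 := h0_le_one hH hT (D := E - D) (by rw [PreCurve.deg_sub]; omega)
  omega

theorem false_of_genus_le (hH : ¬ C.Hyperelliptic) (hT : ¬ C.Trigonal) {D : C.Div}
    (hD : 2 ≤ C.h0 D) (hE : C.genus ≤ C.h0 (C.K - D) + 2) : False := by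
  have h1 : 3 < C.deg D := by
    by_contra! h1
    have := h0_le_one hH hT h1
    omega
  obtain ⟨Q⟩ := nonempty_point (D := D) hD
  obtain ⟨m, hm⟩ := Int.eq_ofNat_of_zero_le (show 0 ≤ C.deg D - 3 by omega)
  have h2 := h0_le_sub (nsmul_nonneg (pt_nonneg Q) m) (D := D)
  have h3 : C.deg (m • C.pt Q) = m := by rw [deg_nsmul, deg_pt]; simp
  have h4 := C.riemann_roch D
  have h5 := h0_le_one hH hT (D := D - m • C.pt Q) (by rw [PreCurve.deg_sub, h3]; omega)
  omega

theorem isPlaneQuintic_of_three_le (hH : ¬ C.Hyperelliptic) (hT : ¬ C.Trigonal) {D E : C.Div}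
    (hdeg : C.deg E ≤ 9) (hD : 2 ≤ C.h0 D) (hE : 3 ≤ C.h0 (E - D)) : C.IsPlaneQuintic := by
  have h1 : 3 < C.deg D := by
    by_contra! h1
    have := h0_le_one hH hT h1
    omega
  obtain ⟨Q⟩ := nonempty_point (D := D) hD
  have h2 : C.deg (E - D) ≤ 5 := by rw [PreCurve.deg_sub]; omega
  have key : ∀ P Q, C.h0 (E - D - C.pt P - C.pt Q) + 2 = C.h0 (E - D) := by
    intro P Q
    have h3 := h0_le_one hH hT (D := E - D - C.pt P - C.pt Q)
      (by rw [PreCurve.deg_sub, PreCurve.deg_sub, deg_pt, deg_pt]; omega)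
    have h4 := h0_le_sub_pt (E - D) P
    have h5 := h0_le_sub_pt (E - D - C.pt P) Q
    omega
  have h3 := h0_le_one hH hT (D := E - D - C.pt Q - C.pt Q)
      (by rw [PreCurve.deg_sub, PreCurve.deg_sub, deg_pt]; omega)
  have h6 := key Q Q
  refine ⟨E - D, le_antisymm h2 ?_, by omega, key⟩
  by_contra! h7
  have h4 := h0_le_sub_pt (E - D) Q
  have h8 := h0_le_one hH hT (D := E - D - C.pt Q)
    (by rw [PreCurve.deg_sub, deg_pt]; omega)
  omega

/-- The mutual relations among the sections `ω` in the degenerate case. -/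
theorem exists_relations (hH : ¬ C.Hyperelliptic) (hT : ¬ C.Trigonal) (hn : n + 2 = C.genus)
    (hp : Injective p) (hG : GenPos p)
    (hbad : ∀ i j k, i ≠ j → i ≠ k → j ≠ k → Bad p i j k)
    (h : LinearIndependent ℂ ![x, y]) (hx : x ∈ C.H0 (C.K - ∑ r, C.pt (p r)))
    (hy : y ∈ C.H0 (C.K - ∑ r, C.pt (p r)))
    (hω : ∀ i, ω i ∈ C.H0 (C.K - ∑ r, C.pt (p r) + C.pt (p i)))
    (hω' : ∀ i, ω i ∉ C.H0 (C.K - ∑ r, C.pt (p r))) (i : Fin n) :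
    ∃ A B c : Fin n → ℂ[X], ∃ e : Fin n → Fin n → ℂ[X],
      (∀ j, (A j).natDegree ≤ 1) ∧ (∀ j, (B j).natDegree ≤ 1) ∧ (∀ j, (c j).natDegree ≤ 2) ∧
      (∀ j k, (e j k).natDegree ≤ 1) ∧ (∀ j ≠ i, c j ≠ 0) ∧
      (∀ j ≠ i, (ω i / x - aeval (y / x) (A j)) * (ω j / x - aeval (y / x) (B j)) =
        aeval (y / x) (c j)) ∧
      ∀ j ≠ i, ∀ k ≠ i, j ≠ k → c j = (A j - A k) * (B j - e j k) := by
  have hx0 : x ≠ 0 := h.ne_zero 0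
  have hn' : Fintype.card (Fin n) + 2 = C.genus := by simpa using hn
  have hrel : ∀ j k, ∃ A B c : ℂ[X], A.natDegree ≤ 1 ∧ B.natDegree ≤ 1 ∧ c.natDegree ≤ 2 ∧
      (j ≠ k → (ω j / x - aeval (y / x) A) * (ω k / x - aeval (y / x) B) = aeval (y / x) c) := by
    intro j k
    by_cases hjk : j = k
    · exact ⟨0, 0, 0, by simp, by simp, by simp, fun h => absurd hjk h⟩
    · obtain ⟨A, B, c, hA, hB, hc, hr⟩ := exists_pair_relation hn' hp hG h hx hy hjk (hω j) (hω' j)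
        (hω k) (hω' k) fun l hl hl' => hbad j k l hjk hl hl'
      exact ⟨A, B, c, hA, hB, hc, fun _ => hr⟩
  choose A B c hA hB hc hr using hrel
  have hne : ∀ j (D : ℂ[X]), D.natDegree ≤ 1 → ω j / x - aeval (y / x) D ≠ 0 := by
    intro j D hD h0
    apply hω' j
    have h1 := mul_aeval_mem hx0 hx hy hD
    rwa [← sub_eq_zero.1 h0, mul_div_cancel₀ _ hx0] at h1
  have hc0 : ∀ j k, j ≠ k → c j k ≠ 0 := by
    intro j k hjk h0
    have h1 := hr j k hjk
    rw [h0, map_zero] at h1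
    exact mul_ne_zero (hne j _ (hA j k)) (hne k _ (hB j k)) h1
  refine ⟨A i, B i, c i, fun j k => A j k, hA i, hB i, hc i, hA, fun j hj => hc0 i j hj.symm,
    fun j hj => hr i j hj.symm, ?_⟩
  obtain ⟨S, hS, hw⟩ := separates_fiber (canonical_veryAmple hH hT) hp hG h hx hy hω hω'
    (fun j hj => hr i j hj.symm) (fun j hj => hc0 i j hj.symm)
  intro j hj k hk hjk
  refine relation_eq (fun q₀ q₁ q₂ hq => ?_) (hr i j hj.symm) (hr i k hk.symm) (hr j k hjk)
    (hc0 i k hk.symm)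
  have := four_le_genus hH hT
  exact quadratic_eq_zero h hx hy hG.1 hG.2 (by rw [GenPos.deg_sub hn']; omega) hS hw hq

theorem false_of_all_bad (hH : ¬ C.Hyperelliptic) (hT : ¬ C.Trigonal)
    (hPQ : ¬ C.IsPlaneQuintic) (hn : n + 2 = C.genus) (hp : Injective p) (hG : GenPos p)
    (hbad : ∀ i j k, i ≠ j → i ≠ k → j ≠ k → Bad p i j k) : False := by
  have hg := four_le_genus hH hT
  have hn' : Fintype.card (Fin n) + 2 = C.genus := by simpa using hn
  obtain ⟨x, y, hx, hy, h⟩ := exists_pair hG.1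
  have hω : ∀ i, ∃ w, w ∈ C.H0 (C.K - ∑ r, C.pt (p r) + C.pt (p i)) ∧
      w ∉ C.H0 (C.K - ∑ r, C.pt (p r)) := by
    intro i
    have h1 := hG.h0_add_sum hn {i}
    rw [Finset.sum_singleton, Finset.card_singleton] at h1
    have h2 := hG.1
    by_contra! h3
    have h4 : C.h0 _ ≤ C.h0 _ := Submodule.finrank_mono h3
    omega
  choose ω hω hω' using hω
  have hx0 : x ≠ 0 := h.ne_zero 0
  have ht := not_isConst_div h
  let i₀ : Fin n := ⟨0, by omega⟩
  let j₀ : Fin n := ⟨1, by omega⟩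
  have hj₀ : j₀ ≠ i₀ := by simp [i₀, j₀, Fin.ext_iff]
  obtain ⟨A, B, c, e, hA, hB, hc, he, hc0, hr, hrr⟩ :=
    exists_relations hH hT hn hp hG hbad h hx hy hω hω' i₀
  have hK : C.K - ∑ r, C.pt (p r) + ∑ r ∈ Finset.univ, C.pt (p r) = C.K := sub_add_cancel _ _
  have hMs : ∀ s : Finset (Fin n), C.H0 (C.K - ∑ r, C.pt (p r)) ≤
      C.H0 (C.K - ∑ r, C.pt (p r) + ∑ r ∈ s, C.pt (p r)) := fun s =>
    H0_le (le_add_of_nonneg_right (Finset.sum_nonneg fun r _ => pt_nonneg (p r)))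
  have hωs : ∀ s : Finset (Fin n), ∀ j ∈ s, ω j ∈
      C.H0 (C.K - ∑ r, C.pt (p r) + ∑ r ∈ s, C.pt (p r)) := fun s j hj =>
    H0_le (add_le_add_right (Finset.single_le_sum (f := fun r => C.pt (p r))
      (fun r _ => pt_nonneg (p r)) hj) _) (hω j)
  by_cases hn2 : n = 2
  · obtain ⟨P, Q, hP, hQ, hPQc⟩ := exists_eq_mul_of_natDegree_le_two (hc j₀)
    have hP0 : P ≠ 0 := by rintro rfl; exact hc0 j₀ hj₀ (by rw [← hPQc, zero_mul])
    have hP0' := aeval_ne_zero ht hP0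
    obtain ⟨D, hD, hD'⟩ := exists_divisor_of_mul (J := {j₀}) (s := Finset.univ) (P := P)
      (u := (ω i₀ / x - aeval (y / x) (A j₀)) / aeval (y / x) P) hn hp hG h hx hy hω hω'
      (Finset.mem_univ i₀) (Finset.subset_univ _) (hA j₀) hP hP0 (fun j _ => hB j)
      (div_mul_cancel₀ _ hP0') (by
        intro j hj
        rw [Finset.mem_singleton.1 hj, div_mul_eq_mul_div, hr j₀ hj₀, ← hPQc, map_mul,
          mul_div_cancel_left₀ _ hP0']
        exact hMs _ (mul_aeval_mem hx0 hx hy hQ))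
    rw [hK] at hD'
    exact false_of_two_le hH hT (by rw [deg_K]; omega) hD (by simpa using hD')
  let k₀ : Fin n := ⟨2, by omega⟩
  have hk₀ : k₀ ≠ i₀ := by simp [i₀, k₀, Fin.ext_iff]
  have hjk : j₀ ≠ k₀ := by simp [j₀, k₀, Fin.ext_iff]
  have hAne : ∀ j ≠ i₀, ∀ k ≠ i₀, j ≠ k → A j ≠ A k := by
    intro j hj k hk hjk h0
    exact hc0 j hj (by rw [hrr j hj k hk hjk, h0, sub_self, zero_mul])
  have hP : (A j₀ - A k₀).natDegree ≤ 1 := natDegree_sub_le_of_le (hA _) (hA _)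
  have hP0 : A j₀ - A k₀ ≠ 0 := sub_ne_zero.2 (hAne j₀ hj₀ k₀ hk₀ hjk)
  have hP0' := aeval_ne_zero ht hP0
  have main : ∀ J s : Finset (Fin n), i₀ ∈ s → i₀ ∉ J → J ⊆ s →
      (∀ j ∈ J, j ≠ j₀ → ∃ l : ℂ, A j₀ - A j = Polynomial.C l * (A j₀ - A k₀)) →
      ∃ D : C.Div, 2 ≤ C.h0 D ∧
        J.card + 1 ≤ C.h0 (C.K - ∑ r, C.pt (p r) + ∑ r ∈ s, C.pt (p r) - D) := by
    intro J s his hiJ hJs hl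
    refine exists_divisor_of_mul (P := A j₀ - A k₀)
      (u := (ω i₀ / x - aeval (y / x) (A j₀)) / aeval (y / x) (A j₀ - A k₀)) hn hp hG h hx hy hω hω'
      his hJs (hA j₀) hP hP0 (fun j _ => hB j) (div_mul_cancel₀ _ hP0') ?_
    intro j hj
    have hji : j ≠ i₀ := by rintro rfl; exact hiJ hj
    by_cases hjj : j = j₀
    · rw [hjj, div_mul_eq_mul_div, hr j₀ hj₀, hrr j₀ hj₀ k₀ hk₀ hjk, map_mul,
        mul_div_cancel_left₀ _ hP0']
      exact hMs _ (mul_aeval_mem hx0 hx hy (natDegree_sub_le_of_le (hB _) (he _ _)))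
    · obtain ⟨l, hl⟩ := hl j hj hjj
      have h1 := hr j hji
      have h2 : aeval (y / x) (A j₀) - aeval (y / x) (A j) =
          algebraMap ℂ C.F l * aeval (y / x) (A j₀ - A k₀) := by
        rw [← map_sub, hl, map_mul, aeval_C]
      rw [hrr j hji j₀ hj₀ hjj, map_mul, map_sub, map_sub] at h1
      have h3 : x * ((ω i₀ / x - aeval (y / x) (A j₀)) / aeval (y / x) (A j₀ - A k₀) *
          (ω j / x - aeval (y / x) (B j))) =
          (-l) • (ω j - x * aeval (y / x) (e j j₀)) := by
        generalize aeval (y / x) (A j₀ - A k₀) = P at *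
        rw [Algebra.smul_def, map_neg]
        field_simp
        field_simp at h1
        linear_combination h1 - (- x ^ 2 * aeval (y / x) (e j j₀) + x * ω j) * h2
      rw [h3]
      exact Submodule.smul_mem _ _ (sub_mem (hωs s j (hJs hj))
        (hMs s (mul_aeval_mem hx0 hx hy (he _ _))))
  by_cases hn4 : n = 4
  · obtain ⟨D, hD, hD'⟩ := main {j₀, k₀} {i₀, j₀, k₀} (by simp) (by simp [hj₀.symm, hk₀.symm])
      (by simp) (by
        intro j hj hjj
        have : j = k₀ := by simpa [hjj] using hj
        exact ⟨1, by rw [this, map_one, one_mul]⟩)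
    rw [Finset.card_pair hjk] at hD'
    refine hPQ (isPlaneQuintic_of_three_le hH hT (le_of_eq ?_) hD hD')
    rw [deg_add, GenPos.deg_sub hn', deg_sum]
    simp only [deg_pt]
    rw [Finset.sum_const, Finset.card_insert_of_notMem (by simp [hj₀.symm, hk₀.symm]),
      Finset.card_pair hjk]
    simp
    omega
  · obtain ⟨D, hD, hD'⟩ := main (Finset.univ.erase i₀) Finset.univ (Finset.mem_univ _)
      (Finset.notMem_erase _ _) (Finset.subset_univ _) (by
        intro j hj hjj
        have hji : j ≠ i₀ := Finset.ne_of_mem_erase hj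
        by_cases hjk' : j = k₀
        · exact ⟨1, by rw [hjk', map_one, one_mul]⟩
        obtain ⟨m, hm⟩ : ∃ m, m ∉ ({i₀, j₀, k₀, j} : Finset (Fin n)) := by
          by_contra! h4
          have h5 := Finset.card_le_card (fun r _ => h4 r : Finset.univ ⊆ _)
          have h6 := Finset.card_le_four (a := i₀) (b := j₀) (c := k₀) (d := j)
          rw [Finset.card_univ, Fintype.card_fin] at h5
          have h7 := j.isLt
          simp only [i₀, j₀, k₀, ne_eq, Fin.ext_iff] at hji hjj hjk'
          omega
        simp only [Finset.mem_insert, Finset.mem_singleton, not_or] at hm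
        obtain ⟨hmi, hmj, hmk, hmj'⟩ := hm
        have h3 : ∀ a b c' d, a ≠ i₀ → b ≠ i₀ → c' ≠ i₀ → d ≠ i₀ → a ≠ b → a ≠ c' → a ≠ d →
            linDet (A a - A b) (A a - A c') = 0 ∨ linDet (A a - A b) (A a - A d) = 0 ∨
              linDet (A a - A c') (A a - A d) = 0 := by
          intro a b c' d ha hb hc' hd hab hac had
          refine linDet_of_three_factors (hc0 a ha) (l := ![A a - A b, A a - A c', A a - A d])
            (m := ![B a - e a b, B a - e a c', B a - e a d]) ?_ ?_ ?_
          · intro i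
            fin_cases i <;> exact natDegree_sub_le_of_le (hA _) (hA _)
          · intro i
            fin_cases i <;> exact natDegree_sub_le_of_le (hB _) (he _ _)
          · intro i
            fin_cases i
            exacts [(hrr _ ha _ hb hab).symm, (hrr _ ha _ hc' hac).symm, (hrr _ ha _ hd had).symm]
        refine exists_smul_of_linDet hP (natDegree_sub_le_of_le (hA _) (hA _)) hP0
          (linDet_sub_of_four (hA j₀) (hA k₀) (hA j) (hA m)
          (hAne _ hj₀ _ hmi (Ne.symm hmj)) (hAne _ hk₀ _ hmi (Ne.symm hmk))
          (hAne _ hji _ hmi (Ne.symm hmj')) (h3 _ _ _ _ hj₀ hk₀ hji hmi hjk (Ne.symm hjj)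
            (Ne.symm hmj)) (h3 _ _ _ _ hk₀ hj₀ hji hmi hjk.symm (Ne.symm hjk') (Ne.symm hmk))
          (h3 _ _ _ _ hji hj₀ hk₀ hmi hjj hjk' (Ne.symm hmj'))))
    rw [hK, Finset.card_erase_of_mem (Finset.mem_univ _), Finset.card_univ,
      Fintype.card_fin] at hD'
    exact false_of_genus_le hH hT hD (by omega)

end Curve

namespace Curve
open PreCurve
variable {C : Curve}

theorem h0_zero_nsmul_K : C.h0 (0 • C.K) = 1 := by
  rw [zero_nsmul]; exact C.h0_triv

theorem h0_one_nsmul_K : C.h0 (1 • C.K) = C.genus := by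
  rw [one_nsmul]; exact h0_K

theorem h0_nsmul_K (hg : 2 ≤ C.genus) (j : ℕ) :
    (C.h0 ((j + 2) • C.K) : ℤ) = (2 * j + 3) * (C.genus - 1) := by
  have h1 : C.deg ((j + 2) • C.K) = (j + 2) * (2 * C.genus - 2) := by
    rw [deg_nsmul, deg_K]; simp
  rw [h0_of_deg (by rw [h1]; nlinarith), h1]
  ring

variable {M M' : Matrix (Fin 4) (Fin 4) C.F}

/-- Multiplication by a matrix of sections of the canonical bundle. -/
def mulR (hM : ∀ i k, M i k ∈ C.H0 C.K) (j : ℕ) :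
    (Fin 4 → C.H0 (j • C.K)) →ₗ[ℂ] (Fin 4 → C.H0 ((j + 1) • C.K)) where
  toFun z i := ⟨M.mulVec (fun k => (z k : C.F)) i, by
    change ∑ k, M i k * (z k : C.F) ∈ _
    refine Submodule.sum_mem (C.H0 ((j + 1) • C.K)) fun k _ => ?_
    rw [succ_nsmul, add_comm]
    exact mul_mem_H0 _ (hM i k) (z k).2⟩
  map_add' z z' := by
    funext i
    refine Subtype.ext ?_
    exact congrFun (M.mulVec_add (fun k => (z k : C.F)) fun k => (z' k : C.F)) i
  map_smul' c z := by
    funext i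
    refine Subtype.ext ?_
    exact congrFun (M.mulVec_smul c fun k => (z k : C.F)) i

theorem mem_ker_mulR (hM : ∀ i k, M i k ∈ C.H0 C.K) {j : ℕ} {z : Fin 4 → C.H0 (j • C.K)} :
    z ∈ LinearMap.ker (mulR hM j) ↔ M.mulVec (fun k => (z k : C.F)) = 0 := by
  rw [LinearMap.mem_ker, funext_iff, funext_iff]
  exact forall_congr' fun i => Subtype.ext_iff

theorem range_mulR_eq (hM : ∀ i k, M i k ∈ C.H0 C.K) (hM' : ∀ i k, M' i k ∈ C.H0 C.K)
    (h : M' * M = 0) {β : ℕ → ℕ} (hβ : ∀ j, Module.finrank ℂ (LinearMap.ker (mulR hM j)) ≤ β j)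
    (hβ' : ∀ j, Module.finrank ℂ (LinearMap.ker (mulR hM' j)) ≤ β j)
    (hsum : ∀ j, β j + β (j + 1) ≤ 4 * C.h0 (j • C.K)) (j : ℕ) :
    LinearMap.range (mulR hM j) = LinearMap.ker (mulR hM' (j + 1)) ∧
      Module.finrank ℂ (LinearMap.ker (mulR hM j)) = β j := by
  have h1 : LinearMap.range (mulR hM j) ≤ LinearMap.ker (mulR hM' (j + 1)) := by
    rintro _ ⟨z, rfl⟩
    rw [mem_ker_mulR]
    have h2 : (fun k => (mulR hM j z k : C.F)) = M.mulVec fun k => (z k : C.F) := rfl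
    rw [h2, Matrix.mulVec_mulVec, h, Matrix.zero_mulVec]
  have h2 := LinearMap.finrank_range_add_finrank_ker (mulR hM j)
  have h3 : Module.finrank ℂ (Fin 4 → C.H0 (j • C.K)) = 4 * C.h0 (j • C.K) := by
    rw [Module.finrank_pi_fintype]
    simp [PreCurve.h0]
  have h4 := Submodule.finrank_mono h1
  have h5 := hβ j
  have h6 := hβ' (j + 1)
  have h7 := hsum j
  exact ⟨Submodule.eq_of_le_of_finrank_le h1 (by omega), by omega⟩

/-- The columns of a matrix. -/
def cols (M : Matrix (Fin 4) (Fin 4) C.F) (i r : Fin 4) : C.F := M r i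

theorem sum_smul_cols (z : Fin 4 → C.F) : ∑ i, z i • cols M i = M.mulVec z := by
  funext r
  simp [cols, Matrix.mulVec, dotProduct, mul_comm]

theorem minGen_cols (hM : ∀ i k, M i k ∈ C.H0 C.K) (hM' : ∀ i k, M' i k ∈ C.H0 C.K)
    (h : ∀ j, LinearMap.range (mulR hM j) = LinearMap.ker (mulR hM' (j + 1)))
    (h0 : Module.finrank ℂ (LinearMap.ker (mulR hM 0)) = 0) :
    (C.RL C.K).MinGen (cols M) ((C.RL C.K).Syz (cols M')) := by
  refine ⟨fun n m => ?_, fun z hz hz0 => ?_⟩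
  · rw [GradedSystem.mem_syz, sum_smul_cols]
    constructor
    · rintro ⟨hm, hm0⟩
      have h1 : (fun i => ⟨m i, hm i⟩ : Fin 4 → C.H0 ((n + 1) • C.K)) ∈
          LinearMap.ker (mulR hM' (n + 1)) := (mem_ker_mulR hM').2 hm0
      rw [← h] at h1
      obtain ⟨z, hz⟩ := h1
      refine ⟨fun i => z i, fun i => (z i).2, ?_⟩
      rw [sum_smul_cols]
      funext i
      exact congrArg Subtype.val (congrFun hz i)
    · rintro ⟨z, hz, rfl⟩
      have h1 : mulR hM n (fun i => ⟨z i, hz i⟩) ∈ LinearMap.ker (mulR hM' (n + 1)) := by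
        rw [← h]; exact LinearMap.mem_range_self _ _
      rw [mem_ker_mulR] at h1
      rw [sum_smul_cols]
      exact ⟨fun i => (mulR hM n (fun i => ⟨z i, hz i⟩) i).2, h1⟩
  · rw [sum_smul_cols] at hz0
    have h1 : (fun i => ⟨z i, hz i⟩ : Fin 4 → C.H0 (0 • C.K)) ∈ LinearMap.ker (mulR hM 0) :=
      (mem_ker_mulR hM).2 hz0
    rw [Submodule.finrank_eq_zero.1 h0, Submodule.mem_bot] at h1
    funext i
    exact congrArg Subtype.val (congrFun h1 i)

theorem lin_syz_cols
    (h : (C.RL C.K).MinGen (cols M) ((C.RL C.K).Syz (cols M')))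
    (h' : (C.RL C.K).MinGen (cols M') ((C.RL C.K).Syz (cols M))) (i : ℕ) :
    (C.RL C.K).Lin i (Fin 4 → C.F) ((C.RL C.K).Syz (cols M)) ∧
      (C.RL C.K).Lin i (Fin 4 → C.F) ((C.RL C.K).Syz (cols M')) := by
  induction i with
  | zero => exact ⟨⟨Fin 4, inferInstance, _, h'⟩, ⟨Fin 4, inferInstance, _, h⟩⟩
  | succ i ih =>
    exact ⟨⟨Fin 4, inferInstance, _, h', ih.2⟩, ⟨Fin 4, inferInstance, _, h, ih.1⟩⟩

/-- The skew-symmetric matrix attached to a pair of triples. -/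
def skew (a b : Fin 3 → C.F) : Matrix (Fin 4) (Fin 4) C.F :=
  !![0, b 0, b 1, b 2; -b 0, 0, a 2, -a 1; -b 1, -a 2, 0, a 0; -b 2, a 1, -a 0, 0]

theorem skew_mulVec_eq_zero {a b : Fin 3 → C.F} {v : Fin 4 → C.F} :
    (skew a b).mulVec v = 0 ↔ b 0 * v 1 + b 1 * v 2 + b 2 * v 3 = 0 ∧
      a 2 * v 2 - a 1 * v 3 = b 0 * v 0 ∧ a 0 * v 3 - a 2 * v 1 = b 1 * v 0 ∧
      a 1 * v 1 - a 0 * v 2 = b 2 * v 0 := by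
  have h : (skew a b).mulVec v = ![b 0 * v 1 + b 1 * v 2 + b 2 * v 3,
      a 2 * v 2 - a 1 * v 3 - b 0 * v 0, a 0 * v 3 - a 2 * v 1 - b 1 * v 0,
      a 1 * v 1 - a 0 * v 2 - b 2 * v 0] := by
    funext i
    fin_cases i <;> simp [skew, Matrix.mulVec, dotProduct, Fin.sum_univ_four] <;> ring
  rw [h]
  simp [funext_iff, Fin.forall_fin_succ, sub_eq_zero]

theorem skew_mul_skew {a b : Fin 3 → C.F} (h : a 0 * b 0 + a 1 * b 1 + a 2 * b 2 = 0) :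
    skew a b * skew b a = 0 := by
  ext i k
  fin_cases i <;> fin_cases k <;> simp [skew, Matrix.mul_apply, Fin.sum_univ_four] <;>
  first | linear_combination -h | linear_combination (0 : C.F) * h

theorem skew_mem {a b : Fin 3 → C.F} (ha : ∀ i, a i ∈ C.H0 C.K) (hb : ∀ i, b i ∈ C.H0 C.K)
    (i k : Fin 4) : skew a b i k ∈ C.H0 C.K := by
  fin_cases i <;> fin_cases k <;> simp [skew, ha, hb]

/-- `a` and `b` are triples of canonical sections, the common zeros of `a` are contained in the
divisor `D`, and `b` does not vanish along `D`. -/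
structure SkewPair (a b : Fin 3 → C.F) (D : C.Div) : Prop where
  left_mem : ∀ i, a i ∈ C.H0 (C.K - D)
  left_ne : a 2 ≠ 0
  left_sat : ∀ f N, (∀ i, f * a i ∈ C.H0 (N + C.K)) → f ∈ C.H0 (N + D)
  right_sat : ∀ f N, f ∈ C.H0 N → (∀ i, f * b i ∈ C.H0 (N + C.K - D)) → f ∈ C.H0 (N - D)

theorem finrank_le_add {W : Type} [AddCommGroup W] [Module ℂ W] [FiniteDimensional ℂ W]
    (V : Submodule ℂ W) (φ ψ : W →ₗ[ℂ] C.F) {A B : C.Div} (hA : ∀ v ∈ V, φ v ∈ C.H0 A)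
    (hB : ∀ v ∈ V, φ v = 0 → ψ v ∈ C.H0 B) (h : ∀ v ∈ V, φ v = 0 → ψ v = 0 → v = 0) :
    Module.finrank ℂ V ≤ C.h0 A + C.h0 B := by
  have h1 : LinearMap.range (φ.domRestrict V) ≤ C.H0 A := by
    rintro _ ⟨v, rfl⟩
    exact hA v v.2
  have h2 : LinearMap.range ((ψ.domRestrict V).domRestrict (LinearMap.ker (φ.domRestrict V))) ≤
      C.H0 B := by
    rintro _ ⟨⟨v, hv⟩, rfl⟩
    exact hB v v.2 hv
  have h3 : Injective ((ψ.domRestrict V).domRestrict (LinearMap.ker (φ.domRestrict V))) := by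
    rw [injective_iff_map_eq_zero]
    rintro ⟨v, hv⟩ hv'
    exact Subtype.ext (Subtype.ext (h v v.2 hv hv'))
  have e1 := LinearMap.finrank_range_add_finrank_ker (φ.domRestrict V)
  have e2 := LinearMap.finrank_range_of_inj h3
  have e3 : _ ≤ C.h0 _ := Submodule.finrank_mono h1
  have e4 : _ ≤ C.h0 _ := Submodule.finrank_mono h2
  omega

theorem SkewPair.finrank_ker_le {a b : Fin 3 → C.F} {D : C.Div} (h : SkewPair a b D)
    (hM : ∀ i k, skew a b i k ∈ C.H0 C.K) (j : ℕ) :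
    Module.finrank ℂ (LinearMap.ker (mulR hM j)) ≤
      C.h0 (j • C.K - D) + C.h0 (j • C.K - C.K + D) := by
  have hva : ∀ {s t : C.F} {i k : Fin 3}, s ∈ C.H0 (j • C.K) → t ∈ C.H0 (j • C.K) →
      a i * s - a k * t ∈ C.H0 (j • C.K + C.K - D) := by
    intro s t i k hs ht
    have : j • C.K + C.K - D = (C.K - D) + j • C.K := by abel
    rw [this]
    exact sub_mem (mul_mem_H0 _ (h.left_mem i) hs) (mul_mem_H0 _ (h.left_mem k) ht)
  have key : ∀ v ∈ LinearMap.ker (mulR hM j), (v 0 : C.F) = 0 →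
      (v 1 : C.F) = (v 3 : C.F) * (a 2)⁻¹ * a 0 ∧ (v 2 : C.F) = (v 3 : C.F) * (a 2)⁻¹ * a 1 ∧
        (v 3 : C.F) = (v 3 : C.F) * (a 2)⁻¹ * a 2 := by
    intro v hv hv0
    rw [mem_ker_mulR, skew_mulVec_eq_zero] at hv
    obtain ⟨-, h1, h2, h3⟩ := hv
    rw [hv0, mul_zero] at h1 h2 h3
    have h20 := h.left_ne
    refine ⟨?_, ?_, ?_⟩
    · field_simp
      linear_combination -h2
    · field_simp
      linear_combination h1
    · field_simp
  refine finrank_le_add _ ((C.H0 (j • C.K)).subtype ∘ₗ LinearMap.proj (0 : Fin 4))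
    (LinearMap.mulRight ℂ (a 2)⁻¹ ∘ₗ (C.H0 (j • C.K)).subtype ∘ₗ LinearMap.proj (3 : Fin 4))
    ?_ ?_ ?_
  · intro v hv
    rw [mem_ker_mulR, skew_mulVec_eq_zero] at hv
    obtain ⟨-, h1, h2, h3⟩ := hv
    refine h.right_sat _ _ (v 0).2 fun i => ?_
    change (v 0 : C.F) * b i ∈ _
    rw [mul_comm]
    fin_cases i
    · exact h1 ▸ hva (v 2).2 (v 3).2
    · exact h2 ▸ hva (v 3).2 (v 1).2
    · exact h3 ▸ hva (v 1).2 (v 2).2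
  · intro v hv hv0
    obtain ⟨e1, e2, e3⟩ := key v hv hv0
    change (v 3 : C.F) * (a 2)⁻¹ ∈ _
    refine h.left_sat _ _ fun i => ?_
    rw [sub_add_cancel]
    fin_cases i
    · exact e1 ▸ (v 1).2
    · exact e2 ▸ (v 2).2
    · exact e3 ▸ (v 3).2
  · intro v hv hv0 hv1
    obtain ⟨e1, e2, e3⟩ := key v hv hv0
    replace hv1 : (v 3 : C.F) * (a 2)⁻¹ = 0 := hv1
    rw [hv1, zero_mul] at e1 e2 e3
    refine funext fun i => Subtype.ext ?_
    fin_cases i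
    exacts [hv0, e1, e2, e3]

end Curve

namespace Curve
open PreCurve
variable {C : Curve} {a b : Fin 3 → C.F}

/-- The dimensions of the graded pieces of the kernel of the matrix `skew a b`. -/
def kerDim (g : ℕ) : ℕ → ℕ
  | 0 => 0
  | 1 => 4
  | j + 2 => 4 * (j + 1) * (g - 1)

theorem SkewPair.finrank_ker_le_kerDim {D : C.Div} (h : SkewPair a b D) (hg : 4 ≤ C.genus)
    (hD : C.h0 D = 1) (hdeg : C.deg D = C.genus - 3)
    (hM : ∀ i k, skew a b i k ∈ C.H0 C.K) (j : ℕ) :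
    Module.finrank ℂ (LinearMap.ker (mulR hM j)) ≤ kerDim C.genus j := by
  refine (h.finrank_ker_le hM j).trans ?_
  have hgZ : (4 : ℤ) ≤ C.genus := by exact_mod_cast hg
  match j with
  | 0 =>
    rw [zero_nsmul, zero_sub, zero_sub, h0_eq_zero, h0_eq_zero]
    · exact Nat.zero_le _
    · rw [deg_add, deg_neg, deg_K, hdeg]; linarith
    · rw [deg_neg, hdeg]; linarith
  | 1 =>
    have h1 := C.riemann_roch D
    rw [one_nsmul, sub_self, zero_add, kerDim]
    omega
  | j + 2 =>
    have h1 : C.deg ((j + 2) • C.K) = (j + 2) * (2 * C.genus - 2) := by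
      rw [deg_nsmul, deg_K]; simp
    have hj : (0 : ℤ) ≤ j := Int.natCast_nonneg j
    have h2 : (C.h0 ((j + 2) • C.K - D) : ℤ) = C.deg ((j + 2) • C.K - D) + 1 - C.genus :=
      h0_of_deg (by rw [PreCurve.deg_sub, h1, hdeg]; nlinarith)
    have h3 : (C.h0 ((j + 2) • C.K - C.K + D) : ℤ) =
        C.deg ((j + 2) • C.K - C.K + D) + 1 - C.genus :=
      h0_of_deg (by rw [deg_add, PreCurve.deg_sub, h1, hdeg, deg_K]; nlinarith)
    rw [PreCurve.deg_sub, h1, hdeg] at h2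
    rw [deg_add, PreCurve.deg_sub, h1, hdeg, deg_K] at h3
    rw [kerDim]
    zify [show 1 ≤ C.genus by omega]
    rw [h2, h3]
    apply le_of_eq
    ring

theorem kerDim_add_le (hg : 2 ≤ C.genus) (j : ℕ) :
    kerDim C.genus j + kerDim C.genus (j + 1) ≤ 4 * C.h0 (j • C.K) := by
  match j with
  | 0 => rw [h0_zero_nsmul_K]; rfl
  | 1 =>
    rw [h0_one_nsmul_K]
    simp only [kerDim]
    omega
  | j + 2 =>
    simp only [kerDim]
    zify [show 1 ≤ C.genus by omega]
    rw [h0_nsmul_K hg]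
    apply le_of_eq
    ring

theorem finrank_ker_le_of_injective {M M' : Matrix (Fin 4) (Fin 4) C.F}
    (hM : ∀ i k, M i k ∈ C.H0 C.K) (hM' : ∀ i k, M' i k ∈ C.H0 C.K) {j : ℕ}
    (T : (Fin 4 → C.H0 (j • C.K)) →ₗ[ℂ] (Fin 4 → C.H0 (j • C.K))) (hT : Injective T)
    (h : ∀ v, M.mulVec (fun k => (v k : C.F)) = 0 → M'.mulVec (fun k => (T v k : C.F)) = 0) :
    Module.finrank ℂ (LinearMap.ker (mulR hM j)) ≤
      Module.finrank ℂ (LinearMap.ker (mulR hM' j)) := by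
  refine LinearMap.finrank_le_finrank_of_injective
    (f := T.restrict (p := LinearMap.ker (mulR hM j)) (q := LinearMap.ker (mulR hM' j)) ?_) ?_
  · intro v hv
    rw [mem_ker_mulR] at hv ⊢
    exact h v hv
  · intro v w hvw
    exact Subtype.ext (hT (congrArg Subtype.val hvw))

theorem finrank_ker_skew_swap (ha : ∀ i, a i ∈ C.H0 C.K) (hb : ∀ i, b i ∈ C.H0 C.K) (j : ℕ)
    (hM : ∀ i k, skew ![a 0, b 1, a 2] ![b 0, a 1, b 2] i k ∈ C.H0 C.K) :
    Module.finrank ℂ (LinearMap.ker (mulR (skew_mem hb ha) j)) ≤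
      Module.finrank ℂ (LinearMap.ker (mulR hM j)) := by
  refine finrank_ker_le_of_injective _ _ (LinearMap.pi ![LinearMap.proj 2, LinearMap.proj 3,
    -LinearMap.proj 0, -LinearMap.proj 1]) ?_ ?_
  · rw [injective_iff_map_eq_zero]
    intro v hv
    have h0 : v 2 = 0 := congrFun hv 0
    have h1 : v 3 = 0 := congrFun hv 1
    have h2 : -v 0 = 0 := congrFun hv 2
    have h3 : -v 1 = 0 := congrFun hv 3
    funext i
    fin_cases i
    exacts [neg_eq_zero.1 h2, neg_eq_zero.1 h3, h0, h1]
  · intro v hv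
    rw [skew_mulVec_eq_zero] at hv ⊢
    obtain ⟨h0, h1, h2, h3⟩ := hv
    simp only [LinearMap.pi_apply, Matrix.cons_val, LinearMap.proj_apply, LinearMap.neg_apply,
      NegMemClass.coe_neg, Matrix.cons_val_zero, Matrix.cons_val_one]
    refine ⟨?_, ?_, ?_, ?_⟩
    · linear_combination h2
    · linear_combination h3
    · linear_combination -h0
    · linear_combination -h1

/-- The triple `b + c × a`. -/
def twist (a b : Fin 3 → C.F) (c : Fin 3 → ℂ) : Fin 3 → C.F :=
  ![b 0 + c 1 • a 2 - c 2 • a 1, b 1 + c 2 • a 0 - c 0 • a 2, b 2 + c 0 • a 1 - c 1 • a 0]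

theorem twist_mem (ha : ∀ i, a i ∈ C.H0 C.K) (hb : ∀ i, b i ∈ C.H0 C.K) (c : Fin 3 → ℂ) (i) :
    twist a b c i ∈ C.H0 C.K := by
  have h : ∀ i k l : Fin 3, ∀ s t : ℂ, b i + s • a k - t • a l ∈ C.H0 C.K := fun i k l s t =>
    sub_mem (add_mem (hb i) (Submodule.smul_mem _ _ (ha k))) (Submodule.smul_mem _ _ (ha l))
  fin_cases i
  exacts [h _ _ _ _ _, h _ _ _ _ _, h _ _ _ _ _]

theorem sum_mul_twist (h : a 0 * b 0 + a 1 * b 1 + a 2 * b 2 = 0) (c : Fin 3 → ℂ) :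
    a 0 * twist a b c 0 + a 1 * twist a b c 1 + a 2 * twist a b c 2 = 0 := by
  simp only [twist, Matrix.cons_val, Matrix.cons_val_zero, Matrix.cons_val_one, Algebra.smul_def]
  linear_combination h

theorem finrank_ker_skew_twist (ha : ∀ i, a i ∈ C.H0 C.K) (hb : ∀ i, b i ∈ C.H0 C.K)
    (c : Fin 3 → ℂ) (j : ℕ) :
    Module.finrank ℂ (LinearMap.ker (mulR (skew_mem ha (twist_mem ha hb c)) j)) ≤
      Module.finrank ℂ (LinearMap.ker (mulR (skew_mem ha hb) j)) := by
  refine finrank_ker_le_of_injective _ _ (LinearMap.pi ![LinearMap.proj 0,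
    LinearMap.proj 1 - c 0 • LinearMap.proj 0, LinearMap.proj 2 - c 1 • LinearMap.proj 0,
    LinearMap.proj 3 - c 2 • LinearMap.proj 0]) ?_ ?_
  · rw [injective_iff_map_eq_zero]
    intro v hv
    have h0 : v 0 = 0 := congrFun hv 0
    have h1 : v 1 - c 0 • v 0 = 0 := congrFun hv 1
    have h2 : v 2 - c 1 • v 0 = 0 := congrFun hv 2
    have h3 : v 3 - c 2 • v 0 = 0 := congrFun hv 3
    rw [h0, smul_zero, sub_zero] at h1 h2 h3
    funext i
    fin_cases i
    exacts [h0, h1, h2, h3]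
  · intro v hv
    rw [skew_mulVec_eq_zero] at hv ⊢
    obtain ⟨h0, h1, h2, h3⟩ := hv
    simp only [LinearMap.pi_apply, Matrix.cons_val, LinearMap.proj_apply, LinearMap.sub_apply,
      LinearMap.smul_apply, AddSubgroupClass.coe_sub, SetLike.val_smul,
      Matrix.cons_val_zero, Matrix.cons_val_one, twist, Algebra.smul_def] at h0 h1 h2 h3 ⊢
    refine ⟨?_, ?_, ?_, ?_⟩
    · linear_combination h0 + algebraMap ℂ C.F (c 0) * h1 + algebraMap ℂ C.F (c 1) * h2 +
        algebraMap ℂ C.F (c 2) * h3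
    · linear_combination h1
    · linear_combination h2
    · linear_combination h3

theorem finrank_ker_twist_skew (ha : ∀ i, a i ∈ C.H0 C.K) (hb : ∀ i, b i ∈ C.H0 C.K)
    (c : Fin 3 → ℂ) (j : ℕ) :
    Module.finrank ℂ (LinearMap.ker (mulR (skew_mem (twist_mem ha hb c) ha) j)) ≤
      Module.finrank ℂ (LinearMap.ker (mulR (skew_mem hb ha) j)) := by
  refine finrank_ker_le_of_injective _ _ (LinearMap.pi ![LinearMap.proj 0 +
    c 0 • LinearMap.proj 1 + c 1 • LinearMap.proj 2 + c 2 • LinearMap.proj 3,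
    LinearMap.proj 1, LinearMap.proj 2, LinearMap.proj 3]) ?_ ?_
  · rw [injective_iff_map_eq_zero]
    intro v hv
    have h0 : v 0 + c 0 • v 1 + c 1 • v 2 + c 2 • v 3 = 0 := congrFun hv 0
    have h1 : v 1 = 0 := congrFun hv 1
    have h2 : v 2 = 0 := congrFun hv 2
    have h3 : v 3 = 0 := congrFun hv 3
    rw [h1, h2, h3, smul_zero, smul_zero, smul_zero, add_zero, add_zero, add_zero] at h0
    funext i
    fin_cases i
    exacts [h0, h1, h2, h3]
  · intro v hv
    rw [skew_mulVec_eq_zero] at hv ⊢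
    obtain ⟨h0, h1, h2, h3⟩ := hv
    simp only [LinearMap.pi_apply, Matrix.cons_val, LinearMap.proj_apply, LinearMap.add_apply,
      LinearMap.smul_apply, Submodule.coe_add, SetLike.val_smul,
      Matrix.cons_val_zero, Matrix.cons_val_one, twist, Algebra.smul_def] at h0 h1 h2 h3 ⊢
    refine ⟨?_, ?_, ?_, ?_⟩
    · linear_combination h0
    · linear_combination h1 - algebraMap ℂ C.F (c 0) * h0
    · linear_combination h2 - algebraMap ℂ C.F (c 1) * h0
    · linear_combination h3 - algebraMap ℂ C.F (c 2) * h0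

end Curve

namespace GradedSystem
variable {k F : Type} [Field k] [Field F] [Algebra k F] {S : GradedSystem k F}
variable {M M' : Type} [AddCommGroup M] [Module F M] [AddCommGroup M'] [Module F M']

theorem Lin.of_map (i : ℕ) {P' : ℕ → AddSubgroup M'} {P : ℕ → AddSubgroup M}
    (j : M →ₗ[F] M') (hj : Injective j) (hm : ∀ n y, y ∈ P' n ↔ ∃ x ∈ P n, j x = y)
    (h : S.Lin i M' P') : S.Lin i M P := by
  have key : ∀ {ι : Type} [Fintype ι] {q : ι → M'}, S.MinGen q P' →
      ∃ p : ι → M, S.MinGen p P ∧ S.Syz p = S.Syz q := by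
    intro ι _ q hq
    choose p hp hpq using fun i => (hm 0 _).1 (hq.mem i)
    have hsum : ∀ z : ι → F, ∑ i, z i • q i = j (∑ i, z i • p i) := by
      intro z; simp [map_sum, hpq]
    refine ⟨p, ⟨fun n m => ?_, fun z hz hz0 => hq.indep z hz ?_⟩, ?_⟩
    · have h1 : m ∈ P n ↔ j m ∈ P' n := by
        rw [hm]
        refine ⟨fun h => ⟨m, h, rfl⟩, ?_⟩
        rintro ⟨x, hx, hxm⟩
        rwa [← hj hxm]
      rw [h1, hq.mem_iff]
      simp only [hsum, hj.eq_iff]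
    · rw [hsum, hz0, map_zero]
    · funext n
      ext z
      rw [mem_syz, mem_syz, hsum, map_eq_zero_iff j hj]
  cases i with
  | zero =>
    obtain ⟨ι, _, q, hq⟩ := h
    obtain ⟨p, hp, -⟩ := key hq
    exact ⟨ι, _, p, hp⟩
  | succ i =>
    obtain ⟨ι, _, q, hq, hq'⟩ := h
    obtain ⟨p, hp, hpq⟩ := key hq
    exact ⟨ι, _, p, hp, hpq ▸ hq'⟩

end GradedSystem

namespace Curve
open PreCurve
variable {C : Curve} {a b : Fin 3 → C.F}

/-- A pair of orthogonal triples of canonical sections such that the kernels of the associated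
skew-symmetric matrices have the smallest possible dimensions, and such that the first two
entries of `b` have no common zeros. -/
structure KoszulPair (a b : Fin 3 → C.F) : Prop where
  five_le_genus : 5 ≤ C.genus
  left_mem : ∀ i, a i ∈ C.H0 C.K
  right_mem : ∀ i, b i ∈ C.H0 C.K
  sum_mul : a 0 * b 0 + a 1 * b 1 + a 2 * b 2 = 0
  left_ne : a 2 ≠ 0
  right_ne_zero : b 0 ≠ 0
  right_ne_one : b 1 ≠ 0
  gcdDiv_eq : gcdDiv (b 0) (b 1) = -C.K
  ker_le : ∀ j, Module.finrank ℂ (LinearMap.ker (mulR (skew_mem left_mem right_mem) j)) ≤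
    kerDim C.genus j
  ker_le_swap : ∀ j, Module.finrank ℂ
    (LinearMap.ker (mulR (skew_mem right_mem left_mem) j)) ≤ kerDim C.genus j

namespace KoszulPair

theorem mem_H0 (h : KoszulPair a b) {f : C.F} {N : C.Div} (h0 : b 0 * f ∈ C.H0 (N + C.K))
    (h1 : b 1 * f ∈ C.H0 (N + C.K)) : f ∈ C.H0 N := by
  have := (mul_mem_and_iff h.right_ne_zero h.right_ne_one (N + C.K)).1 ⟨h0, h1⟩
  rwa [h.gcdDiv_eq, add_neg_cancel_right] at this

theorem two_le (h : KoszulPair a b) : 2 ≤ C.genus := le_trans (by norm_num) h.five_le_genus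

theorem exact (h : KoszulPair a b) (j : ℕ) :
    LinearMap.range (mulR (skew_mem h.left_mem h.right_mem) j) =
        LinearMap.ker (mulR (skew_mem h.right_mem h.left_mem) (j + 1)) ∧
      Module.finrank ℂ (LinearMap.ker (mulR (skew_mem h.left_mem h.right_mem) j)) =
        kerDim C.genus j :=
  range_mulR_eq _ _ (skew_mul_skew (by linear_combination h.sum_mul)) h.ker_le h.ker_le_swap
    (kerDim_add_le h.two_le) j

theorem exact_swap (h : KoszulPair a b) (j : ℕ) :
    LinearMap.range (mulR (skew_mem h.right_mem h.left_mem) j) =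
        LinearMap.ker (mulR (skew_mem h.left_mem h.right_mem) (j + 1)) ∧
      Module.finrank ℂ (LinearMap.ker (mulR (skew_mem h.right_mem h.left_mem) j)) =
        kerDim C.genus j :=
  range_mulR_eq _ _ (skew_mul_skew (by linear_combination h.sum_mul)) h.ker_le_swap h.ker_le
    (kerDim_add_le h.two_le) j

/-- The first coordinate of the element of the kernel of `skew a b` lying over a syzygy of `b`. -/
def lift (a b x : Fin 3 → C.F) : C.F := (b 0)⁻¹ * (a 2 * x 1 - a 1 * x 2)

theorem skew_mulVec_lift (h : KoszulPair a b) {x : Fin 3 → C.F}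
    (hx : b 0 * x 0 + b 1 * x 1 + b 2 * x 2 = 0) :
    (skew a b).mulVec ![lift a b x, x 0, x 1, x 2] = 0 := by
  have h0 := h.right_ne_zero
  have h1 := h.sum_mul
  rw [skew_mulVec_eq_zero]
  simp only [Matrix.cons_val, Matrix.cons_val_zero, Matrix.cons_val_one, lift]
  refine ⟨hx, ?_, ?_, ?_⟩
  · field_simp
  · field_simp
    linear_combination -a 2 * hx + x 2 * h1
  · field_simp
    linear_combination a 1 * hx - x 1 * h1

theorem lift_mem (h : KoszulPair a b) {x : Fin 3 → C.F} {j : ℕ}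
    (hx : b 0 * x 0 + b 1 * x 1 + b 2 * x 2 = 0) (hxm : ∀ i, x i ∈ C.H0 (j • C.K)) :
    lift a b x ∈ C.H0 (j • C.K) := by
  have h1 := h.skew_mulVec_lift hx
  rw [skew_mulVec_eq_zero] at h1
  obtain ⟨-, h1, h2, -⟩ := h1
  simp only [Matrix.cons_val, Matrix.cons_val_zero, Matrix.cons_val_one] at h1 h2
  have hm : ∀ i k l m, a i * x k - a l * x m ∈ C.H0 (j • C.K + C.K) := by
    intro i k l m
    rw [add_comm]
    exact sub_mem (mul_mem_H0 _ (h.left_mem i) (hxm k)) (mul_mem_H0 _ (h.left_mem l) (hxm m))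
  exact h.mem_H0 (h1 ▸ hm _ _ _ _) (h2 ▸ hm _ _ _ _)

/-- The map of which the syzygies of `b` are the kernel. -/
def sumMap (b : Fin 3 → C.F) (j : ℕ) : (Fin 3 → C.H0 (j • C.K)) →ₗ[ℂ] C.F :=
  ∑ i, LinearMap.mulLeft ℂ (b i) ∘ₗ (C.H0 (j • C.K)).subtype ∘ₗ LinearMap.proj i

theorem sumMap_apply (j : ℕ) (z : Fin 3 → C.H0 (j • C.K)) :
    sumMap b j z = b 0 * z 0 + b 1 * z 1 + b 2 * z 2 := by
  simp [sumMap, Fin.sum_univ_three]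

theorem finrank_ker_sumMap (h : KoszulPair a b) (j : ℕ) :
    Module.finrank ℂ (LinearMap.ker (sumMap b j)) = kerDim C.genus j := by
  rw [← (h.exact j).2]
  let T : (Fin 4 → C.H0 (j • C.K)) →ₗ[ℂ] (Fin 3 → C.H0 (j • C.K)) :=
    LinearMap.pi ![LinearMap.proj 1, LinearMap.proj 2, LinearMap.proj 3]
  have hT : ∀ v ∈ LinearMap.ker (mulR (skew_mem h.left_mem h.right_mem) j),
      T v ∈ LinearMap.ker (sumMap b j) := by
    intro v hv
    rw [mem_ker_mulR, skew_mulVec_eq_zero] at hv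
    rw [LinearMap.mem_ker, sumMap_apply]
    exact hv.1
  refine (LinearEquiv.ofBijective (T.restrict hT) ⟨?_, ?_⟩).finrank_eq.symm
  · rw [injective_iff_map_eq_zero]
    rintro ⟨v, hv⟩ hv0
    have h0 : T v = 0 := congrArg Subtype.val hv0
    have h1 : v 1 = 0 := congrFun h0 0
    have h2 : v 2 = 0 := congrFun h0 1
    have h3 : v 3 = 0 := congrFun h0 2
    rw [mem_ker_mulR, skew_mulVec_eq_zero] at hv
    obtain ⟨-, h4, -⟩ := hv
    rw [h2, h3, ZeroMemClass.coe_zero, mul_zero, mul_zero, sub_zero, eq_comm, mul_eq_zero] at h4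
    refine Subtype.ext (funext fun i => ?_)
    fin_cases i
    exacts [Subtype.ext (h4.resolve_left h.right_ne_zero), h1, h2, h3]
  · rintro ⟨x, hx⟩
    rw [LinearMap.mem_ker, sumMap_apply] at hx
    refine ⟨⟨![⟨lift a b fun i => x i, h.lift_mem hx fun i => (x i).2⟩, x 0, x 1, x 2], ?_⟩, ?_⟩
    · rw [mem_ker_mulR]
      convert h.skew_mulVec_lift (x := fun i => x i) hx using 2
      funext i
      fin_cases i <;> rfl
    · refine Subtype.ext (funext fun i => ?_)
      fin_cases i <;> rfl

theorem connectedOne : (C.RL C.K).ConnectedOne := by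
  have h1 : C.h0 0 = 1 := C.h0_triv
  have : FiniteDimensional ℂ ((C.RL C.K).piece 0) :=
    inferInstanceAs (FiniteDimensional ℂ (C.H0 (0 • C.K)))
  refine (Submodule.eq_of_le_of_finrank_le (Submodule.span_le.2 ?_) ?_).symm
  · rw [Set.singleton_subset_iff]
    exact (C.RL C.K).one_mem
  · rw [finrank_span_singleton one_ne_zero]
    change C.h0 (0 • C.K) ≤ 1
    rw [zero_nsmul, h1]

theorem linearIndependent (h : KoszulPair a b) : LinearIndependent ℂ b := by
  rw [Fintype.linearIndependent_iff]
  intro c hc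
  rw [Fin.sum_univ_three] at hc
  have hone : (1 : C.F) ∈ C.H0 (0 • C.K) := (C.RL C.K).one_mem
  have h1 : (fun i => c i • ⟨1, hone⟩ : Fin 3 → C.H0 (0 • C.K)) ∈ LinearMap.ker (sumMap b 0) := by
    rw [LinearMap.mem_ker, sumMap_apply, ← hc]
    simp
  have h2 : Module.finrank ℂ (LinearMap.ker (sumMap b 0)) = 0 := h.finrank_ker_sumMap 0
  rw [Submodule.finrank_eq_zero.1 h2, Submodule.mem_bot] at h1
  intro i
  have h3 : c i • (1 : C.F) = 0 := congrArg Subtype.val (congrFun h1 i)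
  exact (smul_eq_zero.1 h3).resolve_right one_ne_zero

theorem minGen (h : KoszulPair a b) :
    (C.RL C.K).MinGen b ((C.RL C.K).idl (Submodule.span ℂ (Set.range b))) := by
  have := GradedSystem.minGen_idl (connectedOne (C := C)) (Module.Basis.span h.linearIndependent)
  simpa only [Module.Basis.span_apply] using this

theorem mem_span_mul_iff (h : KoszulPair a b) {j : ℕ} {f : C.F} :
    f ∈ Submodule.span ℂ (Set.range b) * C.H0 (j • C.K) ↔
      ∃ z : Fin 3 → C.F, (∀ i, z i ∈ C.H0 (j • C.K)) ∧ b 0 * z 0 + b 1 * z 1 + b 2 * z 2 = f := by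
  refine (h.minGen.mem_iff j f).trans (exists_congr fun z => and_congr Iff.rfl ?_)
  rw [Fin.sum_univ_three, smul_eq_mul, smul_eq_mul, smul_eq_mul, mul_comm (z 0), mul_comm (z 1),
    mul_comm (z 2)]

theorem finrank_span_mul (h : KoszulPair a b) (j : ℕ) :
    Module.finrank ℂ (Submodule.span ℂ (Set.range b) * C.H0 (j • C.K) : Submodule ℂ C.F) +
      kerDim C.genus j = 3 * C.h0 (j • C.K) := by
  have h1 := LinearMap.finrank_range_add_finrank_ker (sumMap b j)
  have h2 : LinearMap.range (sumMap b j) = Submodule.span ℂ (Set.range b) * C.H0 (j • C.K) := by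
    ext f
    rw [h.mem_span_mul_iff]
    constructor
    · rintro ⟨z, rfl⟩
      exact ⟨fun i => z i, fun i => (z i).2, (sumMap_apply j z).symm⟩
    · rintro ⟨z, hz, rfl⟩
      exact ⟨fun i => ⟨z i, hz i⟩, sumMap_apply j _⟩
  have h3 : Module.finrank ℂ (Fin 3 → C.H0 (j • C.K)) = 3 * C.h0 (j • C.K) := by
    rw [Module.finrank_pi_fintype]
    simp [PreCurve.h0]
  rw [h2, h.finrank_ker_sumMap, h3] at h1
  exact h1

theorem lin_syz (h : KoszulPair a b) (i : ℕ) :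
    (C.RL C.K).Lin i (Fin 3 → C.F) ((C.RL C.K).Syz b) := by
  have h1 := minGen_cols (skew_mem h.left_mem h.right_mem) (skew_mem h.right_mem h.left_mem)
    (fun j => (h.exact j).1) (h.exact 0).2
  have h2 := minGen_cols (skew_mem h.right_mem h.left_mem) (skew_mem h.left_mem h.right_mem)
    (fun j => (h.exact_swap j).1) (h.exact_swap 0).2
  have h3 := (lin_syz_cols h1 h2 i).1
  let L : (Fin 3 → C.F) →ₗ[C.F] C.F :=
    (b 0)⁻¹ • (a 2 • LinearMap.proj 1 - a 1 • LinearMap.proj 2)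
  have hL : ∀ x, L x = lift a b x := fun x => rfl
  refine GradedSystem.Lin.of_map i
    (LinearMap.pi ![L, LinearMap.proj 0, LinearMap.proj 1, LinearMap.proj 2]) ?_ ?_ h3
  · rw [injective_iff_map_eq_zero]
    intro v hv
    have h0 : v 0 = 0 := congrFun hv 1
    have h1 : v 1 = 0 := congrFun hv 2
    have h2 : v 2 = 0 := congrFun hv 3
    funext i
    fin_cases i
    exacts [h0, h1, h2]
  · intro n y
    have hb : ∀ x : Fin 3 → C.F, ∑ i, x i • b i = b 0 * x 0 + b 1 * x 1 + b 2 * x 2 := by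
      intro x
      rw [Fin.sum_univ_three, smul_eq_mul, smul_eq_mul, smul_eq_mul]
      ring
    have hy : ∀ x : Fin 3 → C.F, (LinearMap.pi ![L, LinearMap.proj 0, LinearMap.proj 1,
        LinearMap.proj 2] : (Fin 3 → C.F) →ₗ[C.F] (Fin 4 → C.F)) x =
          ![lift a b x, x 0, x 1, x 2] := by
      intro x
      funext i
      fin_cases i <;> rfl
    simp only [GradedSystem.mem_syz, sum_smul_cols, hb, hy]
    constructor
    · rintro ⟨hm, h0⟩
      rw [skew_mulVec_eq_zero] at h0
      obtain ⟨h0, h1, -⟩ := h0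
      refine ⟨![y 1, y 2, y 3], ⟨fun i => ?_, h0⟩, ?_⟩
      · fin_cases i
        exacts [hm 1, hm 2, hm 3]
      · have h4 : lift a b ![y 1, y 2, y 3] = y 0 := by
          have := h.right_ne_zero
          simp only [lift, Matrix.cons_val, Matrix.cons_val_zero, Matrix.cons_val_one]
          rw [h1, inv_mul_cancel_left₀ this]
        rw [h4]
        funext i
        fin_cases i <;> rfl
    · rintro ⟨x, ⟨hm, h0⟩, rfl⟩
      refine ⟨fun i => ?_, h.skew_mulVec_lift h0⟩
      fin_cases i
      exacts [h.lift_mem h0 hm, hm 0, hm 1, hm 2]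

theorem lin_idl (h : KoszulPair a b) (i : ℕ) :
    (C.RL C.K).Lin i C.F ((C.RL C.K).idl (Submodule.span ℂ (Set.range b))) := by
  cases i with
  | zero => exact ⟨Fin 3, inferInstance, b, h.minGen⟩
  | succ i => exact ⟨Fin 3, inferInstance, b, h.minGen, h.lin_syz i⟩

theorem isKoszul (h : KoszulPair a b)
    (hnd : ∀ c ∈ C.H0 C.K, (∀ r ∈ C.H0 C.K, c * r ∈ Submodule.span ℂ (Set.range b) * C.H0 C.K) →
      c ∈ Submodule.span ℂ (Set.range b)) : (C.RL C.K).IsKoszul := by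
  have hf : ∀ n, FiniteDimensional ℂ ((C.RL C.K).piece n) := fun n =>
    inferInstanceAs (FiniteDimensional ℂ (C.H0 (n • C.K)))
  have hp1 : (C.RL C.K).piece 1 = C.H0 C.K := by
    change C.H0 (1 • C.K) = _
    rw [one_nsmul]
  refine GradedSystem.isKoszul_of_lin connectedOne
    (GradedSystem.lin_augmentation connectedOne (L₀ := Submodule.span ℂ (Set.range b))
      ?_ ?_ ?_ ?_ ?_ h.lin_idl)
  · rw [hp1, Submodule.span_le]
    rintro _ ⟨i, rfl⟩
    exact h.right_mem i
  · rw [hp1, finrank_span_eq_card h.linearIndependent, Fintype.card_fin]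
    change 3 + 2 ≤ C.h0 C.K
    rw [h0_K]
    exact h.five_le_genus
  · have h1 := h.finrank_span_mul 1
    have h2 := h0_nsmul_K h.two_le 0
    rw [h0_one_nsmul_K] at h1
    change C.h0 (2 • C.K) = Module.finrank ℂ
      (Submodule.span ℂ (Set.range b) * C.H0 (1 • C.K) : Submodule ℂ C.F) + 1
    have h3 : kerDim C.genus 1 = 4 := rfl
    have h4 := h.five_le_genus
    rw [h3] at h1
    rw [zero_add] at h2
    push_cast at h2
    omega
  · intro n
    change Submodule.span ℂ (Set.range b) * C.H0 ((n + 2) • C.K) = C.H0 ((n + 3) • C.K)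
    refine Submodule.eq_of_le_of_finrank_le ?_ ?_
    · rw [Submodule.mul_le]
      rintro x hx y hy
      have h1 : (n + 3) • C.K = C.K + (n + 2) • C.K := by rw [succ_nsmul, add_comm]
      rw [h1]
      refine mul_mem_H0 _ ?_ hy
      refine Submodule.span_le.2 ?_ hx
      rintro _ ⟨i, rfl⟩
      exact h.right_mem i
    · have h1 := h.finrank_span_mul (n + 2)
      have h2 := h0_nsmul_K h.two_le n
      have h3 := h0_nsmul_K h.two_le (n + 1)
      have h4 : kerDim C.genus (n + 2) = 4 * (n + 1) * (C.genus - 1) := rfl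
      rw [h4] at h1
      change C.h0 ((n + 1 + 2) • C.K) ≤ _
      have h5 := h.five_le_genus
      zify [show 1 ≤ C.genus by omega] at h1 ⊢
      push_cast at h3
      rw [h3]
      rw [h2] at h1
      linarith
  · rw [hp1]
    exact hnd

end KoszulPair
end Curve

namespace Curve
open PreCurve
variable {C : Curve}

theorem mem_H0_add_pt_K {Q : C.Point} {f : C.F} (hf : f ∈ C.H0 (C.K + C.pt Q)) : f ∈ C.H0 C.K := by
  have h1 := C.riemann_roch (C.K + C.pt Q)
  have h2 : C.h0 (C.K - (C.K + C.pt Q)) = 0 := by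
    refine h0_eq_zero ?_
    rw [PreCurve.deg_sub, deg_add, deg_pt]
    linarith
  rw [h2, deg_add, deg_pt, deg_K] at h1
  have h3 : C.h0 C.K = C.genus := h0_K
  have h4 : C.H0 C.K = C.H0 (C.K + C.pt Q) := by
    refine Submodule.eq_of_le_of_finrank_le (H0_le (le_add_of_nonneg_right (pt_nonneg Q))) ?_
    change C.h0 _ ≤ C.h0 _
    omega
  rwa [h4]

/-- A canonical section multiplying all quadratic differentials into the ideal generated by two
canonical sections without common zeros is a linear combination of them. -/
theorem mem_span_pair_of_mul_mem (hg : 2 ≤ C.genus) {x y a : C.F} (hx0 : x ≠ 0) (hy0 : y ≠ 0)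
    (hx : x ∈ C.H0 C.K) (hy : y ∈ C.H0 C.K) (hxy : gcdDiv x y = -C.K) (ha : a ∈ C.H0 C.K)
    (h : ∀ r ∈ C.H0 (2 • C.K), a * r ∈ Submodule.span ℂ {x, y} * C.H0 (2 • C.K)) :
    a ∈ Submodule.span ℂ {x, y} := by
  have hgZ : (2 : ℤ) ≤ C.genus := by exact_mod_cast hg
  obtain ⟨P, hP⟩ := exists_pt_le (C := C.toPreCurve) (D := C.divOf x + C.K)
    ((mem_H0_of_ne hx0).1 hx) (by
      intro h0
      have := congrArg C.deg h0
      rw [deg_add, deg_divOf hx0, deg_K, deg_zero] at this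
      linarith)
  have hxP : x ∈ C.H0 (C.K - C.pt P) := by
    rw [mem_H0_of_ne hx0]
    rw [← sub_nonneg] at hP
    convert hP using 1
    abel
  have hyP : y ∉ C.H0 (C.K - C.pt P) := by
    intro hyP
    have h1 := le_gcdDiv hx0 hy0 hxP hyP P
    rw [hxy] at h1
    simp [pt_self] at h1
  obtain ⟨c, hc⟩ := exists_sub_smul_mem hy hyP ha
  suffices h1 : a - c • y ∈ Submodule.span ℂ {x} by
    rw [← sub_add_cancel a (c • y)]
    exact add_mem (Submodule.span_mono (by simp) h1)
      (Submodule.smul_mem _ _ (Submodule.subset_span (by simp)))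
  by_contra h1
  set d := a - c • y with hd
  have hd0 : d ≠ 0 := by
    intro h0
    rw [h0] at h1
    exact h1 (zero_mem _)
  have hG := le_gcdDiv hx0 hd0 hxP hc
  have hGx : gcdDiv x d ≤ C.divOf x := inf_le_left
  have hGd : gcdDiv x d ≤ C.divOf d := inf_le_right
  obtain ⟨Q, hQ⟩ := exists_pt_le (C := C.toPreCurve) (D := C.divOf x - gcdDiv x d)
    (sub_nonneg.2 hGx) (by
      intro h0
      rw [sub_eq_zero] at h0
      rw [← h0] at hGd
      have h2 : d * x⁻¹ ∈ C.H0 0 := by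
        rw [mem_H0_of_ne (mul_ne_zero hd0 (inv_ne_zero hx0)), divOf_mul hd0 (inv_ne_zero hx0),
          divOf_inv hx0, add_zero, ← sub_eq_add_neg]
        exact sub_nonneg.2 hGd
      obtain ⟨e, he⟩ := isConst_of_mem le_rfl (le_of_eq C.h0_triv) h2
      apply h1
      rw [Submodule.mem_span_singleton]
      refine ⟨e, ?_⟩
      rw [Algebra.smul_def, he, inv_mul_cancel_right₀ hx0])
  have hdeg : 2 * C.genus - 1 ≤ C.deg (2 • C.K + gcdDiv x d) := by
    have h2 := deg_mono hG
    rw [deg_neg, PreCurve.deg_sub, deg_K, deg_pt] at h2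
    rw [deg_add, deg_nsmul, deg_K]
    push_cast
    linarith
  have h2 : C.h0 (2 • C.K + gcdDiv x d + C.pt Q) = C.h0 (2 • C.K + gcdDiv x d) + 1 := by
    have e1 : (C.h0 (2 • C.K + gcdDiv x d) : ℤ) = _ := h0_of_deg (by linarith)
    have e2 : (C.h0 (2 • C.K + gcdDiv x d + C.pt Q) : ℤ) = _ :=
      h0_of_deg (by rw [deg_add, deg_pt]; linarith)
    rw [deg_add _ (C.pt Q), deg_pt] at e2
    omega
  have h3 : ∃ r ∈ C.H0 (2 • C.K + gcdDiv x d + C.pt Q), r ∉ C.H0 (2 • C.K + gcdDiv x d) := by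
    by_contra! h3
    have : C.h0 _ ≤ C.h0 _ := Submodule.finrank_mono (R := ℂ) h3
    omega
  obtain ⟨r, hr, hr'⟩ := h3
  have hxr : x * r ∈ C.H0 (2 • C.K) := by
    rw [mul_mem_H0_iff hx0]
    refine H0_le ?_ hr
    rw [add_assoc]
    exact add_le_add_right (by rwa [le_sub_iff_add_le'] at hQ) _
  have hdr : d * r ∈ C.H0 (2 • C.K + C.pt Q) := by
    rw [mul_mem_H0_iff hd0]
    refine H0_le ?_ hr
    rw [add_right_comm]
    exact add_le_add_right hGd _
  obtain ⟨p, hp, q, hq, hpq⟩ := Submodule.mem_span_pair_mul.1 (h _ hxr)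
  have ht : (q - c • (x * r)) * x⁻¹ ∈ C.H0 C.K := by
    apply mem_H0_add_pt_K (Q := Q)
    have := (mul_mem_and_iff hx0 hy0 (2 • C.K + C.pt Q) (u := (q - c • (x * r)) * x⁻¹)).1 ⟨?_, ?_⟩
    · rw [hxy] at this
      convert this using 2
      rw [two_nsmul]; abel
    · rw [mul_comm, inv_mul_cancel_right₀ hx0]
      exact H0_le (le_add_of_nonneg_right (pt_nonneg Q))
        (sub_mem hq (Submodule.smul_mem _ _ hxr))
    · have : y * ((q - c • (x * r)) * x⁻¹) = d * r - p := by
        rw [hd]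
        simp only [Algebra.smul_def] at hpq ⊢
        field_simp
        linear_combination hpq
      rw [this]
      exact sub_mem hdr (H0_le (le_add_of_nonneg_right (pt_nonneg Q)) hp)
  have hdr' : d * r ∈ C.H0 (2 • C.K) := by
    have : d * r = y * ((q - c • (x * r)) * x⁻¹) + p := by
      rw [hd]
      simp only [Algebra.smul_def] at hpq ⊢
      field_simp
      linear_combination -hpq
    rw [this]
    refine add_mem ?_ hp
    rw [two_nsmul]
    exact mul_mem_H0 _ hy ht
  exact hr' ((mul_mem_and_iff hx0 hd0 _).1 ⟨hxr, hdr'⟩)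

theorem finrank_span_pair_mul {x y : C.F} (hx0 : x ≠ 0) (hy0 : y ≠ 0)
    (hxy : gcdDiv x y = -C.K) (D : C.Div) :
    Module.finrank ℂ (Submodule.span ℂ {x, y} * C.H0 D : Submodule ℂ C.F) + C.h0 (D - C.K) =
      2 * C.h0 D := by
  have h1 := finrank_pencil hx0 hy0 D
  rw [hxy, ← sub_eq_add_neg] at h1
  rw [Submodule.span_pair_mul]
  exact h1

theorem span_pair_mul_le {x y : C.F} (hx : x ∈ C.H0 C.K) (hy : y ∈ C.H0 C.K) (D : C.Div) :
    Submodule.span ℂ {x, y} * C.H0 D ≤ C.H0 (C.K + D) := by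
  rw [Submodule.mul_le]
  intro s hs t ht
  refine mul_mem_H0 _ (Submodule.span_le.2 ?_ hs) ht
  rintro _ (rfl | rfl)
  exacts [hx, hy]

/-- A quadratic differential multiplying all canonical sections into the ideal generated by two
canonical sections without common zeros belongs to this ideal. -/
theorem finrank_span_pair_le (x y : C.F) :
    Module.finrank ℂ (Submodule.span ℂ {x, y} : Submodule ℂ C.F) ≤ 2 := by
  have h := finrank_range_le_card (R := ℂ) ![x, y]
  rwa [Matrix.range_cons, Matrix.range_cons, Matrix.range_empty, Set.union_empty,
    Set.singleton_union] at h

theorem mem_span_pair_mul_of_mul_mem (hg : 2 ≤ C.genus) {x y s : C.F} (hx0 : x ≠ 0)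
    (hy0 : y ≠ 0) (hx : x ∈ C.H0 C.K) (hy : y ∈ C.H0 C.K) (hxy : gcdDiv x y = -C.K)
    (hs : s ∈ C.H0 (2 • C.K))
    (h : ∀ r ∈ C.H0 C.K, r * s ∈ Submodule.span ℂ {x, y} * C.H0 (2 • C.K)) :
    s ∈ Submodule.span ℂ {x, y} * C.H0 C.K := by
  have hgZ : (2 : ℤ) ≤ C.genus := by exact_mod_cast hg
  have r2 := h0_nsmul_K hg 0
  have r3 := h0_nsmul_K hg 1
  push_cast at r2 r3
  have hK : C.h0 C.K = C.genus := h0_K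
  set W := Submodule.span ℂ {x, y} * C.H0 (2 • C.K) with hW
  have hW3 : W ≤ C.H0 (3 • C.K) := by
    have := span_pair_mul_le hx hy (2 • C.K)
    rwa [← succ_nsmul' C.K 2] at this
  have hWf : FiniteDimensional ℂ W := Submodule.finiteDimensional_of_le hW3
  have hWd : Module.finrank ℂ W + C.genus = 2 * C.h0 (2 • C.K) := by
    have := finrank_span_pair_mul hx0 hy0 hxy (2 • C.K)
    rwa [two_nsmul, add_sub_cancel_right, hK, ← two_nsmul] at this
  obtain ⟨t, ht, htW⟩ : ∃ t ∈ C.H0 (3 • C.K), t ∉ W := by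
    by_contra! h3
    have : C.h0 _ ≤ Module.finrank ℂ W := Submodule.finrank_mono (R := ℂ) h3
    omega
  obtain ⟨φ, hφt, hφW⟩ := Submodule.exists_le_ker_of_notMem htW
  have hφ : ∀ f ∈ C.H0 (3 • C.K), φ f = 0 → f ∈ W := by
    have h1 : W = LinearMap.ker φ ⊓ C.H0 (3 • C.K) := by
      refine Submodule.eq_of_le_of_finrank_le (le_inf hφW hW3) ?_
      have h2 : LinearMap.ker φ ⊓ C.H0 (3 • C.K) < C.H0 (3 • C.K) := by
        refine lt_of_le_of_ne inf_le_right fun h2 => hφt ?_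
        rw [← h2] at ht
        exact ht.1
      have h3 : _ < C.h0 _ := Submodule.finrank_lt_finrank_of_lt h2
      omega
    intro f hf hf0
    rw [h1]
    exact ⟨hf0, hf⟩
  let B : C.H0 C.K →ₗ[ℂ] Module.Dual ℂ (C.H0 (2 • C.K)) :=
    ((LinearMap.mul ℂ C.F).compr₂ φ).domRestrict₁₂ (C.H0 C.K) (C.H0 (2 • C.K))
  have hB : ∀ a r, B a r = φ (a * r) := fun a r => rfl
  have hmul : ∀ (a : C.H0 C.K) (r : C.H0 (2 • C.K)),
      (a : C.F) * r ∈ C.H0 (3 • C.K) := by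
    intro a r
    have := mul_mem_H0 _ a.2 r.2
    rwa [← succ_nsmul' C.K 2] at this
  have hker : Module.finrank ℂ (LinearMap.ker B) ≤ 2 := by
    have h1 : (LinearMap.ker B).map (C.H0 C.K).subtype ≤ Submodule.span ℂ {x, y} := by
      rintro _ ⟨a, ha, rfl⟩
      refine mem_span_pair_of_mul_mem hg hx0 hy0 hx hy hxy a.2 fun r hr => ?_
      exact hφ _ (hmul a ⟨r, hr⟩) (LinearMap.congr_fun ha ⟨r, hr⟩)
    have hsf : FiniteDimensional ℂ (Submodule.span ℂ {x, y} : Submodule ℂ C.F) :=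
      FiniteDimensional.span_of_finite ℂ (Set.toFinite {x, y})
    have h2 := Submodule.finrank_mono h1
    have h3 : Module.finrank ℂ (Submodule.span ℂ {x, y} : Submodule ℂ C.F) ≤ 2 :=
      (finrank_span_pair_le x y)
    rw [Submodule.finrank_map_subtype_eq] at h2
    exact h2.trans h3
  have hrange := LinearMap.finrank_range_add_finrank_ker B
  have hco := Subspace.finrank_add_finrank_dualCoannihilator_eq (LinearMap.range B)
  have hmem : ∀ r : C.H0 (2 • C.K), r ∈ (LinearMap.range B).dualCoannihilator ↔
      ∀ a : C.H0 C.K, φ (a * r) = 0 := by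
    intro r
    rw [Submodule.mem_dualCoannihilator]
    exact ⟨fun h a => h _ ⟨a, rfl⟩, by rintro h _ ⟨a, rfl⟩; exact h a⟩
  have hle : Submodule.span ℂ {x, y} * C.H0 C.K ≤
      (LinearMap.range B).dualCoannihilator.map (C.H0 (2 • C.K)).subtype := by
    intro f hf
    have hf2 := span_pair_mul_le hx hy C.K hf
    rw [← two_nsmul] at hf2
    refine ⟨⟨f, hf2⟩, (hmem _).2 fun a => hφW ?_, rfl⟩
    change (a : C.F) * f ∈ W
    rw [hW, two_nsmul]
    obtain ⟨u, hu, v, hv, rfl⟩ := Submodule.mem_span_pair_mul.1 hf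
    exact Submodule.mem_span_pair_mul.2 ⟨a * u, mul_mem_H0 _ a.2 hu, a * v, mul_mem_H0 _ a.2 hv,
      by ring⟩
  have hdim := finrank_span_pair_mul hx0 hy0 hxy C.K
  rw [sub_self, show C.h0 0 = 1 from C.h0_triv] at hdim
  have heq := Submodule.eq_of_le_of_finrank_le hle (by
    rw [Submodule.finrank_map_subtype_eq]
    change _ + _ = C.h0 _ at hrange
    change _ + _ = C.h0 _ at hco
    omega)
  rw [heq]
  exact ⟨⟨s, hs⟩, (hmem _).2 fun a => hφW (h a a.2), rfl⟩

namespace KoszulPair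
variable {a b : Fin 3 → C.F}

theorem mem_span (h : KoszulPair a b) {c : C.F} (hc : c ∈ C.H0 C.K)
    (hcr : ∀ r ∈ C.H0 C.K, c * r ∈ Submodule.span ℂ (Set.range b) * C.H0 C.K) :
    c ∈ Submodule.span ℂ (Set.range b) := by
  have hmul : ∀ {f g : C.F}, f ∈ C.H0 C.K → g ∈ C.H0 C.K → f * g ∈ C.H0 (2 • C.K) := by
    intro f g hf hg
    rw [two_nsmul]
    exact mul_mem_H0 _ hf hg
  have ha := h.left_mem
  have hb := h.right_mem
  have hab := h.sum_mul
  have ha2 := h.left_ne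
  have h1 : c * a 2 ∈ Submodule.span ℂ {b 0, b 1} * C.H0 C.K := by
    refine mem_span_pair_mul_of_mul_mem h.two_le h.right_ne_zero h.right_ne_one (hb 0) (hb 1)
      h.gcdDiv_eq (hmul hc (ha 2)) fun r hr => ?_
    have h2 := hcr r hr
    rw [← one_nsmul C.K, h.mem_span_mul_iff, one_nsmul] at h2
    obtain ⟨z, hz, hzc⟩ := h2
    refine Submodule.mem_span_pair_mul.2 ⟨a 2 * z 0 - a 0 * z 2,
      sub_mem (hmul (ha 2) (hz 0)) (hmul (ha 0) (hz 2)), a 2 * z 1 - a 1 * z 2,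
      sub_mem (hmul (ha 2) (hz 1)) (hmul (ha 1) (hz 2)), ?_⟩
    linear_combination a 2 * hzc - z 2 * hab
  obtain ⟨p, hp, q, hq, hpq⟩ := Submodule.mem_span_pair_mul.1 h1
  have hker : (skew b a).mulVec ![c, q, -p, (a 1 * p - a 0 * q) / a 2] = 0 := by
    rw [skew_mulVec_eq_zero]
    simp only [Matrix.cons_val, Matrix.cons_val_zero, Matrix.cons_val_one]
    refine ⟨?_, ?_, ?_, ?_⟩
    · field_simp
      ring
    · field_simp
      linear_combination a 0 * hpq - p * hab
    · field_simp
      linear_combination a 1 * hpq - q * hab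
    · linear_combination hpq
  have hz : (a 1 * p - a 0 * q) / a 2 ∈ C.H0 C.K := by
    have h2 := skew_mulVec_eq_zero.1 hker
    simp only [Matrix.cons_val, Matrix.cons_val_zero, Matrix.cons_val_one] at h2
    obtain ⟨-, h3, h4, -⟩ := h2
    refine h.mem_H0 ?_ ?_ <;> rw [← two_nsmul]
    · rw [sub_eq_iff_eq_add.1 h4]
      exact add_mem (hmul (ha 1) hc) (hmul (hb 2) hq)
    · rw [← sub_sub_cancel (b 2 * -p) (b 1 * _), h3]
      exact sub_mem (hmul (hb 2) (neg_mem hp)) (hmul (ha 0) hc)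
  have hv : ∀ i, ![c, q, -p, (a 1 * p - a 0 * q) / a 2] i ∈ C.H0 ((0 + 1) • C.K) := by
    rw [zero_add, one_nsmul]
    intro i
    fin_cases i
    exacts [hc, hq, neg_mem hp, hz]
  have h3 : (fun i => ⟨_, hv i⟩ : Fin 4 → C.H0 ((0 + 1) • C.K)) ∈
      LinearMap.ker (mulR (skew_mem h.right_mem h.left_mem) (0 + 1)) :=
    (mem_ker_mulR _).2 hker
  rw [← (h.exact 0).1] at h3
  obtain ⟨v, hv'⟩ := h3
  have h4 : (skew a b).mulVec (fun k => (v k : C.F)) 0 = c := congrArg Subtype.val (congrFun hv' 0)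
  rw [← GradedSystem.piece_zero_mul (connectedOne (C := C)) (Submodule.span ℂ (Set.range b))]
  refine h.mem_span_mul_iff.2 ⟨![v 1, v 2, v 3], fun i => ?_, ?_⟩
  · fin_cases i
    exacts [(v 1).2, (v 2).2, (v 3).2]
  · rw [← h4]
    simp [skew, Matrix.mulVec, dotProduct, Fin.sum_univ_four]

theorem isKoszul_RL (h : KoszulPair a b) : (C.RL C.K).IsKoszul :=
  h.isKoszul fun _ hc hcr => h.mem_span hc hcr

end KoszulPair
end Curve

theorem Submodule.subsingleton_add_smul_mem {k W : Type*} [Field k] [AddCommGroup W] [Module k W]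
    (V : Submodule k W) {f g : W} (h : f ∈ V → g ∉ V) :
    {c : k | f + c • g ∈ V}.Subsingleton := by
  intro c hc d hd
  rw [Set.mem_ofPred_eq] at hc hd
  by_contra hcd
  have h1 : (c - d) • g ∈ V := by
    have := V.sub_mem hc hd
    rwa [add_sub_add_left_eq_sub, ← sub_smul] at this
  have h2 := (V.smul_mem_iff (sub_ne_zero.2 hcd)).1 h1
  exact h ((V.add_mem_iff_left (V.smul_mem c h2)).1 hc) h2

theorem Submodule.finite_exists_add_smul_mem {k W ι : Type*} [Field k] [AddCommGroup W] [Module k W]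
    {T : Set ι} (hT : T.Finite) (V : ι → Submodule k W) {f g : W}
    (h : ∀ t ∈ T, f ∈ V t → g ∉ V t) : {c : k | ∃ t ∈ T, f + c • g ∈ V t}.Finite := by
  have : {c : k | ∃ t ∈ T, f + c • g ∈ V t} = ⋃ t ∈ T, {c : k | f + c • g ∈ V t} := by
    ext c
    simp
  rw [this]
  exact hT.biUnion fun t ht => ((V t).subsingleton_add_smul_mem (h t ht)).finite

namespace Curve
open PreCurve
variable {C : Curve}

theorem mem_van_of_mul_mem {P : C.Point} {f g : C.F} {m n : ℤ} (hg : g ∉ C.van P (n + 1))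
    (h : f * g ∈ C.van P (m + n)) : f ∈ C.van P m := by
  have hg0 : g ≠ 0 := fun h0 => hg (h0 ▸ zero_mem _)
  rcases eq_or_ne f 0 with rfl | hf
  · exact zero_mem _
  rw [mem_van_of_ne hg0] at hg
  rw [mem_van_of_ne (mul_ne_zero hf hg0), C.ord_mul P f g hf hg0] at h
  rw [mem_van_of_ne hf]
  omega

/-- Two sections without common zeros. -/
theorem gcdDiv_eq_neg {x y : C.F} (hx0 : x ≠ 0) (hy0 : y ≠ 0) {D : C.Div} (hx : x ∈ C.H0 D)
    (hy : y ∈ C.H0 D) (h : ∀ Q, x ∈ C.van Q (1 - D Q) → y ∉ C.van Q (1 - D Q)) :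
    gcdDiv x y = - D := by
  by_contra hne
  obtain ⟨Q, hQ⟩ := exists_pt_le (sub_nonneg.2 (le_gcdDiv hx0 hy0 hx hy)) (sub_ne_zero.2 hne)
  have h1 := mem_H0_of_le_gcdDiv hx0 hy0 (D := D - C.pt Q) (by
    rw [neg_sub, sub_eq_add_neg]; exact le_sub_iff_add_le.1 hQ)
  exact h Q (mem_H0_sub_pt.1 h1.1).2 (mem_H0_sub_pt.1 h1.2).2

section points
variable {n : ℕ} {p : Fin n → C.Point}

theorem sum_pt_apply (hp : Injective p) (B : Finset (Fin n)) (i : Fin n) :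
    (∑ r ∈ B, C.pt (p r)) (p i) = if i ∈ B then 1 else 0 := by
  classical
  rw [Finsupp.finsetSum_apply]
  split_ifs with h
  · rw [Finset.sum_eq_single_of_mem i h fun r _ hr => pt_ne (hp.ne hr), pt_self]
  · exact Finset.sum_eq_zero fun r hr => pt_ne (hp.ne (ne_of_mem_of_not_mem hr h))

theorem sum_pt_apply_of_notMem {Q : C.Point} (hQ : ∀ i, p i ≠ Q) (B : Finset (Fin n)) :
    (∑ r ∈ B, C.pt (p r)) Q = 0 := by
  rw [Finsupp.finsetSum_apply]
  exact Finset.sum_eq_zero fun r _ => pt_ne (hQ r)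

theorem sub_sum_add_pt (K : C.Div) (i : Fin n) : K - ∑ r, C.pt (p r) + C.pt (p i) =
    K - ∑ r ∈ Finset.univ.erase i, C.pt (p r) := by
  rw [← Finset.add_sum_erase _ _ (Finset.mem_univ i)]
  abel

theorem skewPair_of_points (hp : Injective p) {i : Fin n} {a b : Fin 3 → C.F} (h0 : a 0 ≠ 0)
    (h2 : a 2 ≠ 0) (ha0 : a 0 ∈ C.H0 (C.K - ∑ r, C.pt (p r)))
    (ha2 : a 2 ∈ C.H0 (C.K - ∑ r, C.pt (p r)))
    (hgcd : gcdDiv (a 0) (a 2) = -(C.K - ∑ r, C.pt (p r)))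
    (ha1 : a 1 ∈ C.H0 (C.K - ∑ r, C.pt (p r) + C.pt (p i)))
    (ha1' : a 1 ∉ C.H0 (C.K - ∑ r, C.pt (p r)))
    (hb : ∀ s, s ≠ i → ∃ k, b k ∉ C.van (p s) (1 - C.K (p s))) :
    SkewPair a b (∑ r ∈ Finset.univ.erase i, C.pt (p r)) where
  left_mem k := by
    rw [← sub_sum_add_pt]
    have h : ∀ f ∈ C.H0 (C.K - ∑ r, C.pt (p r)),
        f ∈ C.H0 (C.K - ∑ r, C.pt (p r) + C.pt (p i)) :=
      H0_le (le_add_of_nonneg_right (pt_nonneg _))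
    fin_cases k
    exacts [h _ ha0, ha1, h _ ha2]
  left_ne := h2
  left_sat f N hf := by
    have h1 := (mul_mem_and_iff h0 h2 (N + C.K)).1
      ⟨by rw [mul_comm]; exact hf 0, by rw [mul_comm]; exact hf 2⟩
    rw [hgcd, ← Finset.sum_erase_add _ _ (Finset.mem_univ i),
      show ∀ A B : C.Div, N + C.K + -(C.K - (A + B)) = N + A + B by intro A B; abel] at h1
    rw [← add_sub_cancel_right (N + _) (C.pt (p i)), mem_H0_sub_pt]
    refine ⟨h1, mem_van_of_mul_mem (g := a 1) (n := - C.K (p i)) (fun h => ha1' ?_) ?_⟩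
    · rw [← add_sub_cancel_right (C.K - _) (C.pt (p i)), mem_H0_sub_pt]
      refine ⟨ha1, ?_⟩
      rw [Finsupp.add_apply, Finsupp.sub_apply, sum_pt_apply hp, pt_self,
        if_pos (Finset.mem_univ i)]
      rwa [sub_add_cancel, sub_eq_neg_add]
    · have h3 := mem_H0'.1 (hf 1) (p i)
      rw [Finsupp.add_apply, Finsupp.add_apply, sum_pt_apply hp, pt_self,
        if_neg (Finset.notMem_erase _ _)]
      rw [Finsupp.add_apply] at h3
      convert h3 using 2
      ring
  right_sat f N hf h := by
    rw [mem_H0_sub_sum hp]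
    refine ⟨hf, fun s hs => ?_⟩
    obtain ⟨k, hk⟩ := hb s (Finset.ne_of_mem_erase hs)
    refine mem_van_of_mul_mem (g := b k) (n := - C.K (p s)) (by rwa [← sub_eq_neg_add]) ?_
    have h3 := mem_H0'.1 (h k) (p s)
    rw [Finsupp.sub_apply, Finsupp.add_apply, sum_pt_apply hp, if_pos hs] at h3
    convert h3 using 2
    ring

theorem finrank_ker_le_of_points (hn : n + 2 = C.genus) (hg : 4 ≤ C.genus) (hG : GenPos p)
    {i : Fin n} {a b : Fin 3 → C.F}
    (h : SkewPair a b (∑ r ∈ Finset.univ.erase i, C.pt (p r)))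
    (hM : ∀ i k, skew a b i k ∈ C.H0 C.K) (j : ℕ) :
    Module.finrank ℂ (LinearMap.ker (mulR hM j)) ≤ kerDim C.genus j := by
  refine h.finrank_ker_le_kerDim hg (hG.h0_of_le (by simpa using hn) ?_ ?_) ?_ hM j
  · exact Finset.sum_nonneg fun r _ => pt_nonneg _
  · exact Finset.sum_le_univ_sum_of_nonneg fun r => pt_nonneg _
  · rw [deg_sum]
    simp only [deg_pt, Finset.sum_const, nsmul_eq_mul, mul_one,
      Finset.card_erase_of_mem (Finset.mem_univ i), Finset.card_univ, Fintype.card_fin]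
    omega

theorem GenPos.exists_mem_add_pt (hn : n + 2 = C.genus) (hG : GenPos p) (i : Fin n) :
    ∃ w ∈ C.H0 (C.K - ∑ r, C.pt (p r) + C.pt (p i)), w ∉ C.H0 (C.K - ∑ r, C.pt (p r)) := by
  by_contra! h
  have h1 : C.h0 _ ≤ C.h0 _ := Submodule.finrank_mono (R := ℂ) h
  have h2 := hG.h0_add_sum hn {i}
  rw [Finset.sum_singleton, Finset.card_singleton] at h2
  rw [h2, hG.1] at h1
  omega

/-- The product of two sections `u` and `v`, each vanishing at all but one of the points, in
terms of a pencil whose second coefficient does not vanish at the remaining points. -/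
theorem GenPos.exists_mul_eq (hn : n + 2 = C.genus) (hG : GenPos p) {i j : Fin n} (hij : i ≠ j)
    (hbad : ∀ k, i ≠ k → j ≠ k → ¬ Bad p i j k) {u v : C.F}
    (hu : u ∈ C.H0 (C.K - ∑ r, C.pt (p r) + C.pt (p i)))
    (hu' : u ∉ C.H0 (C.K - ∑ r, C.pt (p r)))
    (hv : v ∈ C.H0 (C.K - ∑ r, C.pt (p r) + C.pt (p j)))
    (hv' : v ∉ C.H0 (C.K - ∑ r, C.pt (p r))) :
    ∃ x y l m : C.F, LinearIndependent ℂ ![x, y] ∧ x ∈ C.H0 (C.K - ∑ r, C.pt (p r)) ∧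
      y ∈ C.H0 (C.K - ∑ r, C.pt (p r)) ∧ l ∈ C.H0 C.K ∧ m ∈ C.H0 C.K ∧ x * l + y * m = u * v ∧
      ∀ k, i ≠ k → j ≠ k → m ∉ C.van (p k) (1 - C.K (p k)) := by
  obtain ⟨x, y, hx, hy, hxy⟩ := exists_pair hG.1
  have huv : u * v ∈ Submodule.span ℂ {x, y} * C.H0 C.K := by
    rw [GenPos.mul_H0_K (by simpa using hn) hG hxy hx hy]
    refine H0_le ?_ (mul_mem_H0 _ hu hv)
    have := pt_add_pt_le_sum p hij
    rw [← sub_nonneg] at this ⊢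
    convert this using 1
    abel
  obtain ⟨l, hl, m, hm, hlm⟩ := Submodule.mem_span_pair_mul.1 huv
  obtain ⟨c, hc⟩ := (Submodule.finite_exists_add_smul_mem (Set.toFinite {k | i ≠ k ∧ j ≠ k})
    (fun k => C.van (p k) (1 - C.K (p k))) (f := m) (g := l) (fun k hk hmk hlk =>
      hbad k hk.1 hk.2 ((bad_iff hk.1 hk.2 hu hu' hv hv').2 (hlm ▸ add_mem
        (Submodule.mul_mem_mul hx (mem_H0_sub_pt.2 ⟨hl, hlk⟩))
        (Submodule.mul_mem_mul hy (mem_H0_sub_pt.2 ⟨hm, hmk⟩)))))).infinite_compl.nonempty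
  refine ⟨x - c • y, y, l, m + c • l, ?_, sub_mem hx (Submodule.smul_mem _ _ hy), hy, hl,
    add_mem hm (Submodule.smul_mem _ _ hl), ?_, fun k hik hjk hk => hc ⟨k, ⟨hik, hjk⟩, hk⟩⟩
  · rw [LinearIndependent.pair_iff] at hxy ⊢
    intro s t hst
    have h := hxy s (t - s * c) (by rw [← hst]; module)
    refine ⟨h.1, ?_⟩
    have h2 := h.2
    rwa [h.1, zero_mul, sub_zero] at h2
  · rw [← hlm]
    simp only [Algebra.smul_def]
    ring

theorem GenPos.exists_koszulPair (hn : n + 2 = C.genus) (hp : Injective p) (hG : GenPos p)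
    {i j : Fin n} (hij : i ≠ j) (h5 : 5 ≤ C.genus)
    (hbad : ∀ k, i ≠ k → j ≠ k → ¬ Bad p i j k) : ∃ a b : Fin 3 → C.F, KoszulPair a b := by
  obtain ⟨u, hu, hu'⟩ := hG.exists_mem_add_pt hn i
  obtain ⟨v, hv, hv'⟩ := hG.exists_mem_add_pt hn j
  obtain ⟨x, y, l, m, hxy, hx, hy, hl, hm, huv, hmk⟩ :=
    hG.exists_mul_eq hn hij hbad hu hu' hv hv'
  have hx0 : x ≠ 0 := hxy.ne_zero 0
  have hy0 : y ≠ 0 := hxy.ne_zero 1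
  have hgcd : gcdDiv y x = -(C.K - ∑ r, C.pt (p r)) :=
    gcdDiv_of_bpf ((LinearIndependent.pair_symm_iff).1 hxy) hy hx hG.1 hG.2
  -- values at the chosen points
  have hMp : ∀ s, (C.K - ∑ r, C.pt (p r)) (p s) = C.K (p s) - 1 := fun s => by
    rw [Finsupp.sub_apply, sum_pt_apply hp, if_pos (Finset.mem_univ s)]
  have hvan : ∀ f ∈ C.H0 (C.K - ∑ r, C.pt (p r)), ∀ s, f ∈ C.van (p s) (1 - C.K (p s)) := by
    intro f hf s
    have h := mem_H0'.1 hf (p s)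
    rwa [hMp, neg_sub] at h
  have hne : ∀ s, ∀ f ∈ C.H0 (C.K - ∑ r, C.pt (p r) + C.pt (p s)),
      f ∉ C.H0 (C.K - ∑ r, C.pt (p r)) → f ∉ C.van (p s) (1 - C.K (p s)) := by
    intro s f hf hf' h
    refine hf' ?_
    rw [← add_sub_cancel_right (C.K - _) (C.pt (p s)), mem_H0_sub_pt]
    refine ⟨hf, ?_⟩
    rwa [Finsupp.add_apply, hMp, pt_self, sub_add_cancel]
  have hvan' : ∀ s t, s ≠ t → ∀ f ∈ C.H0 (C.K - ∑ r, C.pt (p r) + C.pt (p s)),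
      f ∈ C.van (p t) (1 - C.K (p t)) := by
    intro s t hst f hf
    have h := mem_H0'.1 hf (p t)
    rwa [Finsupp.add_apply, hMp, pt_ne (hp.ne hst), add_zero, neg_sub] at h
  have hoff : ∀ Q, (∀ r, p r ≠ Q) → (C.K - ∑ r, C.pt (p r)) Q = C.K Q := fun Q hQ => by
    rw [Finsupp.sub_apply, sum_pt_apply_of_notMem hQ, sub_zero]
  have hMK : ∀ f ∈ C.H0 (C.K - ∑ r, C.pt (p r)), f ∈ C.H0 C.K :=
    H0_le (sub_le_self _ (sum_pt_nonneg p))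
  have hMK' : ∀ s, ∀ f ∈ C.H0 (C.K - ∑ r, C.pt (p r) + C.pt (p s)), f ∈ C.H0 C.K := fun s =>
    H0_le (by rw [sub_add, sub_le_self_iff, sub_nonneg]; exact pt_le_sum p s)
  have hcop : ∀ Q, x ∈ C.van Q (1 - (C.K - ∑ r, C.pt (p r)) Q) →
      y ∉ C.van Q (1 - (C.K - ∑ r, C.pt (p r)) Q) := by
    intro Q h1 h2
    have h3 := le_gcdDiv hy0 hx0 (mem_H0_sub_pt.2 ⟨hy, h2⟩) (mem_H0_sub_pt.2 ⟨hx, h1⟩)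
    rw [hgcd, neg_le_neg_iff] at h3
    have h4 := deg_mono h3
    rw [PreCurve.deg_sub _ (C.pt Q), deg_pt] at h4
    omega
  -- the choice of the parameters
  have hmγ : {c : ℂ | m + c • -u ∈ C.van (p i) (1 - C.K (p i))}.Finite :=
    (Submodule.subsingleton_add_smul_mem _ fun _ h =>
      hne i u hu hu' ((Submodule.neg_mem_iff _).1 h)).finite
  have hvγ := Submodule.finite_exists_add_smul_mem (f := -v) (g := y)
    ((finite_section_zeros (C.K - ∑ r, C.pt (p r)) hx0).inter_of_left {Q | ∀ r, p r ≠ Q})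
    (fun Q => C.van Q (1 - C.K Q)) (fun Q hQ _ h => hcop Q hQ.1 (by rwa [hoff Q hQ.2]))
  obtain ⟨γ, hγ⟩ := (hmγ.union hvγ).infinite_compl.nonempty
  simp only [Set.mem_compl_iff, Set.mem_union, not_or] at hγ
  obtain ⟨hγi, hγQ⟩ := hγ
  have hd : -v + γ • y ∉ C.van (p j) (1 - C.K (p j)) := fun h => hne j v hv hv' <| by
    rw [← Submodule.neg_mem_iff]
    exact (Submodule.add_mem_iff_left _ (Submodule.smul_mem _ _ (hvan y hy j))).1 h
  have hd0 : -v + γ • y ≠ 0 := fun h => hd (h ▸ zero_mem _)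
  have hc := Submodule.finite_exists_add_smul_mem (f := m + γ • -u) (g := x)
    ((finite_section_zeros C.K hd0).inter_of_left {Q | ∀ r, p r ≠ Q})
    (fun Q => C.van Q (1 - C.K Q))
    (fun Q hQ _ h => hγQ ⟨Q, ⟨by rwa [Set.mem_ofPred_eq, hoff Q hQ.2], hQ.2⟩, hQ.1⟩)
  obtain ⟨κ, hκ⟩ := hc.infinite_compl.nonempty
  have he : m + γ • -u + κ • x ∉ C.van (p i) (1 - C.K (p i)) := fun h => hγi <|
    (Submodule.add_mem_iff_left _ (Submodule.smul_mem _ _ (hvan x hx i))).1 h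
  have he0 : m + γ • -u + κ • x ≠ 0 := fun h => he (h ▸ zero_mem _)
  have hcommon : ∀ Q, m + γ • -u + κ • x ∈ C.van Q (1 - C.K Q) →
      -v + γ • y ∉ C.van Q (1 - C.K Q) := by
    intro Q h1 h2
    by_cases hQ : ∀ r, p r ≠ Q
    · exact hκ ⟨Q, ⟨h2, hQ⟩, h1⟩
    · push Not at hQ
      obtain ⟨s, rfl⟩ := hQ
      by_cases his : i = s
      · exact he (his ▸ h1)
      by_cases hjs : j = s
      · exact hd (hjs ▸ h2)
      refine hmk s his hjs ?_
      have h3 := (Submodule.add_mem_iff_left _ (Submodule.smul_mem _ _ (hvan x hx s))).1 h1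
      exact (Submodule.add_mem_iff_left _
        (Submodule.smul_mem _ _ (neg_mem (hvan' i s his u hu)))).1 h3
  -- the two triples
  have ha : ∀ k, ![y, u, x] k ∈ C.H0 C.K := by
    intro k
    fin_cases k
    exacts [hMK y hy, hMK' i u hu, hMK x hx]
  have hb : ∀ k, ![m, -v, l] k ∈ C.H0 C.K := by
    intro k
    fin_cases k
    exacts [hm, neg_mem (hMK' j v hv), hl]
  have hab : ![y, u, x] 0 * ![m, -v, l] 0 + ![y, u, x] 1 * ![m, -v, l] 1 +
      ![y, u, x] 2 * ![m, -v, l] 2 = 0 := by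
    simp only [Matrix.cons_val, Matrix.cons_val_zero, Matrix.cons_val_one]
    linear_combination huv
  have hpair : SkewPair ![y, u, x] ![m, -v, l] (∑ r ∈ Finset.univ.erase i, C.pt (p r)) := by
    refine skewPair_of_points hp hy0 hx0 hy hx hgcd hu hu' fun s hs => ?_
    by_cases hjs : j = s
    · exact ⟨1, fun h => hne j v hv hv' (hjs ▸ (Submodule.neg_mem_iff _).1 h)⟩
    · exact ⟨0, hmk s hs.symm hjs⟩
  have hpair' : SkewPair ![y, -v, x] ![m, u, l] (∑ r ∈ Finset.univ.erase j, C.pt (p r)) := by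
    refine skewPair_of_points hp hy0 hx0 hy hx hgcd (neg_mem hv)
      (fun h => hv' ((Submodule.neg_mem_iff _).1 h)) fun s hs => ?_
    by_cases his : i = s
    · exact ⟨1, fun h => hne i u hu hu' (his ▸ h)⟩
    · exact ⟨0, hmk s his hs.symm⟩
  have ha' : ∀ k, ![y, -v, x] k ∈ C.H0 C.K := by
    intro k
    fin_cases k
    exacts [ha 0, hb 1, ha 2]
  have hb' : ∀ k, ![m, u, l] k ∈ C.H0 C.K := by
    intro k
    fin_cases k
    exacts [hb 0, ha 1, hb 2]
  have h0 : twist ![y, u, x] ![m, -v, l] ![0, κ, γ] 0 = m + γ • -u + κ • x := by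
    simp only [twist, Matrix.cons_val, Matrix.cons_val_zero, Matrix.cons_val_one]
    module
  have h1 : twist ![y, u, x] ![m, -v, l] ![0, κ, γ] 1 = -v + γ • y := by
    simp only [twist, Matrix.cons_val, Matrix.cons_val_zero, Matrix.cons_val_one]
    module
  refine ⟨![y, u, x], twist ![y, u, x] ![m, -v, l] ![0, κ, γ], h5, ha, twist_mem ha hb _,
    sum_mul_twist hab _, hx0, h0 ▸ he0, h1 ▸ hd0, ?_, fun k => ?_, fun k => ?_⟩
  · have h2 := twist_mem ha hb ![0, κ, γ]
    have h3 := h2 0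
    have h4 := h2 1
    rw [h0] at h3
    rw [h1] at h4
    rw [h0, h1]
    exact gcdDiv_eq_neg he0 hd0 h3 h4 hcommon
  · exact (finrank_ker_skew_twist ha hb _ k).trans
      (finrank_ker_le_of_points hn (by omega) hG hpair _ k)
  · exact (finrank_ker_twist_skew ha hb _ k).trans
      ((finrank_ker_skew_swap ha hb k (skew_mem ha' hb')).trans
        (finrank_ker_le_of_points hn (by omega) hG hpair' _ k))

end points

theorem isKoszul_RL_K (hHE : ¬ C.Hyperelliptic) (hTri : ¬ C.Trigonal)
    (hPQ : ¬ C.IsPlaneQuintic) : (C.RL C.K).IsKoszul := by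
  have h4 := four_le_genus hHE hTri
  obtain ⟨n, hn⟩ : ∃ n, n + 2 = C.genus := ⟨C.genus - 2, by omega⟩
  obtain ⟨p, hp, hG, hbad | ⟨i, j, hij, k, hik, hjk, hbad⟩⟩ := bad_dichotomy hHE hTri hn
  · exact (false_of_all_bad hHE hTri hPQ hn hp hG hbad).elim
  · have h3 : 3 ≤ n := by
      have h1 := i.2
      have h2 := j.2
      have h3 := k.2
      have h5 := Fin.val_ne_of_ne hij
      have h6 := Fin.val_ne_of_ne hik
      have h7 := Fin.val_ne_of_ne hjk
      omega
    obtain ⟨a, b, h⟩ := hG.exists_koszulPair hn hp hij (by omega) hbad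
    exact h.isKoszul_RL

end Curve

/-!  ### STATEMENT 6

Let `C` be a smooth connected projective complex curve which is non-hyperelliptic,
non-trigonal, and not a smooth plane quintic.  Then the canonical algebra
`R_K = ⊕_{n≥0} H⁰(C, Kⁿ)` is Koszul. -/
theorem canonical_algebra_koszul (C : Curve)
    (hHE : ¬ C.Hyperelliptic) (hTri : ¬ C.Trigonal) (hPQ : ¬ C.IsPlaneQuintic) :
    (C.RL C.K).IsKoszul :=
  Curve.isKoszul_RL_K hHE hTri hPQ

end
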